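/- Let n ≥ 2, let A(D) be an elliptic homogeneous linear differential operator of order k on ℝⁿ from V to E, and let ℓ ∈ {1, …, min(k, n−1)}. Then there exists a constant C > 0 such that (∫_{ℝⁿ} |D^{k−ℓ}u(x)|^{n/(n−ℓ)} dx)^{1−ℓ/n} ≤ C ∫_{ℝⁿ} |A(D)u(x)| dx holds for every u ∈ C_c^∞(ℝⁿ; V) if and only if A(D) is canceling. -/

import Mathlib

open MeasureTheory ENNReal
open scoped NNReal RealInnerProductSpace

noncomputable section

/-- A homogeneous linear differential operator `A(D)` of order `k` from `V` to `E` on a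
Euclidean space `X`, represented through its action `u ↦ A (D^k u)` on the `k`-th
iterated (Fréchet) derivative; this is equivalent to the data of a family of coefficients
`(A_α)_{|α| = k}`, `A_α ∈ 𝓛(V; E)`, acting by `A(D)u = ∑_{|α|=k} A_α (∂^α u)`. -/
abbrev DiffOperator (X : Type*) [NormedAddCommGroup X] [InnerProductSpace ℝ X]
    (k : ℕ) (V E : Type*) [NormedAddCommGroup V] [NormedSpace ℝ V]
    [NormedAddCommGroup E] [NormedSpace ℝ E] :=
  ContinuousMultilinearMap ℝ (fun _ : Fin k => X) V →L[ℝ] E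

namespace DiffOperator

variable {X : Type*} [NormedAddCommGroup X] [InnerProductSpace ℝ X]
  {k : ℕ} {V E : Type*} [NormedAddCommGroup V] [NormedSpace ℝ V]
  [NormedAddCommGroup E] [NormedSpace ℝ E]

/-- The action `A(D)u` of the differential operator on a function `u : X → V`. -/
noncomputable def app (A : DiffOperator X k V E) (u : X → V) (x : X) : E :=
  A (iteratedFDeriv ℝ k u x)

/-- The symbol `A(ξ) = ∑_{|α|=k} ξ^α A_α ∈ 𝓛(V; E)` of the operator: it sends `v : V` to
`A` applied to the `k`-linear map `(w₁, …, w_k) ↦ (⟪ξ,w₁⟫ ⋯ ⟪ξ,w_k⟫) • v`. -/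
noncomputable def symbol (A : DiffOperator X k V E) (ξ : X) : V →L[ℝ] E :=
  A.comp (((ContinuousMultilinearMap.compContinuousLinearMapL
      (fun _ : Fin k => innerSL ℝ ξ)).comp
    (ContinuousMultilinearMap.piFieldEquiv ℝ (Fin k)
      V).toContinuousLinearEquiv.toContinuousLinearMap))

/-- `A(D)` is elliptic if its symbol `A(ξ)` is injective for every `ξ ≠ 0`. -/
def IsElliptic (A : DiffOperator X k V E) : Prop :=
  ∀ ξ : X, ξ ≠ 0 → Function.Injective (A.symbol ξ)

/-- `A(D)` is canceling if `⋂_{ξ ≠ 0} A(ξ)[V] = {0}`. -/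
def IsCanceling (A : DiffOperator X k V E) : Prop :=
  (⋂ (ξ : X) (_ : ξ ≠ 0), Set.range (A.symbol ξ)) = {0}

end DiffOperator

/-- `u ∈ C_c^∞`: a smooth compactly supported function. -/
def IsTestFun {X V : Type*} [NormedAddCommGroup X] [NormedSpace ℝ X]
    [NormedAddCommGroup V] [NormedSpace ℝ V] (u : X → V) : Prop :=
  ContDiff ℝ (⊤ : ℕ∞) u ∧ HasCompactSupport u

section fourierApp
open FourierTransform Real

/-- The rank-one `k`-tensor `(w₁, …, w_k) ↦ (∏ ⟪ξ, wᵢ⟫) • v`. -/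
def tens {X : Type*} [NormedAddCommGroup X] [InnerProductSpace ℝ X] {V : Type*}
    [NormedAddCommGroup V] [NormedSpace ℝ V] (k : ℕ) (ξ : X) :
    V →L[ℝ] ContinuousMultilinearMap ℝ (fun _ : Fin k => X) V :=
  ((ContinuousMultilinearMap.compContinuousLinearMapL
      (fun _ : Fin k => innerSL ℝ ξ)).comp
    (ContinuousMultilinearMap.piFieldEquiv ℝ (Fin k)
      V).toContinuousLinearEquiv.toContinuousLinearMap)

theorem tens_apply {X : Type*} [NormedAddCommGroup X] [InnerProductSpace ℝ X] {V : Type*}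
    [NormedAddCommGroup V] [NormedSpace ℝ V] (k : ℕ) (ξ : X) (v : V) (w : Fin k → X) :
    tens k ξ v w = (∏ i, ⟪ξ, w i⟫) • v := by
  simp [tens, ContinuousMultilinearMap.piFieldEquiv]

theorem symbol_eq {X : Type*} [NormedAddCommGroup X] [InnerProductSpace ℝ X]
    {k : ℕ} {V E : Type*} [NormedAddCommGroup V] [NormedSpace ℝ V]
    [NormedAddCommGroup E] [NormedSpace ℝ E] (A : DiffOperator X k V E) (ξ : X) (v : V) :
    A.symbol ξ v = A (tens k ξ v) := rfl

theorem IsTestFun.fderiv {X V : Type*} [NormedAddCommGroup X] [NormedSpace ℝ X]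
    [NormedAddCommGroup V] [NormedSpace ℝ V] {u : X → V} (hu : IsTestFun u) :
    IsTestFun (fderiv ℝ u) :=
  ⟨hu.1.fderiv_right (m := (⊤ : ℕ∞)) (by simp), hu.2.fderiv ℝ⟩

theorem IsTestFun.clm {X V W : Type*} [NormedAddCommGroup X] [NormedSpace ℝ X]
    [NormedAddCommGroup V] [NormedSpace ℝ V] [NormedAddCommGroup W] [NormedSpace ℝ W]
    {u : X → V} (hu : IsTestFun u) (L : V →L[ℝ] W) : IsTestFun (fun x => L (u x)) :=
  ⟨L.contDiff.comp hu.1, hu.2.comp_left (g := L) (map_zero L)⟩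

variable {X : Type} [NormedAddCommGroup X] [InnerProductSpace ℝ X] [FiniteDimensional ℝ X]
  [MeasurableSpace X] [BorelSpace X]

theorem fourier_fderiv_apply {g : X → ℂ} (hg : IsTestFun g) (m ξ : X) :
    𝓕 (fun y => fderiv ℝ g y m) ξ = (2 * π * Complex.I) * (⟪ξ, m⟫ * 𝓕 g ξ) := by
  have h := SchwartzMap.fourier_lineDerivOp_eq (hg.2.toSchwartzMap hg.1) m
  have h2 := congrArg (fun f : SchwartzMap X ℂ => f ξ) h
  have : (inner ℝ · m : X → ℝ).HasTemperateGrowth := ((innerSL ℝ).flip m).hasTemperateGrowth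
  simp [SchwartzMap.fourier_coe, this, SchwartzMap.smulLeftCLM_apply_apply] at h2
  exact h2

theorem fourier_fderiv_gen {V : Type*} [NormedAddCommGroup V] [NormedSpace ℝ V]
    {u : X → V} (hu : IsTestFun u) (S : (X →L[ℝ] V) →L[ℝ] ℂ) (ξ : X) :
    𝓕 (fun y => S (fderiv ℝ u y)) ξ =
      (2 * π * Complex.I) * 𝓕 (fun y => S ((innerSL ℝ ξ).smulRight (u y))) ξ := by
  classical
  set b := stdOrthonormalBasis ℝ X
  have hS : ∀ L : X →L[ℝ] V, S L = ∑ i, S ((innerSL ℝ (b i)).smulRight (L (b i))) := by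
    intro L
    rw [← map_sum]
    congr 1
    ext x
    simp only [sum_apply, ContinuousLinearMap.smulRight_apply,
      innerSL_apply_apply]
    conv_lhs => rw [← b.sum_repr' x]
    simp
  set Q : ∀ i, V →L[ℝ] ℂ := fun i => S.comp
    ((ContinuousLinearMap.smulRightL ℝ X V) (innerSL ℝ (b i))) with hQ
  have hQt : ∀ i, IsTestFun (fun y => Q i (u y)) := fun i => hu.clm (Q i)
  have h1 : (fun y => S (fderiv ℝ u y)) =
      fun y => ∑ i, fderiv ℝ (fun z => Q i (u z)) y (b i) := by
    ext y
    rw [hS]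
    refine Finset.sum_congr rfl fun i _ => ?_
    have hd : DifferentiableAt ℝ u y := (hu.1.differentiable (by simp)).differentiableAt
    have := ((Q i).hasFDerivAt.comp y hd.hasFDerivAt).fderiv
    simp only [Function.comp_def] at this
    rw [this]
    simp [hQ]
  have h2 : (fun y => S ((innerSL ℝ ξ).smulRight (u y))) =
      fun y => ∑ i, (⟪ξ, b i⟫ : ℂ) * Q i (u y) := by
    ext y
    rw [hS]
    refine Finset.sum_congr rfl fun i _ => ?_
    have : (innerSL ℝ (b i)).smulRight (((innerSL ℝ ξ).smulRight (u y)) (b i))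
      = (⟪ξ, b i⟫ : ℝ) • ((innerSL ℝ (b i)).smulRight (u y)) := by
      ext x
      simp [smul_smul, mul_comm]
    rw [this, map_smul]
    simp [hQ]
  have hIntg : ∀ g : X → ℂ, IsTestFun g → ∀ ξ : X, Integrable (fun y => 𝐞 (-⟪y, ξ⟫) • g y) := by
    intro g hg ξ
    have := (hg.1.continuous.integrable_of_hasCompactSupport hg.2 : Integrable g)
    simpa using (Real.fourierIntegral_convergent_iff ξ).2 this
  have hfd : ∀ i, IsTestFun (fun y => fderiv ℝ (fun z => Q i (u z)) y (b i)) := fun i =>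
    (hQt i).fderiv.clm (ContinuousLinearMap.apply ℝ ℂ (b i))
  have h3 : 𝓕 (fun y => ∑ i, fderiv ℝ (fun z => Q i (u z)) y (b i)) ξ
      = ∑ i, 𝓕 (fun y => fderiv ℝ (fun z => Q i (u z)) y (b i)) ξ := by
    simp only [Real.fourier_eq, Finset.smul_sum]
    rw [integral_finsetSum _ (fun i _ => hIntg _ (hfd i) ξ)]
  have h4 : 𝓕 (fun y => ∑ i, (⟪ξ, b i⟫ : ℂ) * Q i (u y)) ξ
      = ∑ i, (⟪ξ, b i⟫ : ℂ) * 𝓕 (fun y => Q i (u y)) ξ := by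
    simp only [Real.fourier_eq, Finset.smul_sum, ← integral_const_mul]
    rw [integral_finsetSum]
    · refine Finset.sum_congr rfl fun i _ => ?_
      congr 1
      ext y
      simp [Circle.smul_def]; ring
    · intro i _
      have := (hIntg _ (hQt i) ξ).const_mul (⟪ξ, b i⟫ : ℂ)
      refine this.congr (Filter.Eventually.of_forall fun y => ?_)
      simp [Circle.smul_def]; ring
  rw [h1, h2, h3, h4, Finset.mul_sum]
  exact Finset.sum_congr rfl fun i _ => fourier_fderiv_apply (hQt i) (b i) ξ

/-- Fourier transform of a linear functional of the `k`-th derivative. -/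
theorem fourier_iter {V : Type*} [NormedAddCommGroup V] [NormedSpace ℝ V] (k : ℕ)
    {u : X → V} (hu : IsTestFun u)
    (T : ContinuousMultilinearMap ℝ (fun _ : Fin k => X) V →L[ℝ] ℂ) (ξ : X) :
    𝓕 (fun y => T (iteratedFDeriv ℝ k u y)) ξ =
      (2 * π * Complex.I) ^ k * 𝓕 (fun y => T (tens k ξ (u y))) ξ := by
  induction k generalizing V with
  | zero =>
    have : ∀ y, iteratedFDeriv ℝ 0 u y = tens 0 ξ (u y) := by
      intro y; ext w; simp [tens_apply]
    simp [this]
  | succ k ih =>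
    set R := (continuousMultilinearCurryRightEquiv' ℝ k X V).symm.toContinuousLinearEquiv.toContinuousLinearMap
    have h1 : (fun y => T (iteratedFDeriv ℝ (k + 1) u y)) =
        fun y => (T.comp R) (iteratedFDeriv ℝ k (fderiv ℝ u) y) := by
      ext y; rw [iteratedFDeriv_succ_eq_comp_right]; rfl
    rw [h1, ih hu.fderiv (T.comp R)]
    have h2 := fourier_fderiv_gen hu ((T.comp R).comp (tens k ξ)) ξ
    simp only [ContinuousLinearMap.comp_apply] at h2 ⊢
    rw [h2, ← mul_assoc, pow_succ]
    suffices h : ∀ y, R (tens k ξ ((innerSL ℝ ξ).smulRight (u y))) = tens (k + 1) ξ (u y) by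
      simp only [h]
    intro y
    ext w
    have : R (tens k ξ ((innerSL ℝ ξ).smulRight (u y))) w =
      tens k ξ ((innerSL ℝ ξ).smulRight (u y)) (Fin.init w) (w (Fin.last k)) := by
      exact continuousMultilinearCurryRightEquiv_symm_apply' _ _
    rw [this]
    simp [tens_apply, Fin.prod_univ_castSucc, smul_smul, Fin.init]

end fourierApp

section leftInv
open FourierTransform Real

variable {X : Type} [NormedAddCommGroup X] [InnerProductSpace ℝ X] [FiniteDimensional ℝ X]
  [MeasurableSpace X] [BorelSpace X]

/-- Fubini form of the multiplication formula. -/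
theorem pairing_fourier {E : Type*} [NormedAddCommGroup E] [NormedSpace ℝ E]
    (Ψ : SchwartzMap X (E →L[ℝ] ℂ)) {f : X → E} (hf : Continuous f) (hfc : HasCompactSupport f) :
    ∫ y, (𝓕 (Ψ : X → (E →L[ℝ] ℂ)) y) (f y) = ∫ ξ, 𝓕 (fun y => Ψ ξ (f y)) ξ := by
  have hfi : Integrable f := hf.integrable_of_hasCompactSupport hfc
  have hΨi : Integrable Ψ := Ψ.integrable
  have h1 : ∀ y, (𝓕 (Ψ : X → (E →L[ℝ] ℂ)) y) (f y) = ∫ ξ, 𝐞 (-⟪ξ, y⟫) • (Ψ ξ (f y)) := by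
    intro y
    rw [Real.fourier_eq, ContinuousLinearMap.integral_apply]
    · rfl
    · exact (Real.fourierIntegral_convergent_iff y).2 hΨi
  simp_rw [h1, Real.fourier_eq]
  rw [integral_integral_swap]
  · simp_rw [real_inner_comm]
  · refine Integrable.mono' (hfi.norm.mul_prod hΨi.norm) ?_ ?_
    · apply Continuous.aestronglyMeasurable
      have := Ψ.continuous
      simp only [Function.uncurry_def, Circle.smul_def]
      have h3 : Continuous fun x : X × X => ((𝐞 (-⟪x.2, x.1⟫) : Circle) : ℂ) := by fun_prop
      exact h3.smul ((this.comp continuous_snd).clm_apply (hf.comp continuous_fst))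
    · refine Filter.Eventually.of_forall fun x => ?_
      simp only [Function.uncurry_def, Circle.norm_smul]
      rw [mul_comm]
      exact (Ψ x.2).le_opNorm _

theorem IsTestFun.app {X : Type*} [NormedAddCommGroup X] [InnerProductSpace ℝ X]
    {k : ℕ} {V E : Type*} [NormedAddCommGroup V] [NormedSpace ℝ V]
    [NormedAddCommGroup E] [NormedSpace ℝ E] (A : DiffOperator X k V E) {u : X → V}
    (hu : IsTestFun u) : IsTestFun (A.app u) := by
  have h1 : IsTestFun (iteratedFDeriv ℝ k u) :=
    ⟨hu.1.iteratedFDeriv_right (m := (⊤ : ℕ∞)) (by exact_mod_cast le_top),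
      hu.2.iteratedFDeriv k⟩
  exact h1.clm A

theorem pairing_app {k : ℕ} {V E : Type*} [NormedAddCommGroup V] [NormedSpace ℝ V]
    [NormedAddCommGroup E] [NormedSpace ℝ E] (A : DiffOperator X k V E)
    (Ψ : SchwartzMap X (E →L[ℝ] ℂ)) {u : X → V} (hu : IsTestFun u) :
    ∫ y, (𝓕 (Ψ : X → (E →L[ℝ] ℂ)) y) (A.app u y) =
      (2 * π * Complex.I) ^ k * ∫ ξ, 𝓕 (fun y => Ψ ξ (A.symbol ξ (u y))) ξ := by
  rw [pairing_fourier Ψ (hu.app A).1.continuous (hu.app A).2, ← integral_const_mul]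
  congr 1
  ext ξ
  exact fourier_iter k hu ((Ψ ξ).comp A) ξ

section
variable {X : Type*} [NormedAddCommGroup X] [InnerProductSpace ℝ X] [FiniteDimensional ℝ X]
  {k : ℕ} {V E : Type*} [NormedAddCommGroup V] [InnerProductSpace ℝ V]
  [FiniteDimensional ℝ V] [NormedAddCommGroup E] [InnerProductSpace ℝ E] [FiniteDimensional ℝ E]

theorem contDiff_tens {V : Type*} [NormedAddCommGroup V] [NormedSpace ℝ V] :
    ContDiff ℝ (⊤ : ℕ∞) (fun ξ : X =>
      (tens k ξ : V →L[ℝ] ContinuousMultilinearMap ℝ (fun _ : Fin k => X) V)) := by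
  unfold tens
  have h := (ContinuousMultilinearMap.compContinuousLinearMapContinuousMultilinear ℝ
    (fun _ : Fin k => X) (fun _ : Fin k => ℝ) V).contDiff (n := (⊤ : ℕ∞))
  have h2 : ContDiff ℝ (⊤ : ℕ∞) (fun ξ : X => (fun _ : Fin k => innerSL ℝ ξ)) := by
    rw [contDiff_pi]; intro i; exact (innerSL ℝ (E := X)).contDiff
  exact (h.comp h2).clm_comp contDiff_const

theorem contDiff_symbol (A : DiffOperator X k V E) :
    ContDiff ℝ (⊤ : ℕ∞) (fun ξ : X => A.symbol ξ) :=
  (contDiff_const (c := (A : ContinuousMultilinearMap ℝ (fun _ : Fin k => X) V →L[ℝ] E))).clm_comp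
    (contDiff_tens (k := k) (V := V))

/-- The real adjoint as a continuous linear map. -/
def adjL (V E : Type*) [NormedAddCommGroup V] [InnerProductSpace ℝ V]
    [FiniteDimensional ℝ V] [NormedAddCommGroup E] [InnerProductSpace ℝ E]
    [FiniteDimensional ℝ E] : (V →L[ℝ] E) →L[ℝ] (E →L[ℝ] V) :=
  LinearMap.mkContinuous
    { toFun := fun T => ContinuousLinearMap.adjoint T
      map_add' := by intro a b; simp
      map_smul' := by intro a b; simp } 1 (by intro x; simp)

/-- The left inverse `(A^* A)⁻¹ A^*` of the symbol. -/
def linv (A : DiffOperator X k V E) (ξ : X) : E →L[ℝ] V :=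
  (ContinuousLinearMap.inverse ((adjL V E (A.symbol ξ)).comp (A.symbol ξ))).comp
    (adjL V E (A.symbol ξ))

theorem exists_equiv_symbol (A : DiffOperator X k V E) (hA : A.IsElliptic) {ξ : X} (hξ : ξ ≠ 0) :
    ∃ e : V ≃L[ℝ] V, (e : V →L[ℝ] V) = (adjL V E (A.symbol ξ)).comp (A.symbol ξ) := by
  have hinj : Function.Injective ((adjL V E (A.symbol ξ)).comp (A.symbol ξ)) := by
    rw [injective_iff_map_eq_zero]
    intro v hv
    have : ⟪(ContinuousLinearMap.adjoint (A.symbol ξ)) (A.symbol ξ v), v⟫ = 0 := by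
      change (ContinuousLinearMap.adjoint (A.symbol ξ)) (A.symbol ξ v) = 0 at hv
      rw [hv, inner_zero_left]
    rw [ContinuousLinearMap.adjoint_inner_left, inner_self_eq_zero] at this
    exact (injective_iff_map_eq_zero _).1 (hA ξ hξ) v this
  refine ⟨(LinearEquiv.ofInjectiveEndo _ hinj).toContinuousLinearEquiv, ?_⟩
  ext v; rfl

theorem linv_comp (A : DiffOperator X k V E) (hA : A.IsElliptic) {ξ : X} (hξ : ξ ≠ 0) (v : V) :
    linv A ξ (A.symbol ξ v) = v := by
  obtain ⟨e, he⟩ := exists_equiv_symbol A hA hξ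
  unfold linv
  rw [← he, ContinuousLinearMap.inverse_equiv]
  have : (e : V →L[ℝ] V) v = adjL V E (A.symbol ξ) (A.symbol ξ v) := by rw [he]; rfl
  simp only [ContinuousLinearMap.comp_apply]
  rw [← this]
  simp

theorem contDiffAt_linv (A : DiffOperator X k V E) (hA : A.IsElliptic) {ξ : X} (hξ : ξ ≠ 0) :
    ContDiffAt ℝ (⊤ : ℕ∞) (linv A) ξ := by
  obtain ⟨e, he⟩ := exists_equiv_symbol A hA hξ
  have h1 : ContDiffAt ℝ (⊤ : ℕ∞) (fun ξ : X => A.symbol ξ) ξ := (contDiff_symbol A).contDiffAt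
  have h2 : ContDiffAt ℝ (⊤ : ℕ∞) (fun ξ : X => adjL V E (A.symbol ξ)) ξ :=
    (adjL V E).contDiff.contDiffAt.comp ξ h1
  have h3 : ContDiffAt ℝ (⊤ : ℕ∞) (ContinuousLinearMap.inverse : (V →L[ℝ] V) → (V →L[ℝ] V))
      ((adjL V E (A.symbol ξ)).comp (A.symbol ξ)) := by
    rw [← he]; exact contDiffAt_map_inverse e
  exact (ContDiffAt.comp ξ h3 (h2.clm_comp h1)).clm_comp h2

/-- Cut-off of a function smooth away from zero. -/
theorem contDiff_cutoff {W : Type*} [NormedAddCommGroup W] [NormedSpace ℝ W] {F : X → W}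
    (hF : ∀ ξ, ξ ≠ 0 → ContDiffAt ℝ (⊤ : ℕ∞) F ξ) {χ : X → ℝ} (hχ : ContDiff ℝ (⊤ : ℕ∞) χ)
    (h0 : 0 ∉ tsupport χ) : ContDiff ℝ (⊤ : ℕ∞) (fun ξ => χ ξ • F ξ) := by
  rw [contDiff_iff_contDiffAt]
  intro ξ
  by_cases hξ : ξ = 0
  · subst hξ
    have : (fun ξ => χ ξ • F ξ) =ᶠ[nhds 0] fun _ => 0 := by
      filter_upwards [(isClosed_tsupport χ).isOpen_compl.mem_nhds h0] with x hx
      rw [image_eq_zero_of_notMem_tsupport hx, zero_smul]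
    exact contDiffAt_const.congr_of_eventuallyEq this
  · exact hχ.contDiffAt.smul (hF ξ hξ)

end
end leftInv

section cancelSec
open FourierTransform Real

variable {X : Type} [NormedAddCommGroup X] [InnerProductSpace ℝ X] [FiniteDimensional ℝ X]
  [MeasurableSpace X] [BorelSpace X]
  {k : ℕ} {V E : Type*} [NormedAddCommGroup V] [InnerProductSpace ℝ V]
  [FiniteDimensional ℝ V] [NormedAddCommGroup E] [InnerProductSpace ℝ E] [FiniteDimensional ℝ E]

/-- Schwartz kernels annihilating the image of `A(D)`. -/
def annih (A : DiffOperator X k V E) : Submodule ℝ (SchwartzMap X (E →L[ℝ] ℂ)) where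
  carrier := {Φ | ∀ u : X → V, IsTestFun u → ∫ y, Φ y (A.app u y) = 0}
  zero_mem' := by intro u hu; simp
  add_mem' := by
    intro a b ha hb u hu
    have hi : ∀ Φ : SchwartzMap X (E →L[ℝ] ℂ), Integrable (fun y => Φ y (A.app u y)) := fun Φ =>
      (Φ.continuous.clm_apply (hu.app A).1.continuous).integrable_of_hasCompactSupport
        ((hu.app A).2.mono (fun y hy h => hy (by simp [h])))
    simp only [add_apply]
    rw [integral_add (hi a) (hi b), ha u hu, hb u hu, add_zero]
  smul_mem' := by
    intro c a ha u hu
    simp only [smul_apply]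
    rw [integral_smul, ha u hu, smul_zero]

/-- The projection `1 - A(ξ) A(ξ)^{-1}`. -/
def cproj (A : DiffOperator X k V E) (ξ : X) : E →L[ℝ] E :=
  ContinuousLinearMap.id ℝ E - (A.symbol ξ).comp (linv A ξ)

theorem contDiffAt_cproj (A : DiffOperator X k V E) (hA : A.IsElliptic) {ξ : X} (hξ : ξ ≠ 0) :
    ContDiffAt ℝ (⊤ : ℕ∞) (cproj A) ξ :=
  contDiffAt_const.sub ((contDiff_symbol A).contDiffAt.clm_comp (contDiffAt_linv A hA hξ))

theorem contDiff_cut_cproj (A : DiffOperator X k V E) (hA : A.IsElliptic) {χ : X → ℝ}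
    (hχ : ContDiff ℝ (⊤ : ℕ∞) χ)
    (h0 : 0 ∉ tsupport χ) (θ : E →L[ℝ] ℂ) :
    ContDiff ℝ (⊤ : ℕ∞) (fun ξ => χ ξ • θ.comp (cproj A ξ)) :=
  contDiff_cutoff (W := E →L[ℝ] ℂ) (fun ξ hξ =>
    ((ContinuousLinearMap.compL ℝ E E ℂ) θ).contDiff.contDiffAt.comp ξ
      (contDiffAt_cproj A hA hξ)) hχ h0

theorem hasCompactSupport_smul {W : Type*} [NormedAddCommGroup W] [NormedSpace ℝ W] {χ : X → ℝ}
    (h : HasCompactSupport χ) (F : X → W) : HasCompactSupport (fun x => χ x • F x) :=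
  h.mono (fun y hy h => hy (by simp [h]))

theorem annih_spec (A : DiffOperator X k V E) (hA : A.IsElliptic) {χ : X → ℝ} (hχ : IsTestFun χ)
    (h0 : 0 ∉ tsupport χ) (θ : E →L[ℝ] ℂ) :
    ∃ Φ ∈ annih A, Φ 0 = ∫ ξ, χ ξ • θ.comp (cproj A ξ) := by
  have hF : ContDiff ℝ (⊤ : ℕ∞) (fun ξ => χ ξ • θ.comp (cproj A ξ)) :=
    contDiff_cut_cproj A hA hχ.1 h0 θ
  have hc : HasCompactSupport (fun ξ => χ ξ • θ.comp (cproj A ξ)) :=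
    hasCompactSupport_smul hχ.2 (fun ξ => θ.comp (cproj A ξ))
  obtain ⟨Ψ, hΨ⟩ : ∃ Ψ : SchwartzMap X (E →L[ℝ] ℂ), ∀ ξ, Ψ ξ = χ ξ • θ.comp (cproj A ξ) :=
    ⟨hc.toSchwartzMap hF, fun _ => rfl⟩
  refine ⟨𝓕 Ψ, ?_, ?_⟩
  · intro u hu
    rw [SchwartzMap.fourier_coe, pairing_app A _ hu]
    have : ∀ ξ y, Ψ ξ (A.symbol ξ (u y)) = 0 := by
      intro ξ y
      rw [hΨ]
      by_cases hξ : ξ = 0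
      · subst hξ; rw [image_eq_zero_of_notMem_tsupport h0]; simp
      · simp [cproj, linv_comp A hA hξ]
    simp only [this]
    simp [Real.fourier_eq]
  · rw [SchwartzMap.fourier_coe, Real.fourier_eq]
    simp [hΨ]

theorem cproj_functional_zero (A : DiffOperator X k V E) (hA : A.IsElliptic)
    (Λ : (E →L[ℝ] ℂ) →L[ℝ] ℝ) (hΛ : ∀ Φ ∈ annih A, Λ (Φ 0) = 0) (θ : E →L[ℝ] ℂ) {ξ : X}
    (hξ : ξ ≠ 0) : Λ (θ.comp (cproj A ξ)) = 0 := by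
  have hco : ContinuousOn (fun ξ => Λ (θ.comp (cproj A ξ))) ({0}ᶜ : Set X) := by
    intro x hx
    have := (Λ.comp ((ContinuousLinearMap.compL ℝ E E ℂ) θ)).continuous.continuousAt.comp
      (contDiffAt_cproj A hA hx).continuousAt
    exact this.continuousWithinAt
  have hae := isOpen_compl_singleton.ae_eq_zero_of_integral_contDiff_smul_eq_zero
    (μ := (volume : Measure X)) (hco.locallyIntegrableOn isOpen_compl_singleton.measurableSet) ?_
  · have h2 : (fun ξ => Λ (θ.comp (cproj A ξ))) =ᵐ[volume.restrict ({0}ᶜ : Set X)] fun _ => 0 := by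
      rw [Filter.EventuallyEq, ae_restrict_iff' isOpen_compl_singleton.measurableSet]
      exact hae
    exact Measure.eqOn_open_of_ae_eq h2 isOpen_compl_singleton hco continuousOn_const hξ
  · intro g hg hgc hgs
    have h0 : 0 ∉ tsupport g := fun h => hgs h rfl
    obtain ⟨Φ, hΦ, hΦ0⟩ := annih_spec A hA (χ := g) ⟨hg, hgc⟩ h0 θ
    have hF : ContDiff ℝ (⊤ : ℕ∞) (fun ξ => g ξ • θ.comp (cproj A ξ)) :=
      contDiff_cut_cproj A hA hg h0 θ
    have hi : Integrable (fun ξ => g ξ • θ.comp (cproj A ξ)) :=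
      hF.continuous.integrable_of_hasCompactSupport (hasCompactSupport_smul hgc (fun ξ => θ.comp (cproj A ξ)))
    have := hΛ Φ hΦ
    rw [hΦ0, ← Λ.integral_comp_comm hi] at this
    simpa using this

theorem annih_surj (A : DiffOperator X k V E) (hA : A.IsElliptic) (hc : A.IsCanceling)
    (θ : E →L[ℝ] ℂ) : ∃ Φ ∈ annih A, Φ 0 = θ := by
  let ev : SchwartzMap X (E →L[ℝ] ℂ) →ₗ[ℝ] (E →L[ℝ] ℂ) :=
    { toFun := fun Φ => Φ 0, map_add' := fun _ _ => rfl, map_smul' := fun _ _ => rfl }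
  suffices h : (annih A).map ev = ⊤ by
    have : θ ∈ (annih A).map ev := by rw [h]; trivial
    obtain ⟨Φ, h1, h2⟩ := this
    exact ⟨Φ, h1, h2⟩
  by_contra hne
  obtain ⟨Λ', hΛ'0, hΛ'⟩ := Submodule.exists_le_ker_of_lt_top _ (lt_top_iff_ne_top.2 hne)
  set Λ : (E →L[ℝ] ℂ) →L[ℝ] ℝ := LinearMap.toContinuousLinearMap Λ' with hΛdef
  have hΛ : ∀ Φ ∈ annih A, Λ (Φ 0) = 0 := by
    intro Φ hΦ
    exact hΛ' ⟨Φ, hΦ, rfl⟩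
  -- rank one functionals
  let B : ℂ → E →L[ℝ] (E →L[ℝ] ℂ) := fun z =>
    ((ContinuousLinearMap.compL ℝ E ℝ ℂ) (ContinuousLinearMap.toSpanSingleton ℝ z)).comp (innerSL ℝ)
  have hB : ∀ z x y, B z x y = (⟪x, y⟫ : ℂ) * z := by
    intro z x y; simp [B]
  have hz : ∀ z x, Λ (B z x) = 0 := by
    intro z
    set e : E := (InnerProductSpace.toDual ℝ E).symm (Λ.comp (B z)) with he
    have he2 : ∀ x, ⟪e, x⟫ = Λ (B z x) := by
      intro x; rw [he, InnerProductSpace.toDual_symm_apply]; rfl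
    have hemem : e ∈ (⋂ (ξ : X) (_ : ξ ≠ 0), Set.range (A.symbol ξ)) := by
      simp only [Set.mem_iInter]
      intro ξ hξ
      have h1 : ∀ x, ⟪cproj A ξ e, x⟫ = 0 := by
        intro x
        rw [← ContinuousLinearMap.adjoint_inner_right, he2,
          ← cproj_functional_zero A hA Λ hΛ (B z x) hξ]
        congr 1
        ext y
        simp [hB, ContinuousLinearMap.adjoint_inner_left]
      have h2 : cproj A ξ e = 0 := by
        have := h1 (cproj A ξ e)
        exact inner_self_eq_zero.1 this
      refine ⟨linv A ξ e, ?_⟩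
      simp [cproj] at h2
      exact (sub_eq_zero.1 h2).symm
    rw [hc] at hemem
    intro x
    rw [← he2, Set.mem_singleton_iff.1 hemem, inner_zero_left]
  apply hΛ'0
  ext θ
  change Λ θ = 0
  have : θ = B 1 ((InnerProductSpace.toDual ℝ E).symm (Complex.reCLM.comp θ)) +
      B Complex.I ((InnerProductSpace.toDual ℝ E).symm (Complex.imCLM.comp θ)) := by
    ext y
    simp [hB]
  rw [this, map_add, hz, hz, add_zero]

end cancelSec

section kernelSec
open FourierTransform Real

theorem schwartz_bd {X W : Type*} [NormedAddCommGroup X] [NormedSpace ℝ X]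
    [NormedAddCommGroup W] [NormedSpace ℝ W] (Φ : SchwartzMap X W) (N : ℕ) :
    ∃ C : ℝ, 0 ≤ C ∧ ∀ x, ‖Φ x‖ ≤ C / (1 + ‖x‖) ^ N := by
  refine ⟨2 ^ N * (Finset.Iic ((N, 0) : ℕ × ℕ)).sup
    (fun m => SchwartzMap.seminorm ℝ m.1 m.2) Φ, ?_, fun x => ?_⟩
  rotate_left
  · have h := SchwartzMap.one_add_le_sup_seminorm_apply (𝕜 := ℝ) (m := (N, 0)) le_rfl le_rfl Φ x
    rw [norm_iteratedFDeriv_zero] at h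
    rw [le_div_iff₀ (by positivity), mul_comm]
    exact h
  · exact mul_nonneg (by positivity) (apply_nonneg _ _)

theorem schwartz_lip {X W : Type*} [NormedAddCommGroup X] [NormedSpace ℝ X]
    [NormedAddCommGroup W] [NormedSpace ℝ W] (Φ : SchwartzMap X W) (N : ℕ) :
    ∃ C : ℝ, 0 ≤ C ∧ ∀ x y, ‖x - y‖ ≤ 1 → ‖Φ x - Φ y‖ ≤ C * ‖x - y‖ / (1 + ‖x‖) ^ N := by
  obtain ⟨D, hD0, hD⟩ : ∃ D : ℝ, 0 ≤ D ∧ ∀ x, ‖fderiv ℝ Φ x‖ ≤ D / (1 + ‖x‖) ^ N := by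
    refine ⟨2 ^ N * (Finset.Iic ((N, 1) : ℕ × ℕ)).sup
      (fun m => SchwartzMap.seminorm ℝ m.1 m.2) Φ, ?_, fun x => ?_⟩
    rotate_left
    · have h := SchwartzMap.one_add_le_sup_seminorm_apply (𝕜 := ℝ) (m := (N, 1)) le_rfl le_rfl Φ x
      rw [norm_iteratedFDeriv_one] at h
      rw [le_div_iff₀ (by positivity), mul_comm]
      exact h
    · exact mul_nonneg (by positivity) (apply_nonneg _ _)
  refine ⟨D * 2 ^ N, by positivity, fun x y hxy => ?_⟩
  have h := (convex_closedBall x 1).norm_image_sub_le_of_norm_fderiv_le (𝕜 := ℝ) (f := Φ)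
    (C := D * 2 ^ N / (1 + ‖x‖) ^ N) (x := y) (y := x)
    (fun z _ => Φ.differentiable.differentiableAt) (fun z hz => ?_)
    (by rw [mem_closedBall_iff_norm, norm_sub_rev]; exact hxy) (by simp)
  · refine h.trans (le_of_eq (by ring))
  · refine (hD z).trans ?_
    rw [div_le_div_iff₀ (by positivity) (by positivity), mul_assoc, ← mul_pow]
    refine mul_le_mul_of_nonneg_left (pow_le_pow_left₀ (by positivity) ?_ _) hD0
    rw [mem_closedBall_iff_norm] at hz
    have : ‖x‖ ≤ ‖z‖ + ‖z - x‖ := by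
      have := norm_sub_le z (z - x); simpa using this
    have := norm_nonneg z
    linarith

variable {X : Type} [NormedAddCommGroup X] [InnerProductSpace ℝ X] [FiniteDimensional ℝ X]
  [MeasurableSpace X] [BorelSpace X]
  {k : ℕ} {V E : Type*} [NormedAddCommGroup V] [InnerProductSpace ℝ V]
  [FiniteDimensional ℝ V] [NormedAddCommGroup E] [InnerProductSpace ℝ E] [FiniteDimensional ℝ E]

theorem annih_translate (A : DiffOperator X k V E) {Φ : SchwartzMap X (E →L[ℝ] ℂ)}
    (h : Φ ∈ annih A) (c : X) : Φ.compSubConstCLM ℝ c ∈ annih A := by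
  intro u hu
  have hu' : IsTestFun (fun y => u (y + c)) :=
    ⟨hu.1.comp (contDiff_id.add contDiff_const), hu.2.comp_homeomorph (Homeomorph.addRight c)⟩
  have := h _ hu'
  rw [← integral_add_right_eq_self _ c]
  rw [← this]
  congr 1
  ext y
  simp only [SchwartzMap.compSubConstCLM_apply, add_sub_cancel_right, DiffOperator.app]
  rw [iteratedFDeriv_comp_add_right]

theorem kernel_approx (A : DiffOperator X k V E) (hA : A.IsElliptic) (hc : A.IsCanceling)
    (κ : SchwartzMap X (E →L[ℝ] ℂ)) (N : ℕ) :
    ∃ C : ℝ, 0 ≤ C ∧ ∀ c, ∃ Φ ∈ annih A, ∀ y,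
      ‖κ y - Φ y‖ ≤ C * (min 1 ‖y - c‖ / (1 + ‖y‖) ^ N) := by
  classical
  set b := Module.finBasis ℝ (E →L[ℝ] ℂ)
  choose Φ hΦ hΦ0 using fun i => annih_surj A hA hc (b i)
  set co : ∀ i, (E →L[ℝ] ℂ) →L[ℝ] ℝ := fun i => LinearMap.toContinuousLinearMap (b.coord i)
  have hco : ∀ θ, ∑ i, co i θ • b i = θ := fun θ => b.sum_repr θ
  obtain ⟨C1, hC1, h1⟩ := schwartz_bd κ N
  obtain ⟨C2, hC2, h2⟩ := schwartz_lip κ N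
  choose C3 hC3 h3 using fun i => schwartz_bd (Φ i) N
  choose C4 hC4 h4 using fun i => schwartz_lip (Φ i) N
  have hcok : ∀ i c, |co i (κ c)| ≤ ‖co i‖ * C1 / (1 + ‖c‖) ^ N := by
    intro i c
    refine ((co i).le_opNorm _).trans ?_
    rw [mul_div_assoc]
    exact mul_le_mul_of_nonneg_left (h1 c) (norm_nonneg _)
  refine ⟨(C1 + ∑ i, ‖co i‖ * C1 * C3 i) + (C2 + ∑ i, ‖co i‖ * C1 * 2 ^ N * C4 i), ?_, ?_⟩
  · have : ∀ i, 0 ≤ ‖co i‖ * C1 * C3 i := fun i => by have := hC3 i; positivity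
    have h' : ∀ i, 0 ≤ ‖co i‖ * C1 * 2 ^ N * C4 i := fun i => by have := hC4 i; positivity
    have := Finset.sum_nonneg fun i (_ : i ∈ Finset.univ) => this i
    have := Finset.sum_nonneg fun i (_ : i ∈ Finset.univ) => h' i
    linarith
  intro c
  refine ⟨∑ i, co i (κ c) • (Φ i).compSubConstCLM ℝ c, Submodule.sum_mem _ fun i _ =>
    Submodule.smul_mem _ _ (annih_translate A (hΦ i) c), fun y => ?_⟩
  have hval : (∑ i, co i (κ c) • (Φ i).compSubConstCLM ℝ c) y
      = ∑ i, co i (κ c) • Φ i (y - c) := by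
    simp [sum_apply, smul_apply]
  have hS1 : 0 ≤ ∑ i, ‖co i‖ * C1 * C3 i :=
    Finset.sum_nonneg fun i _ => by have := hC3 i; positivity
  have hS2 : 0 ≤ ∑ i, ‖co i‖ * C1 * 2 ^ N * C4 i :=
    Finset.sum_nonneg fun i _ => by have := hC4 i; positivity
  have htri : ‖y‖ ≤ ‖c‖ + ‖y - c‖ := by
    have := norm_add_le c (y - c); simpa using this
  rw [hval]
  rcases le_total 1 ‖y - c‖ with hd | hd
  · rw [min_eq_left hd]
    have hA1 : ‖κ y - ∑ i, co i (κ c) • Φ i (y - c)‖ ≤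
        C1 / (1 + ‖y‖) ^ N + ∑ i, (‖co i‖ * C1 * C3 i) / (1 + ‖y‖) ^ N := by
      refine (norm_sub_le _ _).trans (add_le_add (h1 y) ((norm_sum_le _ _).trans
        (Finset.sum_le_sum fun i _ => ?_)))
      rw [norm_smul]
      refine (mul_le_mul (hcok i c) (h3 i _) (norm_nonneg _) (by positivity)).trans ?_
      rw [div_mul_div_comm, ← mul_pow]
      have := hC3 i
      refine div_le_div_of_nonneg_left (by positivity) (by positivity)
        (pow_le_pow_left₀ (by positivity) ?_ _)
      nlinarith [norm_nonneg c, norm_nonneg (y - c), norm_nonneg y]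
    refine hA1.trans ?_
    rw [← Finset.sum_div, ← add_div, mul_one_div]
    exact div_le_div_of_nonneg_right (by linarith) (by positivity)
  · rw [min_eq_right hd]
    have hA1 : ‖κ y - ∑ i, co i (κ c) • Φ i (y - c)‖ ≤
        C2 * ‖y - c‖ / (1 + ‖y‖) ^ N +
          ∑ i, (‖co i‖ * C1 * 2 ^ N * C4 i) * ‖y - c‖ / (1 + ‖y‖) ^ N := by
      have : κ y - ∑ i, co i (κ c) • Φ i (y - c) =
          (κ y - κ c) - ∑ i, co i (κ c) • (Φ i (y - c) - Φ i 0) := by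
        simp only [smul_sub, Finset.sum_sub_distrib, hΦ0, hco]
        abel
      rw [this]
      refine (norm_sub_le _ _).trans (add_le_add (h2 y c hd) ((norm_sum_le _ _).trans
        (Finset.sum_le_sum fun i _ => ?_)))
      rw [norm_smul]
      have h5 : ‖Φ i (y - c) - Φ i 0‖ ≤ C4 i * ‖y - c‖ := by
        have := h4 i (y - c) 0 (by simpa using hd)
        rw [sub_zero] at this
        refine this.trans (div_le_self (mul_nonneg (hC4 i) (norm_nonneg _)) ?_)
        exact one_le_pow₀ (by linarith [norm_nonneg (y - c)])
      refine (mul_le_mul (hcok i c) h5 (norm_nonneg _) (by positivity)).trans ?_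
      rw [div_mul_eq_mul_div, div_le_div_iff₀ (by positivity) (by positivity)]
      have h6 : (1 + ‖y‖) ^ N ≤ 2 ^ N * (1 + ‖c‖) ^ N := by
        rw [← mul_pow]
        refine pow_le_pow_left₀ (by positivity) ?_ _
        linarith [norm_nonneg c]
      have := hC4 i
      calc ‖co i‖ * C1 * (C4 i * ‖y - c‖) * (1 + ‖y‖) ^ N
          ≤ ‖co i‖ * C1 * (C4 i * ‖y - c‖) * (2 ^ N * (1 + ‖c‖) ^ N) := by gcongr
        _ = _ := by ring
    refine hA1.trans ?_
    rw [← Finset.sum_div, ← add_div, ← Finset.sum_mul, ← add_mul, mul_div_assoc]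
    exact mul_le_mul_of_nonneg_right (by linarith) (by positivity)

/-- The key estimate for canceling operators: the kernel may be assumed to vanish at any point. -/
theorem kernel_estimate (A : DiffOperator X k V E) (hA : A.IsElliptic) (hc : A.IsCanceling)
    (κ : SchwartzMap X (E →L[ℝ] ℂ)) (N : ℕ) :
    ∃ C : ℝ, 0 ≤ C ∧ ∀ c, ∀ u : X → V, IsTestFun u →
      ‖∫ y, κ y (A.app u y)‖ₑ ≤ ENNReal.ofReal C *
        ∫⁻ y, ENNReal.ofReal (min 1 ‖y - c‖ / (1 + ‖y‖) ^ N) * ‖A.app u y‖ₑ := by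
  obtain ⟨C, hC0, hC⟩ := kernel_approx A hA hc κ N
  refine ⟨C, hC0, fun c u hu => ?_⟩
  obtain ⟨Φ, hΦ, hb⟩ := hC c
  have hi : ∀ Φ : SchwartzMap X (E →L[ℝ] ℂ), Integrable (fun y => Φ y (A.app u y)) := fun Φ =>
      (Φ.continuous.clm_apply (hu.app A).1.continuous).integrable_of_hasCompactSupport
        ((hu.app A).2.mono (fun y hy h => hy (by simp [h])))
  have : ∫ y, κ y (A.app u y) = ∫ y, (κ y - Φ y) (A.app u y) := by
    simp only [sub_apply]
    rw [integral_sub (hi κ) (hi Φ), hΦ u hu, sub_zero]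
  rw [this, ← lintegral_const_mul' _ _ ENNReal.ofReal_ne_top]
  refine (enorm_integral_le_lintegral_enorm _).trans (lintegral_mono fun y => ?_)
  rw [← mul_assoc, ← ENNReal.ofReal_mul hC0]
  refine (ContinuousLinearMap.le_opENorm _ _).trans ?_
  gcongr
  rw [← ofReal_norm]
  exact ENNReal.ofReal_le_ofReal (hb y)

end kernelSec

section geomSec
open Real

theorem geom_int_summable {γ : ℝ} (hγ : 0 < γ) :
    Summable (fun i : ℤ => (2 : ℝ) ^ (-γ * |(i : ℝ)|)) := by
  have h1 : Summable (fun i : ℕ => (2 : ℝ) ^ (-γ * (i : ℝ))) := by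
    have : ∀ i : ℕ, (2 : ℝ) ^ (-γ * (i : ℝ)) = ((2 : ℝ) ^ (-γ)) ^ i := by
      intro i; rw [Real.rpow_mul (by norm_num), Real.rpow_natCast]
    simp only [this]
    exact summable_geometric_of_lt_one (by positivity)
      (Real.rpow_lt_one_of_one_lt_of_neg (by norm_num) (by linarith))
  refine Summable.of_nat_of_neg (h1.congr fun i => ?_) (h1.congr fun i => ?_) <;> simp

theorem geom_int {α β : ℝ} (hα : 0 < α) (hβ : 0 < β) :
    ∃ C : ℝ≥0∞, C ≠ ⊤ ∧ ∀ a b : ℝ, 0 < a → 0 < b →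
      ∑' j : ℤ, ENNReal.ofReal (min (a * 2 ^ (j * α)) (b * 2 ^ (-(j * β)))) ≤
        C * ENNReal.ofReal (a ^ (β / (α + β)) * b ^ (α / (α + β))) := by
  set γ := min α β with hγd
  have hγ : 0 < γ := lt_min hα hβ
  have hs := geom_int_summable hγ
  refine ⟨ENNReal.ofReal (2 ^ γ) * ∑' i : ℤ, ENNReal.ofReal ((2 : ℝ) ^ (-γ * |(i : ℝ)|)), ?_, ?_⟩
  · refine ENNReal.mul_ne_top ENNReal.ofReal_ne_top ?_
    rw [← ENNReal.ofReal_tsum_of_nonneg (fun i => by positivity) hs]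
    exact ENNReal.ofReal_ne_top
  intro a b ha hb
  set m := a ^ (β / (α + β)) * b ^ (α / (α + β)) with hm
  have hm0 : 0 < m := by positivity
  set lam := Real.logb 2 (b / a) / (α + β) with hlam
  have hab : (2 : ℝ) ^ (lam * (α + β)) = b / a := by
    rw [hlam, div_mul_cancel₀ _ (by positivity), Real.rpow_logb (by norm_num) (by norm_num)
      (by positivity)]
  have hm1 : m = a * 2 ^ (lam * α) := by
    have h2 : (2 : ℝ) ^ (lam * α) = (b / a) ^ (α / (α + β)) := by
      rw [← hab, ← Real.rpow_mul (by norm_num)]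
      congr 1
      field_simp
    rw [h2, Real.div_rpow hb.le ha.le, hm]
    have h3 : β / (α + β) = 1 - α / (α + β) := by field_simp; ring
    rw [h3, Real.rpow_sub ha, Real.rpow_one]
    ring
  have hm2 : m = b * 2 ^ (-(lam * β)) := by
    rw [hm1]
    have h2 : b = a * 2 ^ (lam * (α + β)) := by rw [hab]; field_simp
    conv_rhs => rw [h2]
    rw [mul_assoc, ← Real.rpow_add (by norm_num)]
    congr 2
    ring
  set j0 := ⌊lam⌋ with hj0
  have hterm : ∀ j : ℤ, min (a * 2 ^ (j * α)) (b * 2 ^ (-(j * β)))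
      ≤ m * (2 ^ γ * 2 ^ (-γ * |((j - j0 : ℤ) : ℝ)|)) := by
    intro j
    have hfl1 := Int.floor_le lam
    have hfl2 := Int.lt_floor_add_one lam
    rw [← hj0] at hfl1 hfl2
    rw [← Real.rpow_add (by norm_num)]
    have hg1 : γ ≤ α := min_le_left _ _
    have hg2 : γ ≤ β := min_le_right _ _
    push_cast
    rcases le_or_gt j j0 with h | h
    · replace h : (j : ℝ) ≤ j0 := by exact_mod_cast h
      refine (min_le_left _ _).trans ?_
      rw [hm1, mul_assoc, ← Real.rpow_add (by norm_num)]
      refine mul_le_mul_of_nonneg_left ?_ ha.le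
      refine Real.rpow_le_rpow_of_exponent_le (by norm_num) ?_
      rw [abs_of_nonpos (by linarith)]
      nlinarith
    · replace h : (j0 : ℝ) + 1 ≤ j := by exact_mod_cast h
      refine (min_le_right _ _).trans ?_
      rw [hm2, mul_assoc, ← Real.rpow_add (by norm_num)]
      refine mul_le_mul_of_nonneg_left ?_ hb.le
      refine Real.rpow_le_rpow_of_exponent_le (by norm_num) ?_
      rw [abs_of_nonneg (by linarith)]
      nlinarith
  calc ∑' j : ℤ, ENNReal.ofReal (min (a * 2 ^ (j * α)) (b * 2 ^ (-(j * β))))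
      ≤ ∑' j : ℤ, ENNReal.ofReal (m * (2 ^ γ * 2 ^ (-γ * |((j - j0 : ℤ) : ℝ)|))) :=
        ENNReal.tsum_le_tsum fun j => ENNReal.ofReal_le_ofReal (hterm j)
    _ = ENNReal.ofReal m * (ENNReal.ofReal (2 ^ γ) *
          ∑' j : ℤ, ENNReal.ofReal (2 ^ (-γ * |((j - j0 : ℤ) : ℝ)|))) := by
        rw [← ENNReal.tsum_mul_left, ← ENNReal.tsum_mul_left]
        congr 1
        ext j
        rw [ENNReal.ofReal_mul hm0.le, ENNReal.ofReal_mul (p := 2 ^ γ) (by positivity)]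
    _ = _ := by
        rw [mul_comm]
        congr 2
        exact (Equiv.subRight j0).tsum_eq (fun i : ℤ => ENNReal.ofReal ((2 : ℝ) ^ (-γ * |(i : ℝ)|)))

end geomSec

section energySec
open Real

variable {X : Type} [NormedAddCommGroup X] [InnerProductSpace ℝ X] [FiniteDimensional ℝ X]
  [MeasurableSpace X] [BorelSpace X]

theorem measurable_ballmeas (ν : Measure X) [IsFiniteMeasure ν] :
    Measurable (fun q : X × X => ν (Metric.closedBall q.1 ‖q.1 - q.2‖)) := by
  have hs : MeasurableSet {a : (X × X) × X | dist a.2 a.1.1 ≤ ‖a.1.1 - a.1.2‖} := by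
    apply IsClosed.measurableSet
    exact isClosed_le (by fun_prop) (by fun_prop)
  exact measurable_measure_prodMk_left (ν := ν) hs

theorem ballmeas_level (ν : Measure X) [IsFiniteMeasure ν] (z : X) (τ : ℝ≥0∞) :
    ν {c | ν (Metric.closedBall z ‖z - c‖) ≤ τ} ≤ τ := by
  have hm : MeasurableSet {c | ν (Metric.closedBall z ‖z - c‖) ≤ τ} :=
    measurableSet_le ((measurable_ballmeas ν).comp (measurable_const.prodMk measurable_id))
      measurable_const
  rw [hm.measure_eq_iSup_isCompact]
  refine iSup_le fun K => iSup_le fun hK => iSup_le fun hKc => ?_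
  rcases K.eq_empty_or_nonempty with h | h
  · simp [h]
  obtain ⟨c, hc, hmax⟩ := hKc.exists_isMaxOn h (f := fun c => ‖z - c‖) (by fun_prop)
  refine (measure_mono fun y hy => ?_).trans (hK hc)
  rw [Metric.mem_closedBall, dist_comm, dist_eq_norm]
  exact hmax hy

theorem ballmeas_integral {σ : ℝ} (hσ0 : 0 < σ) (hσ1 : σ < 1) :
    ∃ C : ℝ≥0∞, C ≠ ⊤ ∧ ∀ (ν : Measure X) [IsFiniteMeasure ν] (z : X),
      ∫⁻ c, (ν (Metric.closedBall z ‖z - c‖)) ^ (-σ) ∂ν ≤ C * ν Set.univ ^ (1 - σ) := by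
  have hq1 : (2 : ℝ≥0∞)⁻¹ ^ (1 - σ) < 1 := ENNReal.rpow_lt_one (by norm_num) (by linarith)
  refine ⟨2 ^ σ * ∑' i : ℕ, ((2 : ℝ≥0∞)⁻¹ ^ (1 - σ)) ^ i, ?_, ?_⟩
  · refine ENNReal.mul_ne_top (ENNReal.rpow_ne_top_of_nonneg hσ0.le (by norm_num)) ?_
    rw [ENNReal.tsum_geometric]
    exact ENNReal.inv_ne_top.2 (tsub_pos_of_lt hq1).ne'
  intro ν _ z
  set T := ν Set.univ with hT
  have hTt : T ≠ ⊤ := measure_ne_top _ _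
  set F : X → ℝ≥0∞ := fun c => ν (Metric.closedBall z ‖z - c‖) with hF
  have hFm : Measurable F := (measurable_ballmeas ν).comp (measurable_const.prodMk measurable_id)
  set S : ℕ → Set X := fun i => {c | F c ≤ T * (2 : ℝ≥0∞)⁻¹ ^ i} with hS
  have hSm : ∀ i, MeasurableSet (S i) := fun i => measurableSet_le hFm measurable_const
  have h0 : ∀ᵐ c ∂ν, F c ≠ 0 := by
    have := ballmeas_level ν z 0
    rw [ae_iff]
    simpa [hF] using this
  have hpt : ∀ᵐ c ∂ν, F c ^ (-σ) ≤
      ∑' i : ℕ, (S i).indicator (fun _ => (T * (2 : ℝ≥0∞)⁻¹ ^ (i + 1)) ^ (-σ)) c := by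
    filter_upwards [h0] with c hc
    have hFT : F c ≤ T := measure_mono (Set.subset_univ _)
    have hex : ∃ i : ℕ, T * (2 : ℝ≥0∞)⁻¹ ^ (i + 1) < F c := by
      have ht : Filter.Tendsto (fun i : ℕ => T * (2 : ℝ≥0∞)⁻¹ ^ (i + 1)) Filter.atTop (nhds (T * 0)) := by
        refine ENNReal.Tendsto.const_mul ?_ (Or.inr hTt)
        exact (ENNReal.tendsto_pow_atTop_nhds_zero_of_lt_one (by norm_num)).comp
          (Filter.tendsto_add_atTop_nat 1)
      rw [mul_zero] at ht
      exact (ht.eventually (gt_mem_nhds (pos_iff_ne_zero.2 hc))).exists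
    classical
    set i := Nat.find hex with hi
    have hi1 : T * (2 : ℝ≥0∞)⁻¹ ^ (i + 1) < F c := Nat.find_spec hex
    have hi2 : F c ≤ T * (2 : ℝ≥0∞)⁻¹ ^ i := by
      rcases Nat.eq_zero_or_pos i with h | h
      · rw [h]; simpa using hFT
      · have := Nat.find_min hex (m := i - 1) (by omega)
        rw [Nat.sub_add_cancel h] at this
        exact not_lt.1 this
    refine le_trans ?_ (ENNReal.le_tsum i)
    rw [Set.indicator_of_mem (show c ∈ S i from hi2), ENNReal.rpow_neg, ENNReal.rpow_neg]
    exact ENNReal.inv_le_inv.2 (ENNReal.rpow_le_rpow hi1.le hσ0.le)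
  refine (lintegral_mono_ae hpt).trans ?_
  rw [lintegral_tsum fun i => (measurable_const.indicator (hSm i)).aemeasurable]
  rw [mul_assoc, ← ENNReal.tsum_mul_right, ← ENNReal.tsum_mul_left]
  refine ENNReal.tsum_le_tsum fun i => ?_
  rw [lintegral_indicator_const (hSm i)]
  have h3 : ν (S i) ≤ T * (2 : ℝ≥0∞)⁻¹ ^ i := ballmeas_level ν z _
  rcases eq_or_ne T 0 with hT0 | hT0
  · have : ν (S i) = 0 := le_antisymm (by simpa [hT0] using h3) bot_le
    rw [this]; simp
  refine (mul_le_mul_right h3 _).trans (le_of_eq ?_)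
  have h2t : ∀ i : ℕ, (2 : ℝ≥0∞)⁻¹ ^ i ≠ ⊤ := fun i => ENNReal.pow_ne_top (by norm_num)
  have h20 : ∀ i : ℕ, (2 : ℝ≥0∞)⁻¹ ^ i ≠ 0 := fun i => pow_ne_zero _ (by norm_num)
  rw [ENNReal.mul_rpow_of_ne_top hTt (h2t _), ENNReal.rpow_sub _ _ hT0 hTt, ENNReal.rpow_one,
    pow_succ, ENNReal.mul_rpow_of_ne_top (h2t _) (by norm_num), ENNReal.inv_rpow 2 (-σ),
    ENNReal.rpow_neg 2, inv_inv, ← ENNReal.rpow_natCast _ i, ← ENNReal.rpow_natCast _ i,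
    ← ENNReal.rpow_mul, ← ENNReal.rpow_mul, ENNReal.rpow_neg T, ENNReal.div_eq_inv_mul]
  have : (2 : ℝ≥0∞)⁻¹ ^ ((1 - σ) * (i : ℝ)) =
      (2 : ℝ≥0∞)⁻¹ ^ ((i : ℝ) * -σ) * (2 : ℝ≥0∞)⁻¹ ^ (i : ℝ) := by
    rw [← ENNReal.rpow_add _ _ (by norm_num) (by norm_num)]
    congr 1; ring
  rw [this]
  ring

end energySec

section energy2
open Real

variable {X : Type} [NormedAddCommGroup X] [InnerProductSpace ℝ X] [FiniteDimensional ℝ X]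
  [MeasurableSpace X] [BorelSpace X]

/-- The weight `(1 + r |z|)^{-N}`. -/
def wt (N : ℕ) (r : ℝ) (z : X) : ℝ≥0∞ := ENNReal.ofReal (1 / (1 + r * ‖z‖) ^ N)

theorem measurable_wt (N : ℕ) (r : ℝ) : Measurable (wt N r : X → ℝ≥0∞) := by
  unfold wt; fun_prop

theorem wt_le_one (N : ℕ) {r : ℝ} (hr : 0 ≤ r) (z : X) : wt N r z ≤ 1 := by
  unfold wt
  rw [ENNReal.ofReal_le_one]
  refine (div_le_one (by positivity)).2 (one_le_pow₀ ?_)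
  have := mul_nonneg hr (norm_nonneg z)
  linarith

theorem energy_pointwise {n : ℕ} (hn : 1 ≤ n) (ν : Measure X) [IsFiniteMeasure ν] {r : ℝ}
    (hr : 0 < r) (x : X) (J : ℝ≥0∞)
    (hJ : ∀ c, J ≤ ∫⁻ z, ENNReal.ofReal (min 1 (r * ‖z - c‖)) * wt (n * (n + 2)) r (z - x) ∂ν) :
    J ^ (1 + 1 / (n : ℝ)) ≤ 2 ^ (n * (n + 2)) *
      ∫⁻ c, ∫⁻ z, ENNReal.ofReal (min 1 (r * ‖z - c‖)) *
        (ν (Metric.closedBall z ‖z - c‖)) ^ (-(1 - 1 / (n : ℝ))) *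
          (wt (n + 2) r (z - x) * wt (n + 2) r (c - x)) ∂ν ∂ν := by
  have hn0 : (0 : ℝ) < n := by exact_mod_cast hn
  set N := n * (n + 2) with hN
  set M := ∫⁻ c, wt N r (c - x) ∂ν with hM
  have hMt : M ≠ ⊤ := by
    refine ne_top_of_le_ne_top (measure_ne_top ν Set.univ) ?_
    calc M ≤ ∫⁻ c, 1 ∂ν := lintegral_mono fun c => wt_le_one N hr.le _
      _ = _ := by simp
  have hJM : J ≤ M := by
    refine (hJ x).trans (lintegral_mono fun z => ?_)
    calc _ ≤ 1 * wt N r (z - x) := by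
          gcongr
          exact ENNReal.ofReal_le_one.2 (min_le_left _ _)
      _ = _ := one_mul _
  have hn1 : 0 ≤ 1 - 1 / (n : ℝ) := by
    rw [sub_nonneg, div_le_one hn0]; exact_mod_cast hn
  rcases eq_or_ne M 0 with hM0 | hM0
  · have : J = 0 := le_antisymm (hM0 ▸ hJM) bot_le
    rw [this, ENNReal.zero_rpow_of_pos (by positivity)]
    exact bot_le
  -- `J * M ≤ double integral`
  have hprod : J * M ≤ ∫⁻ c, ∫⁻ z, ENNReal.ofReal (min 1 (r * ‖z - c‖)) *
      wt N r (z - x) * wt N r (c - x) ∂ν ∂ν := by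
    rw [hM, ← lintegral_const_mul' _ _ (ne_top_of_le_ne_top hMt hJM)]
    refine lintegral_mono fun c => ?_
    refine (mul_le_mul_left (hJ c) _).trans (le_of_eq ?_)
    rw [← lintegral_mul_const]
    have := measurable_wt (X := X) N r
    exact Measurable.mul (by fun_prop) (this.comp (by fun_prop))
  have hJp : J ^ (1 + 1 / (n : ℝ)) ≤ M ^ (-(1 - 1 / (n : ℝ))) * (J * M) := by
    have e1 : M ^ (-(1 - 1 / (n : ℝ))) * M = M ^ (1 / (n : ℝ)) := by
      conv_lhs => rw [← ENNReal.rpow_one M, ← ENNReal.rpow_mul, one_mul,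
        ← ENNReal.rpow_add _ _ hM0 hMt]
      congr 1; ring
    calc J ^ (1 + 1 / (n : ℝ)) = J * J ^ (1 / (n : ℝ)) := by
          rw [ENNReal.rpow_add_of_nonneg _ _ (by norm_num) (by positivity), ENNReal.rpow_one]
      _ ≤ J * M ^ (1 / (n : ℝ)) := by gcongr
      _ = M ^ (-(1 - 1 / (n : ℝ))) * (J * M) := by rw [← e1]; ring
  refine hJp.trans ((mul_le_mul_right hprod _).trans ?_)
  have hMn : M ^ (-(1 - 1 / (n : ℝ))) ≠ ⊤ := by
    rw [ENNReal.rpow_neg]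
    exact ENNReal.inv_ne_top.2 (by
      intro h; rw [ENNReal.rpow_eq_zero_iff] at h; rcases h with h | h
      · exact hM0 h.1
      · exact hMt h.1)
  rw [← lintegral_const_mul' _ _ hMn, ← lintegral_const_mul' _ _ (ENNReal.pow_ne_top (by norm_num))]
  refine lintegral_mono fun c => ?_
  simp only []
  rw [← lintegral_const_mul' _ _ hMn, ← lintegral_const_mul' _ _ (ENNReal.pow_ne_top (by norm_num))]
  refine lintegral_mono fun z => ?_
  simp only []
  set a := r * ‖z - x‖ with ha
  set b := r * ‖c - x‖ with hb
  have ha0 : 0 ≤ a := by positivity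
  have hb0 : 0 ≤ b := by positivity
  set Q := 2 * ((1 + a) * (1 + b)) with hQ
  have hQ1 : 0 < Q := by positivity
  set B := ν (Metric.closedBall z ‖z - c‖) with hB
  have hBM : B * ENNReal.ofReal (1 / Q ^ N) ≤ M := by
    rw [mul_comm, hB, ← setLIntegral_const]
    refine (setLIntegral_mono ?_ fun y hy => ?_).trans (setLIntegral_le_lintegral _ _)
    · exact (measurable_wt N r).comp (by fun_prop)
    · unfold wt
      refine ENNReal.ofReal_le_ofReal (one_div_le_one_div_of_le (by positivity)
        (pow_le_pow_left₀ (by positivity) ?_ _))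
      rw [Metric.mem_closedBall, dist_eq_norm] at hy
      have t1 : ‖y - x‖ ≤ ‖y - z‖ + ‖z - x‖ := norm_sub_le_norm_sub_add_norm_sub _ _ _
      have t2 : ‖z - c‖ ≤ ‖z - x‖ + ‖c - x‖ := by
        rw [norm_sub_rev c x]; exact norm_sub_le_norm_sub_add_norm_sub _ _ _
      have t3 : r * ‖y - x‖ ≤ r * (‖z - x‖ + ‖c - x‖ + ‖z - x‖) :=
        mul_le_mul_of_nonneg_left (by linarith) hr.le
      have t4 : r * (‖z - x‖ + ‖c - x‖ + ‖z - x‖) = a + b + a := by rw [ha, hb]; ring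
      rw [hQ]
      nlinarith [mul_nonneg ha0 hb0]
  have hMle : M ^ (-(1 - 1 / (n : ℝ))) ≤
      B ^ (-(1 - 1 / (n : ℝ))) * ENNReal.ofReal (Q ^ (N - (n + 2))) := by
    have h1 : M ^ (-(1 - 1 / (n : ℝ))) ≤ (B * ENNReal.ofReal (1 / Q ^ N)) ^ (-(1 - 1 / (n : ℝ))) := by
      rw [ENNReal.rpow_neg, ENNReal.rpow_neg]
      exact ENNReal.inv_le_inv.2 (ENNReal.rpow_le_rpow hBM hn1)
    refine h1.trans (le_of_eq ?_)
    rw [ENNReal.mul_rpow_of_ne_top (measure_ne_top _ _) ENNReal.ofReal_ne_top,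
      ENNReal.ofReal_rpow_of_pos (by positivity)]
    congr 2
    rw [one_div, Real.rpow_neg (by positivity), Real.inv_rpow (by positivity), inv_inv,
      ← Real.rpow_natCast, ← Real.rpow_natCast, ← Real.rpow_mul hQ1.le]
    congr 1
    have : n + 2 ≤ N := by rw [hN]; nlinarith
    rw [Nat.cast_sub this, hN]
    push_cast
    field_simp
  have hW : ENNReal.ofReal (Q ^ (N - (n + 2))) * (wt N r (z - x) * wt N r (c - x)) ≤
      2 ^ N * (wt (n + 2) r (z - x) * wt (n + 2) r (c - x)) := by
    unfold wt
    have h2 : (2 : ℝ≥0∞) ^ N = ENNReal.ofReal (2 ^ N) := by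
      rw [ENNReal.ofReal_pow (by norm_num)]; norm_num
    rw [h2, ← ENNReal.ofReal_mul (by positivity), ← ENNReal.ofReal_mul (by positivity),
      ← ENNReal.ofReal_mul (by positivity), ← ENNReal.ofReal_mul (by positivity)]
    refine ENNReal.ofReal_le_ofReal ?_
    rw [← ha, ← hb]
    have hNn : N = (N - (n + 2)) + (n + 2) := by
      have : n + 2 ≤ N := by rw [hN]; nlinarith
      omega
    have e : Q ^ (N - (n + 2)) * (1 / (1 + a) ^ N * (1 / (1 + b) ^ N)) =
        2 ^ (N - (n + 2)) * (1 / (1 + a) ^ (n + 2) * (1 / (1 + b) ^ (n + 2))) := by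
      rw [hQ, mul_pow, mul_pow]
      conv_lhs => rw [hNn]
      simp only [Nat.add_sub_cancel, pow_add (1 + a) _ (n + 2), pow_add (1 + b) _ (n + 2)]
      field_simp
    rw [e]
    have : (2 : ℝ) ^ (N - (n + 2)) ≤ 2 ^ N := pow_le_pow_right₀ (by norm_num) (by omega)
    gcongr
  calc M ^ (-(1 - 1 / (n : ℝ))) * (ENNReal.ofReal (min 1 (r * ‖z - c‖)) *
      wt N r (z - x) * wt N r (c - x))
      ≤ (B ^ (-(1 - 1 / (n : ℝ))) * ENNReal.ofReal (Q ^ (N - (n + 2)))) *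
        (ENNReal.ofReal (min 1 (r * ‖z - c‖)) * wt N r (z - x) * wt N r (c - x)) := by gcongr
    _ = (ENNReal.ofReal (min 1 (r * ‖z - c‖)) * B ^ (-(1 - 1 / (n : ℝ)))) *
        (ENNReal.ofReal (Q ^ (N - (n + 2))) * (wt N r (z - x) * wt N r (c - x))) := by ring
    _ ≤ (ENNReal.ofReal (min 1 (r * ‖z - c‖)) * B ^ (-(1 - 1 / (n : ℝ)))) *
        (2 ^ N * (wt (n + 2) r (z - x) * wt (n + 2) r (c - x))) := by gcongr
    _ = _ := by ring

end energy2

section energy3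
open Real

variable {X : Type} [NormedAddCommGroup X] [InnerProductSpace ℝ X] [FiniteDimensional ℝ X]
  [MeasurableSpace X] [BorelSpace X]

theorem lintegral_comp_smul_pos {r : ℝ} (hr : 0 < r) (f : X → ℝ≥0∞) :
    ENNReal.ofReal (r ^ Module.finrank ℝ X) * ∫⁻ x, f (r • x) = ∫⁻ x, f x := by
  have h := Measure.map_addHaar_smul (volume : Measure X) hr.ne'
  have h2 : ∫⁻ x, f (r • x) = ∫⁻ x, f x ∂(Measure.map (r • ·) (volume : Measure X)) :=
    (lintegral_map_equiv f (Homeomorph.smulOfNeZero r hr.ne').toMeasurableEquiv).symm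
  rw [h2, h, lintegral_smul_measure, smul_eq_mul, ← mul_assoc,
    ← ENNReal.ofReal_mul (by positivity), abs_of_pos (by positivity),
    mul_inv_cancel₀ (by positivity), ENNReal.ofReal_one, one_mul]

theorem wt_xint {n : ℕ} (hX : Module.finrank ℝ X = n) {r : ℝ} (hr : 0 < r) (z c : X) :
    ∫⁻ x, ENNReal.ofReal (r ^ n) * (wt (n + 2) r (z - x) * wt (n + 2) r (c - x)) ≤
      (∫⁻ y : X, wt (n + 1) 1 y) * ENNReal.ofReal (1 / (1 + r * ‖z - c‖)) := by
  have hpt : ∀ x, wt (n + 2) r (z - x) * wt (n + 2) r (c - x) ≤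
      wt (n + 1) 1 (r • (z - x)) * ENNReal.ofReal (1 / (1 + r * ‖z - c‖)) := by
    intro x
    unfold wt
    rw [← ENNReal.ofReal_mul (by positivity), ← ENNReal.ofReal_mul (by positivity)]
    refine ENNReal.ofReal_le_ofReal ?_
    rw [norm_smul, Real.norm_of_nonneg hr.le, one_mul, div_mul_div_comm, div_mul_div_comm]
    rw [one_mul]
    refine one_div_le_one_div_of_le (by positivity) ?_
    have t2 : ‖z - c‖ ≤ ‖z - x‖ + ‖c - x‖ := by
      rw [norm_sub_rev c x]; exact norm_sub_le_norm_sub_add_norm_sub _ _ _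
    have t3 : r * ‖z - c‖ ≤ r * ‖z - x‖ + r * ‖c - x‖ := by
      rw [← mul_add]; exact mul_le_mul_of_nonneg_left t2 hr.le
    have ha0 : 0 ≤ r * ‖z - x‖ := by positivity
    have hb0 : 0 ≤ r * ‖c - x‖ := by positivity
    have h1 : (1 : ℝ) ≤ (1 + r * ‖c - x‖) ^ (n + 1) := one_le_pow₀ (by linarith)
    calc (1 + r * ‖z - x‖) ^ (n + 1) * (1 + r * ‖z - c‖)
        ≤ (1 + r * ‖z - x‖) ^ (n + 1) * ((1 + r * ‖z - x‖) * (1 + r * ‖c - x‖)) := by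
          gcongr
          nlinarith [mul_nonneg ha0 hb0]
      _ = (1 + r * ‖z - x‖) ^ (n + 2) * ((1 + r * ‖c - x‖) * 1) := by ring
      _ ≤ (1 + r * ‖z - x‖) ^ (n + 2) * ((1 + r * ‖c - x‖) * (1 + r * ‖c - x‖) ^ (n + 1)) := by
          gcongr
      _ = _ := by ring
  have hm := measurable_wt (X := X) (n + 1) 1
  calc _ ≤ ∫⁻ x, ENNReal.ofReal (r ^ n) * (wt (n + 1) 1 (r • (z - x)) *
        ENNReal.ofReal (1 / (1 + r * ‖z - c‖))) := lintegral_mono fun x => mul_le_mul_right (hpt x) _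
    _ = ENNReal.ofReal (r ^ n) * ∫⁻ x, wt (n + 1) 1 (r • (z - x)) *
        ENNReal.ofReal (1 / (1 + r * ‖z - c‖)) := by
        rw [lintegral_const_mul' _ _ ENNReal.ofReal_ne_top]
    _ = (ENNReal.ofReal (r ^ n) * ∫⁻ x, wt (n + 1) 1 (r • (z - x))) *
        ENNReal.ofReal (1 / (1 + r * ‖z - c‖)) := by
        rw [lintegral_mul_const' _ _ ENNReal.ofReal_ne_top, mul_assoc]
    _ = _ := by
        congr 1
        rw [lintegral_sub_left_eq_self (fun x : X => wt (n + 1) 1 (r • x)) z, ← hX,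
          lintegral_comp_smul_pos hr]

theorem wt_int_finite {n : ℕ} (hX : Module.finrank ℝ X = n) :
    (∫⁻ y : X, wt (n + 1) 1 y) ≠ ⊤ := by
  have h := finite_integral_one_add_norm (μ := (volume : Measure X)) (r := (n + 1 : ℕ))
    (by rw [hX]; push_cast; linarith)
  refine ne_of_eq_of_ne ?_ h.ne
  refine lintegral_congr fun y => ?_
  unfold wt
  rw [Real.rpow_neg (by positivity), Real.rpow_natCast, one_mul, one_div]

theorem sum_min_div : ∃ C : ℝ≥0∞, C ≠ ⊤ ∧ ∀ d : ℝ, 0 ≤ d →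
    ∑' j : ℤ, ENNReal.ofReal (min 1 ((2 : ℝ) ^ j * d)) *
      ENNReal.ofReal (1 / (1 + (2 : ℝ) ^ j * d)) ≤ C := by
  obtain ⟨C, hC, h⟩ := geom_int (α := 1) (β := 1) one_pos one_pos
  refine ⟨C, hC, fun d hd => ?_⟩
  rcases hd.eq_or_lt with rfl | hd
  · simp
  refine (ENNReal.tsum_le_tsum fun j => ?_).trans ((h d d⁻¹ hd (by positivity)).trans (le_of_eq ?_))
  · rw [← ENNReal.ofReal_mul (by positivity)]
    refine ENNReal.ofReal_le_ofReal ?_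
    rw [mul_one, Real.rpow_neg (by norm_num), Real.rpow_intCast, ← mul_inv, mul_comm d]
    have hp : 0 < (2 : ℝ) ^ j * d := by positivity
    refine le_min ?_ ?_
    · calc _ ≤ ((2 : ℝ) ^ j * d) * 1 := by
            gcongr
            · exact min_le_right _ _
            · rw [div_le_one (by positivity)]; linarith
        _ = _ := mul_one _
    · calc _ ≤ (1 : ℝ) * (1 / ((2 : ℝ) ^ j * d)) := by
            gcongr
            · exact min_le_left _ _
            · linarith
        _ = _ := by rw [one_mul, one_div]
  · rw [Real.inv_rpow hd.le, mul_inv_cancel₀ (by positivity)]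
    simp

theorem tonelli3 (ν : Measure X) [IsFiniteMeasure ν] (F : X → X → X → ℝ≥0∞)
    (hF : Measurable (fun q : (X × X) × X => F q.1.1 q.1.2 q.2)) :
    ∫⁻ x, ∫⁻ c, ∫⁻ z, F c z x ∂ν ∂ν = ∫⁻ c, ∫⁻ z, ∫⁻ x, F c z x ∂volume ∂ν ∂ν := by
  rw [lintegral_lintegral_swap]
  · refine lintegral_congr fun c => ?_
    rw [lintegral_lintegral_swap]
    refine Measurable.aemeasurable ?_
    exact hF.comp (f := fun q : X × X => ((c, q.2), q.1)) (by fun_prop)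
  · refine Measurable.aemeasurable ?_
    have : Measurable (fun q : (X × X) × X => F q.1.2 q.2 q.1.1) :=
      hF.comp (f := fun q : (X × X) × X => ((q.1.2, q.2), q.1.1)) (by fun_prop)
    exact this.lintegral_prod_right'

set_option maxHeartbeats 1000000 in
theorem energy_sum {n : ℕ} (hn : 2 ≤ n) (hX : Module.finrank ℝ X = n) :
    ∃ C : ℝ≥0∞, C ≠ ⊤ ∧ ∀ (ν : Measure X) [IsFiniteMeasure ν] (J : ℤ → X → ℝ≥0∞),
      (∀ j x c, J j x ≤ ∫⁻ z, ENNReal.ofReal (min 1 ((2 : ℝ) ^ j * ‖z - c‖)) *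
        wt (n * (n + 2)) ((2 : ℝ) ^ j) (z - x) ∂ν) →
      ∑' j : ℤ, ∫⁻ x, ENNReal.ofReal (((2 : ℝ) ^ j) ^ n) * J j x ^ (1 + 1 / (n : ℝ)) ≤
        C * ν Set.univ ^ (1 + 1 / (n : ℝ)) := by
  have hn0 : (0 : ℝ) < n := by positivity
  have hn2 : (2 : ℝ) ≤ n := by exact_mod_cast hn
  obtain ⟨C1, hC1, h1⟩ := sum_min_div
  obtain ⟨C2, hC2, h2⟩ := ballmeas_integral (X := X) (σ := 1 - 1 / (n : ℝ))
    (by rw [sub_pos, div_lt_one hn0]; linarith) (by simp; positivity)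
  set K := ∫⁻ y : X, wt (n + 1) 1 y with hK
  have hKt : K ≠ ⊤ := wt_int_finite hX
  refine ⟨2 ^ (n * (n + 2)) * K * C1 * C2, ?_, ?_⟩
  · exact ENNReal.mul_ne_top (ENNReal.mul_ne_top (ENNReal.mul_ne_top
      (ENNReal.pow_ne_top (by norm_num)) hKt) hC1) hC2
  intro ν _ J hJ
  set H : X → X → ℝ≥0∞ := fun z c => (ν (Metric.closedBall z ‖z - c‖)) ^ (-(1 - 1 / (n : ℝ)))
    with hH
  have hHm : Measurable (fun q : X × X => H q.1 q.2) :=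
    (measurable_ballmeas ν).pow_const _
  have hwm := measurable_wt (X := X) (n + 2)
  -- bound for a single scale
  have hone : ∀ j : ℤ, ∫⁻ x, ENNReal.ofReal (((2 : ℝ) ^ j) ^ n) * J j x ^ (1 + 1 / (n : ℝ)) ≤
      2 ^ (n * (n + 2)) * K * ∫⁻ c, ∫⁻ z, H z c *
        (ENNReal.ofReal (min 1 ((2 : ℝ) ^ j * ‖z - c‖)) *
          ENNReal.ofReal (1 / (1 + (2 : ℝ) ^ j * ‖z - c‖))) ∂ν ∂ν := by
    intro j
    set r := (2 : ℝ) ^ j with hr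
    have hr0 : 0 < r := by positivity
    have hF : Measurable (fun q : (X × X) × X => ENNReal.ofReal (r ^ n) *
        (ENNReal.ofReal (min 1 (r * ‖q.1.2 - q.1.1‖)) * H q.1.2 q.1.1 *
          (wt (n + 2) r (q.1.2 - q.2) * wt (n + 2) r (q.1.1 - q.2)))) := by
      refine Measurable.mul measurable_const (Measurable.mul (Measurable.mul (by fun_prop) ?_)
        (Measurable.mul ((hwm r).comp (by fun_prop)) ((hwm r).comp (by fun_prop))))
      exact hHm.comp ((measurable_snd.comp measurable_fst).prodMk
        (measurable_fst.comp measurable_fst))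
    calc _ ≤ ∫⁻ x, 2 ^ (n * (n + 2)) * ∫⁻ c, ∫⁻ z, ENNReal.ofReal (r ^ n) *
        (ENNReal.ofReal (min 1 (r * ‖z - c‖)) * H z c *
          (wt (n + 2) r (z - x) * wt (n + 2) r (c - x))) ∂ν ∂ν := by
          refine lintegral_mono fun x => ?_
          refine (mul_le_mul_right (energy_pointwise (by omega) ν hr0 x (J j x) (hJ j x)) _).trans
            (le_of_eq ?_)
          rw [mul_left_comm, ← lintegral_const_mul' _ _ ENNReal.ofReal_ne_top]
          congr 1
          refine lintegral_congr fun c => ?_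
          rw [← lintegral_const_mul' _ _ ENNReal.ofReal_ne_top]
      _ = 2 ^ (n * (n + 2)) * ∫⁻ x, ∫⁻ c, ∫⁻ z, ENNReal.ofReal (r ^ n) *
        (ENNReal.ofReal (min 1 (r * ‖z - c‖)) * H z c *
          (wt (n + 2) r (z - x) * wt (n + 2) r (c - x))) ∂ν ∂ν := by
          rw [lintegral_const_mul' _ _ (ENNReal.pow_ne_top (by norm_num))]
      _ = 2 ^ (n * (n + 2)) * ∫⁻ c, ∫⁻ z, ∫⁻ x, ENNReal.ofReal (r ^ n) *
        (ENNReal.ofReal (min 1 (r * ‖z - c‖)) * H z c *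
          (wt (n + 2) r (z - x) * wt (n + 2) r (c - x))) ∂volume ∂ν ∂ν := by
          congr 1
          exact tonelli3 ν (fun c z x => ENNReal.ofReal (r ^ n) *
            (ENNReal.ofReal (min 1 (r * ‖z - c‖)) * H z c *
              (wt (n + 2) r (z - x) * wt (n + 2) r (c - x)))) hF
      _ ≤ 2 ^ (n * (n + 2)) * ∫⁻ c, ∫⁻ z, K * (H z c *
        (ENNReal.ofReal (min 1 (r * ‖z - c‖)) *
          ENNReal.ofReal (1 / (1 + r * ‖z - c‖)))) ∂ν ∂ν := by
          gcongr with c z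
          have e : ∀ x, ENNReal.ofReal (r ^ n) *
              (ENNReal.ofReal (min 1 (r * ‖z - c‖)) * H z c *
              (wt (n + 2) r (z - x) * wt (n + 2) r (c - x))) =
              (ENNReal.ofReal (min 1 (r * ‖z - c‖)) * H z c) * (ENNReal.ofReal (r ^ n) *
              (wt (n + 2) r (z - x) * wt (n + 2) r (c - x))) := fun x => by ring
          simp only [e]
          rw [lintegral_const_mul]
          · refine (mul_le_mul_right (wt_xint hX hr0 z c) _).trans (le_of_eq ?_)
            rw [← hK]; ring
          · exact measurable_const.mul (((hwm r).comp (by fun_prop)).mul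
              ((hwm r).comp (by fun_prop)))
      _ = _ := by
          rw [mul_assoc, ← lintegral_const_mul' _ _ hKt]
          congr 1
          refine lintegral_congr fun c => ?_
          rw [lintegral_const_mul' _ _ hKt]
  refine (ENNReal.tsum_le_tsum hone).trans ?_
  rw [ENNReal.tsum_mul_left]
  have hG : ∀ j : ℤ, Measurable (fun q : X × X => H q.2 q.1 *
        (ENNReal.ofReal (min 1 ((2 : ℝ) ^ j * ‖q.2 - q.1‖)) *
          ENNReal.ofReal (1 / (1 + (2 : ℝ) ^ j * ‖q.2 - q.1‖)))) := by
    intro j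
    refine Measurable.mul (hHm.comp measurable_swap) (by fun_prop)
  have hfin : ∑' j : ℤ, ∫⁻ c, ∫⁻ z, H z c *
        (ENNReal.ofReal (min 1 ((2 : ℝ) ^ j * ‖z - c‖)) *
          ENNReal.ofReal (1 / (1 + (2 : ℝ) ^ j * ‖z - c‖))) ∂ν ∂ν ≤
      C1 * (C2 * ν Set.univ ^ (1 + 1 / (n : ℝ))) := by
    rw [← lintegral_tsum (fun j => (hG j).lintegral_prod_right'.aemeasurable)]
    have : ∀ c, ∑' j : ℤ, ∫⁻ z, H z c *
        (ENNReal.ofReal (min 1 ((2 : ℝ) ^ j * ‖z - c‖)) *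
          ENNReal.ofReal (1 / (1 + (2 : ℝ) ^ j * ‖z - c‖))) ∂ν ≤ C1 * ∫⁻ z, H z c ∂ν := by
      intro c
      have hGc : ∀ j : ℤ, Measurable (fun z => H z c *
        (ENNReal.ofReal (min 1 ((2 : ℝ) ^ j * ‖z - c‖)) *
          ENNReal.ofReal (1 / (1 + (2 : ℝ) ^ j * ‖z - c‖)))) := fun j =>
        (hG j).comp (f := fun z => (c, z)) (by fun_prop)
      rw [← lintegral_tsum (fun j => (hGc j).aemeasurable),
        ← lintegral_const_mul' _ _ hC1]
      refine lintegral_mono fun z => ?_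
      rw [ENNReal.tsum_mul_left, mul_comm]
      gcongr
      exact h1 _ (norm_nonneg _)
    refine (lintegral_mono this).trans ?_
    rw [lintegral_const_mul' _ _ hC1]
    gcongr
    have hsw : Measurable (Function.uncurry fun c z => H z c) := hHm.comp measurable_swap
    rw [lintegral_lintegral_swap hsw.aemeasurable]
    refine (lintegral_mono fun z => h2 ν z).trans ?_
    rw [lintegral_const, mul_assoc, ENNReal.rpow_add_of_nonneg _ _ (by norm_num) (by positivity),
      ENNReal.rpow_one, mul_comm (ν Set.univ)]
    refine le_of_eq ?_
    congr 3
    ring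
  refine (mul_le_mul_right hfin _).trans (le_of_eq ?_)
  ring

end energy3

section repSec
open FourierTransform Real Filter

variable {X : Type} [NormedAddCommGroup X] [InnerProductSpace ℝ X] [FiniteDimensional ℝ X]
  [MeasurableSpace X] [BorelSpace X]

/-- bump function used for the Littlewood-Paley decomposition -/
def rhoBump (X : Type) [NormedAddCommGroup X] [InnerProductSpace ℝ X] [FiniteDimensional ℝ X] :
    ContDiffBump (0 : X) := ⟨1, 3 / 2, by norm_num, by norm_num⟩

/-- smooth radial cutoff -/
def rho (ξ : X) : ℝ := rhoBump X ξ

/-- smooth cutoff to an annulus -/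
def chi (ξ : X) : ℝ := rho ξ - rho ((2 : ℝ) • ξ)

theorem rho_contDiff : ContDiff ℝ (⊤ : ℕ∞) (rho : X → ℝ) := (rhoBump X).contDiff

theorem rho_compact : HasCompactSupport (rho : X → ℝ) := (rhoBump X).hasCompactSupport

theorem rho_one {ξ : X} (h : ‖ξ‖ ≤ 1) : rho ξ = 1 :=
  (rhoBump X).one_of_mem_closedBall (by simpa [rhoBump] using h)

theorem rho_zero {ξ : X} (h : 3 / 2 ≤ ‖ξ‖) : rho ξ = 0 :=
  (rhoBump X).zero_of_le_dist (by simpa [rhoBump] using h)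

theorem rho_two_contDiff : ContDiff ℝ (⊤ : ℕ∞) (fun ξ : X => rho ((2 : ℝ) • ξ)) :=
  rho_contDiff.comp (contDiff_const_smul (2 : ℝ))

theorem rho_two_compact : HasCompactSupport (fun ξ : X => rho ((2 : ℝ) • ξ)) :=
  rho_compact.comp_smul (two_ne_zero)

theorem chi_contDiff : ContDiff ℝ (⊤ : ℕ∞) (chi : X → ℝ) :=
  rho_contDiff.sub rho_two_contDiff

theorem chi_compact : HasCompactSupport (chi : X → ℝ) :=
  rho_compact.sub rho_two_compact

theorem chi_zero_of_le {ξ : X} (h : ‖ξ‖ ≤ 1 / 2) : chi ξ = 0 := by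
  rw [chi, rho_one (by linarith), rho_one (by rw [norm_smul]; norm_num; linarith), sub_self]

theorem chi_zero_of_ge {ξ : X} (h : 3 / 2 ≤ ‖ξ‖) : chi ξ = 0 := by
  rw [chi, rho_zero h, rho_zero (by rw [norm_smul]; norm_num; linarith), sub_self]

theorem chi_one {ξ : X} (h : 3 / 4 ≤ ‖ξ‖) (h2 : ‖ξ‖ ≤ 1) : chi ξ = 1 := by
  rw [chi, rho_one h2, rho_zero (by rw [norm_smul]; norm_num; linarith), sub_zero]

theorem chi_tsupport : (0 : X) ∉ tsupport (chi : X → ℝ) := by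
  rw [notMem_tsupport_iff_eventuallyEq]
  filter_upwards [Metric.ball_mem_nhds (0 : X) (show (0 : ℝ) < 1 / 2 by norm_num)] with x hx
  exact chi_zero_of_le (by simpa using (mem_ball_zero_iff.1 hx).le)

theorem exists_rhoS : ∃ R : SchwartzMap X ℂ, ∀ ξ, R ξ = (rho ξ : ℂ) := by
  have h : IsTestFun (rho : X → ℝ) := ⟨rho_contDiff, rho_compact⟩
  have h2 := h.clm Complex.ofRealCLM
  exact ⟨h2.2.toSchwartzMap h2.1, fun _ => rfl⟩

theorem exists_chiS : ∃ R : SchwartzMap X ℂ, ∀ ξ, R ξ = (chi ξ : ℂ) := by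
  have h : IsTestFun (chi : X → ℝ) := ⟨chi_contDiff, chi_compact⟩
  have h2 := h.clm Complex.ofRealCLM
  exact ⟨h2.2.toSchwartzMap h2.1, fun _ => rfl⟩

theorem fourier_scale {W : Type*} [NormedAddCommGroup W] [NormedSpace ℂ W] {r : ℝ} (hr : 0 < r)
    (f : X → W) (y : X) :
    𝓕 (fun ξ => f (r • ξ)) y = (r ^ Module.finrank ℝ X)⁻¹ • 𝓕 f (r⁻¹ • y) := by
  rw [Real.fourier_eq, Real.fourier_eq]
  have h := Measure.integral_comp_smul (volume : Measure X)
    (fun v => 𝐞 (-⟪v, r⁻¹ • y⟫) • f v) r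
  rw [abs_of_pos (by positivity)] at h
  rw [← h]
  congr 1
  ext v
  rw [real_inner_smul_left, real_inner_smul_right, ← mul_assoc, mul_inv_cancel₀ hr.ne', one_mul]

theorem fourier_chi {R S : SchwartzMap X ℂ} (hR : ∀ ξ, R ξ = (rho ξ : ℂ))
    (hS : ∀ ξ, S ξ = (chi ξ : ℂ)) (y : X) :
    (𝓕 S) y = (𝓕 R) y - ((2 : ℝ) ^ Module.finrank ℝ X)⁻¹ • (𝓕 R) ((2 : ℝ)⁻¹ • y) := by
  rw [SchwartzMap.fourier_coe, SchwartzMap.fourier_coe, ← fourier_scale two_pos]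
  have hR2 : Integrable (fun ξ => R ((2 : ℝ) • ξ)) :=
    R.integrable.comp_smul two_ne_zero
  have e : (S : X → ℂ) = (R : X → ℂ) - fun ξ => R ((2 : ℝ) • ξ) := by
    ext ξ; simp [hS, hR, chi]
  have hi1 := (Real.fourierIntegral_convergent_iff (μ := volume) y).2 R.integrable
  have hi2 := (Real.fourierIntegral_convergent_iff (μ := volume) y).2 hR2
  rw [e, Real.fourier_eq, Real.fourier_eq, Real.fourier_eq]
  rw [← integral_sub hi1 hi2]
  congr 1
  ext v
  rw [Pi.sub_apply, smul_sub]

theorem IsTestFun.scale {V : Type*} [NormedAddCommGroup V] [NormedSpace ℝ V] {u : X → V}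
    (hu : IsTestFun u) (x : X) {t : ℝ} (ht : t ≠ 0) : IsTestFun (fun y => u (x + t • y)) := by
  refine ⟨hu.1.comp (contDiff_const.add (contDiff_const_smul t)), ?_⟩
  have h : HasCompactSupport (fun z => u (x + z)) :=
    hu.2.comp_homeomorph (Homeomorph.addLeft x)
  exact h.comp_smul ht

theorem iteratedFDeriv_scale {V : Type*} [NormedAddCommGroup V] [NormedSpace ℝ V] {u : X → V}
    (hu : ContDiff ℝ (⊤ : ℕ∞) u) (x : X) (t : ℝ) (k : ℕ) (y : X) :
    iteratedFDeriv ℝ k (fun y => u (x + t • y)) y = t ^ k • iteratedFDeriv ℝ k u (x + t • y) := by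
  have h1 : ContDiff ℝ k (fun z => u (x + z)) :=
    (hu.comp (contDiff_const.add contDiff_id)).of_le (by exact_mod_cast le_top)
  have := congrFun (iteratedFDeriv_comp_const_smul t h1) y
  rw [iteratedFDeriv_comp_add_left] at this
  exact this

theorem app_scale {V E : Type*} [NormedAddCommGroup V] [NormedSpace ℝ V]
    [NormedAddCommGroup E] [NormedSpace ℝ E] {k : ℕ} (A : DiffOperator X k V E) {u : X → V}
    (hu : ContDiff ℝ (⊤ : ℕ∞) u) (x : X) (t : ℝ) (y : X) :
    A.app (fun y => u (x + t • y)) y = t ^ k • A.app u (x + t • y) := by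
  rw [DiffOperator.app, iteratedFDeriv_scale hu, map_smul]; rfl

/-- pairing of the mollifier with the dilated function -/
theorem chi_pairing {R S : SchwartzMap X ℂ} (hR : ∀ ξ, R ξ = (rho ξ : ℂ))
    (hS : ∀ ξ, S ξ = (chi ξ : ℂ)) {g : X → ℂ} (hg : IsTestFun g) :
    ∫ ξ, S ξ * 𝓕 g ξ = (∫ y, (𝓕 R) y * g y) - ∫ y, (𝓕 R) y * g ((2 : ℝ) • y) := by
  obtain ⟨G, hG⟩ : ∃ G : SchwartzMap X ℂ, (G : X → ℂ) = g := ⟨hg.2.toSchwartzMap hg.1, rfl⟩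
  have h1 := SchwartzMap.integral_fourier_mul_eq S G
  rw [SchwartzMap.fourier_coe G, hG] at h1
  rw [← h1]
  have hgi : ∀ (F : SchwartzMap X ℂ) , Integrable (fun y => F y * g y) := fun F =>
    (F.continuous.mul hg.1.continuous).integrable_of_hasCompactSupport (hg.2.mul_left)
  have hgi2 : Integrable (fun y => (𝓕 R) ((2 : ℝ)⁻¹ • y) * g y) := by
    refine Continuous.integrable_of_hasCompactSupport ?_ (hg.2.mul_left)
    exact ((𝓕 R).continuous.comp (continuous_const_smul _)).mul hg.1.continuous
  have h2 := Measure.integral_comp_smul (volume : Measure X)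
    (fun y => (𝓕 R) ((2 : ℝ)⁻¹ • y) * g y) 2
  rw [abs_of_pos (by positivity)] at h2
  have h3 : ∀ y : X, (2 : ℝ)⁻¹ • (2 : ℝ) • y = y := fun y => by
    rw [smul_smul]; norm_num
  simp only [h3] at h2
  have hgi3 : Integrable (fun y => ((2 : ℝ) ^ Module.finrank ℝ X)⁻¹ •
    ((𝓕 R) ((2 : ℝ)⁻¹ • y) * g y)) :=
    hgi2.smul (((2 : ℝ) ^ Module.finrank ℝ X)⁻¹)
  rw [h2, ← integral_smul, ← integral_sub (hgi _) hgi3]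
  congr 1
  ext y
  rw [fourier_chi hR hS]
  simp only [Complex.real_smul]
  ring

theorem enorm_le_tsum_diff {a : ℤ → ℂ} {L : ℂ} (h1 : Tendsto a atTop (nhds L))
    (h2 : Tendsto a atBot (nhds 0)) : ‖L‖ₑ ≤ ∑' j : ℤ, ‖a j - a (j - 1)‖ₑ := by
  have key : ∀ N : ℕ, ‖a N - a (-N)‖ₑ ≤ ∑' j : ℤ, ‖a j - a (j - 1)‖ₑ := by
    intro N
    have e : a N - a (-N) = ∑ i ∈ Finset.range (2 * N),
        (a (-N + (i + 1 : ℕ)) - a (-N + (i : ℕ))) := by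
      rw [Finset.sum_range_sub (fun i : ℕ => a (-N + (i : ℕ)))]
      congr 2
      · push_cast; ring
      · simp
    rw [e]
    refine (enorm_sum_le _ _).trans ?_
    have hinj : Function.Injective (fun i : ℕ => (-(N : ℤ) + (i + 1 : ℕ))) := by
      intro i j hij; simp at hij; exact hij
    refine le_trans ?_ (ENNReal.tsum_comp_le_tsum_of_injective hinj _)
    refine le_trans (le_of_eq ?_) (ENNReal.sum_le_tsum (Finset.range (2 * N)))
    refine Finset.sum_congr rfl fun i _ => ?_
    congr 3
    push_cast; ring
  have h3 : Tendsto (fun N : ℕ => ‖a N - a (-N)‖ₑ) atTop (nhds ‖L - 0‖ₑ) := by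
    refine Tendsto.enorm ?_
    refine (h1.comp tendsto_natCast_atTop_atTop).sub (h2.comp ?_)
    exact tendsto_neg_atTop_atBot.comp tendsto_natCast_atTop_atTop
  rw [sub_zero] at h3
  exact le_of_tendsto h3 (Eventually.of_forall key)

theorem integral_fourier_rho {R : SchwartzMap X ℂ} (hR : ∀ ξ, R ξ = (rho ξ : ℂ)) :
    ∫ y, (𝓕 R) y = 1 := by
  have h : (𝓕⁻ (𝓕 R)) 0 = R 0 := by rw [FourierTransform.fourierInv_fourier_eq]
  rw [SchwartzMap.fourierInv_coe, Real.fourierInv_eq] at h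
  simp [hR, rho_one] at h
  exact h

theorem tendsto_mollify_zero {R : SchwartzMap X ℂ} (hR : ∀ ξ, R ξ = (rho ξ : ℂ)) {g : X → ℂ}
    (hg : IsTestFun g) (x : X) :
    Tendsto (fun t : ℝ => ∫ y, (𝓕 R) y * g (x + t • y)) (nhds 0) (nhds (g x)) := by
  obtain ⟨M, hM⟩ := hg.1.continuous.bounded_above_of_compact_support hg.2
  have h : Tendsto (fun t : ℝ => ∫ y, (𝓕 R) y * g (x + t • y)) (nhds 0)
      (nhds (∫ y, (𝓕 R) y * g x)) := by
    refine tendsto_integral_filter_of_dominated_convergence (fun y => ‖(𝓕 R) y‖ * M) ?_ ?_ ?_ ?_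
    · refine Eventually.of_forall fun t => Continuous.aestronglyMeasurable ?_
      exact (𝓕 R).continuous.mul (hg.1.continuous.comp (by fun_prop))
    · refine Eventually.of_forall fun t => Eventually.of_forall fun y => ?_
      rw [norm_mul]; gcongr; exact hM _
    · exact (𝓕 R).integrable.norm.mul_const _
    · refine Eventually.of_forall fun y => ?_
      refine Tendsto.const_mul _ ?_
      have : Continuous fun t : ℝ => g (x + t • y) := hg.1.continuous.comp (by fun_prop)
      simpa using this.tendsto 0
  rwa [integral_mul_const, integral_fourier_rho hR, one_mul] at h

theorem tendsto_mollify_top [Nontrivial X] (R : SchwartzMap X ℂ) {g : X → ℂ}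
    (hg : IsTestFun g) (x : X) :
    Tendsto (fun t : ℝ => ∫ y, (𝓕 R) y * g (x + t • y)) atTop (nhds 0) := by
  obtain ⟨M, hM⟩ := hg.1.continuous.bounded_above_of_compact_support hg.2
  have h : Tendsto (fun t : ℝ => ∫ y, (𝓕 R) y * g (x + t • y)) atTop
      (nhds (∫ y : X, (0 : ℂ))) := by
    refine tendsto_integral_filter_of_dominated_convergence (fun y => ‖(𝓕 R) y‖ * M) ?_ ?_ ?_ ?_
    · refine Eventually.of_forall fun t => Continuous.aestronglyMeasurable ?_
      exact (𝓕 R).continuous.mul (hg.1.continuous.comp (by fun_prop))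
    · refine Eventually.of_forall fun t => Eventually.of_forall fun y => ?_
      rw [norm_mul]; gcongr; exact hM _
    · exact (𝓕 R).integrable.norm.mul_const _
    · filter_upwards [compl_mem_ae_iff.2 (measure_singleton (0 : X))] with y hy
      have hy : y ≠ 0 := by simpa using hy
      rw [← mul_zero ((𝓕 R) y)]
      refine Tendsto.const_mul _ ?_
      refine hg.2.is_zero_at_infty.comp ?_
      refine tendsto_cocompact_of_tendsto_dist_comp_atTop (-(-x)) ?_
      have : ∀ t : ℝ, dist (x + t • y) (-(-x)) = |t| * ‖y‖ := fun t => by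
        rw [neg_neg, dist_eq_norm, add_sub_cancel_left, norm_smul, Real.norm_eq_abs]
      simp only [this]
      exact tendsto_abs_atTop_atTop.atTop_mul_const (norm_pos_iff.2 hy)
  simpa using h


variable {V E : Type*} [NormedAddCommGroup V] [InnerProductSpace ℝ V]
  [FiniteDimensional ℝ V] [NormedAddCommGroup E] [InnerProductSpace ℝ E] [FiniteDimensional ℝ E]

/-- evaluation functional on tensors -/
def evalT {m : ℕ} (w : Fin m → X) (h : V →L[ℝ] ℂ) :
    ContinuousMultilinearMap ℝ (fun _ : Fin m => X) V →L[ℝ] ℂ :=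
  h.comp (ContinuousMultilinearMap.apply ℝ (fun _ : Fin m => X) V w)

theorem evalT_apply {m : ℕ} (w : Fin m → X) (h : V →L[ℝ] ℂ)
    (M : ContinuousMultilinearMap ℝ (fun _ : Fin m => X) V) : evalT w h M = h (M w) := rfl

theorem IsTestFun.evalT {m : ℕ} (w : Fin m → X) (h : V →L[ℝ] ℂ) {u : X → V}
    (hu : IsTestFun u) : IsTestFun (fun y => h (iteratedFDeriv ℝ m u y w)) :=
  hu.app (_root_.evalT w h : DiffOperator X m V ℂ)

set_option maxHeartbeats 800000 in
theorem rep_chi {k m l : ℕ} (hk : k = m + l) (A : DiffOperator X k V E) (hA : A.IsElliptic)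
    (w : Fin m → X) (h : V →L[ℝ] ℂ) {S : SchwartzMap X ℂ}
    (hS : ∀ ξ, S ξ = (chi ξ : ℂ)) :
    ∃ κ : SchwartzMap X (E →L[ℝ] ℂ), ∀ u : X → V, IsTestFun u →
      ∫ y, κ y (A.app u y) = (2 * π * Complex.I) ^ l *
        ∫ ξ, S ξ * 𝓕 (fun y => h (iteratedFDeriv ℝ m u y w)) ξ := by
  have hF : ContDiff ℝ (⊤ : ℕ∞)
      (fun ξ => chi ξ • ((∏ i, ⟪ξ, w i⟫) • h.comp (linv A ξ))) := by
    refine contDiff_cutoff (W := E →L[ℝ] ℂ) (fun ξ hξ => ?_) chi_contDiff chi_tsupport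
    have q1 : ContDiffAt ℝ (⊤ : ℕ∞) (fun ξ : X => ∏ i, ⟪ξ, w i⟫) ξ :=
      contDiffAt_prod fun i _ => contDiffAt_id.inner ℝ contDiffAt_const
    have q2 : ContDiffAt ℝ (⊤ : ℕ∞) (fun ξ : X => h.comp (linv A ξ)) ξ :=
      (contDiffAt_const (c := h)).clm_comp (contDiffAt_linv A hA hξ)
    exact q1.smul q2
  have hc : HasCompactSupport (fun ξ : X => chi ξ • ((∏ i, ⟪ξ, w i⟫) • h.comp (linv A ξ))) :=
    hasCompactSupport_smul chi_compact (fun ξ => (∏ i, ⟪ξ, w i⟫) • h.comp (linv A ξ))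
  obtain ⟨Ψ, hΨ⟩ : ∃ Ψ : SchwartzMap X (E →L[ℝ] ℂ),
      ∀ ξ, Ψ ξ = chi ξ • ((∏ i, ⟪ξ, w i⟫) • h.comp (linv A ξ)) :=
    ⟨hc.toSchwartzMap hF, fun _ => rfl⟩
  refine ⟨𝓕 Ψ, fun u hu => ?_⟩
  have h1 := pairing_app A Ψ hu
  rw [SchwartzMap.fourier_coe, h1,
    show (2 * π * Complex.I) ^ k = (2 * π * Complex.I) ^ (m + l) by rw [hk],
    pow_add, mul_comm ((2 * π * Complex.I) ^ m), mul_assoc,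
    ← integral_const_mul]
  congr 2
  ext ξ
  have h2 := fourier_iter m hu (evalT w h) ξ
  simp only [evalT_apply, tens_apply] at h2
  rw [h2, mul_left_comm]
  congr 1
  have h3 : ∀ y, Ψ ξ (A.symbol ξ (u y)) = S ξ * h ((∏ i, ⟪ξ, w i⟫) • u y) := by
    intro y
    rw [hΨ, hS]
    by_cases hξ : ξ = 0
    · subst hξ
      rw [chi_zero_of_le (by simp)]; simp
    · simp [linv_comp A hA hξ]
  simp only [h3]
  rw [Real.fourier_eq, Real.fourier_eq, ← integral_const_mul]
  congr 1
  ext y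
  rw [mul_smul_comm]

theorem rep [Nontrivial X] {k m l : ℕ} (hk : k = m + l) (A : DiffOperator X k V E)
    (hA : A.IsElliptic) (w : Fin m → X) (h : V →L[ℝ] ℂ) :
    ∃ κ : SchwartzMap X (E →L[ℝ] ℂ), ∀ u : X → V, IsTestFun u → ∀ x,
      ‖h (iteratedFDeriv ℝ m u x w)‖ₑ ≤ ∑' j : ℤ, ENNReal.ofReal (((2 : ℝ) ^ (-j)) ^ l) *
        ‖∫ y, κ y (A.app u (x + (2 : ℝ) ^ (-j) • y))‖ₑ := by
  obtain ⟨R, hR⟩ := exists_rhoS (X := X)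
  obtain ⟨S, hS⟩ := exists_chiS (X := X)
  obtain ⟨κ, hκ⟩ := rep_chi hk A hA w h hS
  refine ⟨κ, fun u hu x => ?_⟩
  set g : X → ℂ := fun y => h (iteratedFDeriv ℝ m u y w) with hgdef
  have hg : IsTestFun g := hu.evalT w h
  set a : ℤ → ℂ := fun j => ∫ y, (𝓕 R) y * g (x + (2 : ℝ) ^ (-j) • y) with ha
  have hlim1 : Tendsto a atTop (nhds (g x)) := by
    refine (tendsto_mollify_zero hR hg x).comp ?_
    have : Tendsto (fun j : ℕ => (2 : ℝ) ^ (-(j : ℤ))) atTop (nhds 0) := by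
      simpa using tendsto_pow_atTop_nhds_zero_of_lt_one (r := (2 : ℝ)⁻¹) (by norm_num) (by norm_num)
    rw [← Nat.map_cast_int_atTop, tendsto_map'_iff]
    exact this
  have hlim2 : Tendsto a atBot (nhds 0) := by
    refine (tendsto_mollify_top R hg x).comp ?_
    have h3 : Tendsto (fun j : ℤ => (2 : ℝ) ^ j) atTop atTop := by
      rw [← Nat.map_cast_int_atTop, tendsto_map'_iff]
      simpa [Function.comp_def] using tendsto_pow_atTop_atTop_of_one_lt (r := (2 : ℝ)) (by norm_num)
    exact h3.comp tendsto_neg_atBot_atTop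
  refine (enorm_le_tsum_diff hlim1 hlim2).trans (ENNReal.tsum_le_tsum fun j => ?_)
  set t : ℝ := (2 : ℝ) ^ (-j) with ht
  have ht0 : 0 < t := by positivity
  have e1 := hκ _ (hu.scale x ht0.ne')
  simp only [app_scale A hu.1, iteratedFDeriv_scale hu.1, map_smul, smul_apply] at e1
  have hgt : IsTestFun (fun y => t ^ m • g (x + t • y)) := by
    have := (hg.scale x ht0.ne').clm ((t ^ m) • ContinuousLinearMap.id ℝ ℂ)
    simpa using this
  have e2 := chi_pairing hR hS hgt
  rw [e2] at e1
  simp only [mul_smul_comm, integral_smul, ← smul_sub] at e1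
  have e3 : a j - a (j - 1) = (∫ y, (𝓕 R) y * g (x + t • y)) -
      ∫ y, (𝓕 R) y * g (x + t • (2 : ℝ) • y) := by
    simp only [ha, smul_smul, ht]
    have : (2 : ℝ) ^ (-(j - 1)) = 2 ^ (-j) * 2 := by
      rw [show -(j - 1) = -j + 1 by ring, zpow_add_one₀ two_ne_zero]
    rw [this]
  rw [← e3] at e1
  rw [show t ^ k = t ^ (m + l) by rw [hk], pow_add, mul_smul] at e1
  have e4 := smul_right_injective ℂ (pow_pos ht0 m).ne' e1
  have e5 : t ^ l * ‖∫ y, κ y (A.app u (x + t • y))‖ = (2 * π) ^ l * ‖a j - a (j - 1)‖ := by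
    have := congrArg norm e4
    simpa [norm_smul, abs_of_pos ht0, abs_of_pos Real.pi_pos] using this
  rw [← ofReal_norm, ← ofReal_norm, ← ENNReal.ofReal_mul (by positivity), e5]
  refine ENNReal.ofReal_le_ofReal ?_
  have : (1 : ℝ) ≤ (2 * π) ^ l := one_le_pow₀ (by nlinarith [Real.pi_gt_three])
  nlinarith [norm_nonneg (a j - a (j - 1))]

end repSec

section suffSec
open FourierTransform Real Filter

variable {X : Type} [NormedAddCommGroup X] [InnerProductSpace ℝ X] [FiniteDimensional ℝ X]
  [MeasurableSpace X] [BorelSpace X]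

/-- Hedberg type interpolation of dyadic sums. -/
theorem hedberg {n l : ℕ} (hn : 2 ≤ n) (hl : 1 ≤ l) (hln : l ≤ n - 1) :
    ∃ C : ℝ≥0∞, C ≠ ⊤ ∧ ∀ (T G : ℝ≥0∞), T ≠ ⊤ → ∀ J : ℤ → ℝ≥0∞, (∀ j, J j ≤ T) →
      (∀ j, ENNReal.ofReal (((2 : ℝ) ^ j) ^ n) * J j ^ (1 + 1 / (n : ℝ)) ≤ G) →
      (∑' j : ℤ, ENNReal.ofReal (((2 : ℝ) ^ j) ^ (n - l)) * J j) ^ ((n : ℝ) / ((n : ℝ) - l)) ≤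
        C * (T ^ ((n : ℝ) / ((n : ℝ) - l) - (1 + 1 / (n : ℝ))) * G) := by
  have hn0 : (0 : ℝ) < n := by positivity
  have hn2 : (2 : ℝ) ≤ n := by exact_mod_cast hn
  have hl1 : (1 : ℝ) ≤ l := by exact_mod_cast hl
  have hln' : (l : ℝ) + 1 ≤ n := by
    have : l + 1 ≤ n := by omega
    exact_mod_cast this
  set p : ℝ := 1 + 1 / (n : ℝ) with hp
  have hp0 : 0 < p := by positivity
  set α : ℝ := (n : ℝ) - l with hα
  have hα0 : 0 < α := by linarith
  set β : ℝ := n / p - α with hβ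
  have hnp : (n : ℝ) / p = n - n / (n + 1) := by rw [hp]; field_simp; ring
  have hβ0 : 0 < β := by
    rw [hβ, hnp, hα]
    have : (n : ℝ) / (n + 1) < 1 := by rw [div_lt_one (by positivity)]; linarith
    linarith
  have hαβ : α + β = n / p := by rw [hβ]; ring
  have hq0 : 0 < (n : ℝ) / α := by positivity
  have hqp : p < (n : ℝ) / α := by
    rw [lt_div_iff₀ hα0]
    have : p * α < p * (n / p) := by
      refine mul_lt_mul_of_pos_left ?_ hp0
      linarith
    rwa [mul_div_cancel₀ _ hp0.ne'] at this
  obtain ⟨C, hC, hgeom⟩ := geom_int hα0 hβ0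
  refine ⟨C ^ ((n : ℝ) / α) + 1, ?_, ?_⟩
  · exact ENNReal.add_ne_top.2 ⟨ENNReal.rpow_ne_top_of_nonneg hq0.le hC, by norm_num⟩
  intro T G hT J hJT hJG
  by_cases hT0 : T = 0
  · have : ∀ j, J j = 0 := fun j => le_antisymm (by simpa [hT0] using hJT j) bot_le
    simp [this, hq0]
  by_cases hG0 : G = 0
  · have : ∀ j, J j = 0 := by
      intro j
      have h := hJG j
      rw [hG0, nonpos_iff_eq_zero, mul_eq_zero, ENNReal.rpow_eq_zero_iff] at h
      rcases h with h | h | h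
      · exact absurd h (by rw [ENNReal.ofReal_eq_zero, not_le]; positivity)
      · exact h.1
      · exact absurd h.2 (by linarith)
    simp [this, hq0]
  by_cases hGt : G = ⊤
  · rw [hGt]
    have : T ^ ((n : ℝ) / α - p) * ⊤ = ⊤ :=
      ENNReal.mul_top (by rw [Ne, ENNReal.rpow_eq_zero_iff]; push Not; exact ⟨fun h => absurd h hT0, fun h => absurd h hT⟩)
    rw [this, ENNReal.mul_top (by simp)]
    exact le_top
  have ha0 : 0 < T.toReal := ENNReal.toReal_pos hT0 hT
  have hb0' : 0 < G.toReal := ENNReal.toReal_pos hG0 hGt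
  set b : ℝ := G.toReal ^ (1 / p) with hb
  have hb0 : 0 < b := by positivity
  have hterm : ∀ j : ℤ, ENNReal.ofReal (((2 : ℝ) ^ j) ^ (n - l)) * J j ≤
      ENNReal.ofReal (min (T.toReal * 2 ^ ((j : ℝ) * α)) (b * 2 ^ (-((j : ℝ) * β)))) := by
    intro j
    have hJt : J j ≠ ⊤ := ne_top_of_le_ne_top hT (hJT j)
    obtain ⟨x, hx0, hx⟩ : ∃ x : ℝ, 0 ≤ x ∧ J j = ENNReal.ofReal x :=
      ⟨(J j).toReal, ENNReal.toReal_nonneg, (ENNReal.ofReal_toReal hJt).symm⟩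
    have h1 : x ≤ T.toReal := by
      have := hJT j
      rw [hx] at this
      exact (ENNReal.ofReal_le_iff_le_toReal hT).1 this
    have h2 : (((2 : ℝ) ^ j) ^ n) * x ^ p ≤ G.toReal := by
      have := hJG j
      rw [hx, ENNReal.ofReal_rpow_of_nonneg hx0 hp0.le, ← ENNReal.ofReal_mul (by positivity)] at this
      exact (ENNReal.ofReal_le_iff_le_toReal hGt).1 this
    have e1 : ((2 : ℝ) ^ j) ^ (n - l) = 2 ^ ((j : ℝ) * α) := by
      rw [hα, ← Nat.cast_sub (by omega), Real.rpow_mul (by norm_num), Real.rpow_intCast,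
        Real.rpow_natCast]
    have e2 : ((2 : ℝ) ^ j) ^ n = 2 ^ ((j : ℝ) * n) := by
      rw [Real.rpow_mul (by norm_num), Real.rpow_intCast, Real.rpow_natCast]
    rw [hx, ← ENNReal.ofReal_mul (by positivity), e1]
    refine ENNReal.ofReal_le_ofReal (le_min ?_ ?_)
    · rw [mul_comm]; gcongr
    · rw [e2] at h2
      have h3 : ((2 : ℝ) ^ ((j : ℝ) * n) * x ^ p) ^ (1 / p) ≤ b :=
        Real.rpow_le_rpow (by positivity) h2 (by positivity)
      rw [Real.mul_rpow (by positivity) (by positivity), ← Real.rpow_mul hx0,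
        mul_one_div_cancel hp0.ne', Real.rpow_one, ← Real.rpow_mul (by norm_num)] at h3
      have e3 : (2 : ℝ) ^ ((j : ℝ) * α) = 2 ^ ((j : ℝ) * n * (1 / p)) * 2 ^ (-((j : ℝ) * β)) := by
        rw [← Real.rpow_add (by norm_num)]
        congr 1
        rw [hβ]; ring
      rw [e3]
      calc _ = (2 ^ ((j : ℝ) * n * (1 / p)) * x) * 2 ^ (-((j : ℝ) * β)) := by ring
        _ ≤ _ := mul_le_mul_of_nonneg_right h3 (by positivity)
  have hsum := (ENNReal.tsum_le_tsum hterm).trans (hgeom T.toReal b ha0 hb0)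
  have h4 := ENNReal.rpow_le_rpow hsum hq0.le
  refine h4.trans ?_
  rw [ENNReal.mul_rpow_of_nonneg _ _ hq0.le]
  refine mul_le_mul' le_self_add (le_of_eq ?_)
  rw [ENNReal.ofReal_rpow_of_nonneg (by positivity) hq0.le, Real.mul_rpow (by positivity) (by positivity),
    hb, ← Real.rpow_mul hb0'.le, ← Real.rpow_mul hb0'.le, ← Real.rpow_mul ha0.le, hαβ,
    ENNReal.ofReal_mul (by positivity), ← ENNReal.ofReal_rpow_of_pos ha0,
    ← ENNReal.ofReal_rpow_of_pos hb0', ENNReal.ofReal_toReal hT, ENNReal.ofReal_toReal hGt]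
  have e5 : β / (n / p) * (n / α) = n / α - p := by
    rw [hβ]; field_simp
  have e6 : 1 / p * (α / (n / p)) * (n / α) = 1 := by
    field_simp
  rw [e5]
  congr 1
  rw [e6, ENNReal.rpow_one]


variable {k : ℕ} {V E : Type*} [NormedAddCommGroup V] [InnerProductSpace ℝ V]
  [FiniteDimensional ℝ V] [NormedAddCommGroup E] [InnerProductSpace ℝ E] [FiniteDimensional ℝ E]

theorem kernel_scaled {n : ℕ} (hX : Module.finrank ℝ X = n) (A : DiffOperator X k V E)
    (hA : A.IsElliptic) (hc : A.IsCanceling) (κ : SchwartzMap X (E →L[ℝ] ℂ)) (N : ℕ) :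
    ∃ C : ℝ≥0∞, C ≠ ⊤ ∧ C ≠ 0 ∧ ∀ u : X → V, IsTestFun u → ∀ (j : ℤ) (x c : X),
      ENNReal.ofReal (((2 : ℝ) ^ (-j)) ^ n) * ‖∫ y, κ y (A.app u (x + (2 : ℝ) ^ (-j) • y))‖ₑ ≤
      C * ∫⁻ z, ENNReal.ofReal (min 1 ((2 : ℝ) ^ j * ‖z - c‖)) * wt N ((2 : ℝ) ^ j) (z - x)
        ∂(volume.withDensity fun z => ‖A.app u z‖ₑ) := by
  obtain ⟨C, hC0, hC⟩ := kernel_estimate A hA hc κ N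
  refine ⟨ENNReal.ofReal C + 1, by simp, by simp, fun u hu j x c => ?_⟩
  set t : ℝ := (2 : ℝ) ^ (-j) with ht
  set r : ℝ := (2 : ℝ) ^ j with hr
  have ht0 : 0 < t := by positivity
  have hr0 : 0 < r := by positivity
  have hrt : r * t = 1 := by rw [hr, ht, ← zpow_add₀ two_ne_zero]; simp
  have hfc : Continuous (A.app u) := (hu.app A).1.continuous
  have h1 := hC (r • (c - x)) _ (hu.scale x ht0.ne')
  simp only [app_scale A hu.1, map_smul, integral_smul, enorm_smul] at h1
  have hmul : ∀ y, ENNReal.ofReal (min 1 ‖y - r • (c - x)‖ / (1 + ‖y‖) ^ N) *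
      (‖t ^ k‖ₑ * ‖A.app u (x + t • y)‖ₑ) = ‖t ^ k‖ₑ *
      (ENNReal.ofReal (min 1 ‖y - r • (c - x)‖ / (1 + ‖y‖) ^ N) * ‖A.app u (x + t • y)‖ₑ) :=
    fun y => by ring
  simp only [hmul] at h1
  rw [lintegral_const_mul' _ _ (by simp), mul_left_comm] at h1
  have h2 := (ENNReal.mul_le_mul_iff_right (by simp [ht0.ne']) (by simp)).1 h1
  have hmw : Measurable fun z : X => ENNReal.ofReal (min 1 (r * ‖z - c‖)) * wt N r (z - x) :=
    Measurable.mul (by fun_prop) ((measurable_wt N r).comp (by fun_prop))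
  rw [lintegral_withDensity_eq_lintegral_mul _ hfc.enorm.measurable hmw]
  have h3 : ∫⁻ z, ((fun z => ‖A.app u z‖ₑ) * fun z =>
      ENNReal.ofReal (min 1 (r * ‖z - c‖)) * wt N r (z - x)) z =
      ENNReal.ofReal (t ^ n) * ∫⁻ y, ENNReal.ofReal (min 1 ‖y - r • (c - x)‖ / (1 + ‖y‖) ^ N) *
        ‖A.app u (x + t • y)‖ₑ := by
    rw [← lintegral_add_left_eq_self _ x, ← lintegral_comp_smul_pos ht0, hX]
    congr 1
    refine lintegral_congr fun y => ?_
    simp only [Pi.mul_apply, wt, add_sub_cancel_left]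
    rw [mul_comm, ← ENNReal.ofReal_mul (by positivity)]
    congr 2
    have e1 : r * ‖x + t • y - c‖ = ‖y - r • (c - x)‖ := by
      rw [← abs_of_pos hr0, ← Real.norm_eq_abs, ← norm_smul, Real.norm_eq_abs, abs_of_pos hr0]
      congr 1
      rw [smul_sub, smul_add, smul_smul, hrt, smul_sub, one_smul]
      abel
    have e2 : r * ‖t • y‖ = ‖y‖ := by
      rw [norm_smul, Real.norm_eq_abs, abs_of_pos ht0, ← mul_assoc, hrt, one_mul]
    rw [e1, e2]
    ring
  rw [h3, mul_left_comm]
  refine mul_le_mul_right (h2.trans ?_) _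
  exact mul_le_mul_left le_self_add _

theorem measurable_kernel_int (κ : SchwartzMap X (E →L[ℝ] ℂ)) {f : X → E} (hf : Continuous f)
    (t : ℝ) : Measurable fun x => ‖∫ y, κ y (f (x + t • y))‖ₑ := by
  have h : Continuous (fun q : X × X => κ q.2 (f (q.1 + t • q.2))) :=
    (κ.continuous.comp continuous_snd).clm_apply (hf.comp (by fun_prop))
  have h2 : StronglyMeasurable fun x => ∫ y, κ y (f (x + t • y)) :=
    StronglyMeasurable.integral_prod_right (f := fun x y => κ y (f (x + t • y)))
      h.stronglyMeasurable
  exact h2.measurable.enorm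

set_option maxHeartbeats 800000 in
theorem suff_component [Nontrivial X] {n m l : ℕ} (hn : 2 ≤ n) (hl : 1 ≤ l) (hln : l ≤ n - 1)
    (hX : Module.finrank ℝ X = n) (hk : k = m + l) (A : DiffOperator X k V E)
    (hA : A.IsElliptic) (hc : A.IsCanceling) (w : Fin m → X) (h : V →L[ℝ] ℂ) :
    ∃ C : ℝ≥0∞, C ≠ ⊤ ∧ ∀ u : X → V, IsTestFun u →
      ∫⁻ x, ‖h (iteratedFDeriv ℝ m u x w)‖ₑ ^ ((n : ℝ) / ((n : ℝ) - l)) ≤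
        C * (∫⁻ x, ‖A.app u x‖ₑ) ^ ((n : ℝ) / ((n : ℝ) - l)) := by
  have hn0 : (0 : ℝ) < n := by positivity
  have hn2 : (2 : ℝ) ≤ n := by exact_mod_cast hn
  have hl1 : (1 : ℝ) ≤ l := by exact_mod_cast hl
  have hln' : (l : ℝ) + 1 ≤ n := by
    have : l + 1 ≤ n := by omega
    exact_mod_cast this
  obtain ⟨κ, hκ⟩ := rep hk A hA w h
  obtain ⟨C0, hC0t, hC00, hC0⟩ := kernel_scaled hX A hA hc κ (n * (n + 2))
  obtain ⟨C1, hC1t, hC1⟩ := energy_sum (X := X) hn hX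
  obtain ⟨C2, hC2t, hC2⟩ := hedberg hn hl hln
  set p : ℝ := 1 + 1 / (n : ℝ) with hp
  have hp0 : 0 < p := by positivity
  set q : ℝ := (n : ℝ) / ((n : ℝ) - l) with hq
  have hα0 : 0 < (n : ℝ) - l := by linarith
  have hq0 : 0 < q := by positivity
  have hqp : p ≤ q := by
    rw [hq, le_div_iff₀ hα0, hp]
    have : (1 + 1 / (n : ℝ)) * (n - l) ≤ (1 + 1 / (n : ℝ)) * (n - 1) :=
      mul_le_mul_of_nonneg_left (by linarith) (by positivity)
    refine this.trans ?_
    have : (1 + 1 / (n : ℝ)) * (n - 1) = n - 1 / n := by field_simp; ring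
    rw [this]
    have : 0 < 1 / (n : ℝ) := by positivity
    linarith
  refine ⟨C0 ^ q * (C2 * C1), ?_, fun u hu => ?_⟩
  · exact ENNReal.mul_ne_top (ENNReal.rpow_ne_top_of_nonneg hq0.le hC0t)
      (ENNReal.mul_ne_top hC2t hC1t)
  have hf := hu.app A
  have hfc : Continuous (A.app u) := hf.1.continuous
  have hfi : Integrable (A.app u) := hfc.integrable_of_hasCompactSupport hf.2
  set ν : Measure X := volume.withDensity fun z => ‖A.app u z‖ₑ with hν
  have hνu : ν Set.univ = ∫⁻ x, ‖A.app u x‖ₑ := by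
    rw [hν, withDensity_apply _ MeasurableSet.univ, Measure.restrict_univ]
  have hνt : ν Set.univ ≠ ⊤ := by rw [hνu]; exact hfi.2.ne
  haveI : IsFiniteMeasure ν := ⟨hνt.lt_top⟩
  set I : ℤ → X → ℝ≥0∞ := fun j x => ‖∫ y, κ y (A.app u (x + (2 : ℝ) ^ (-j) • y))‖ₑ with hI
  set J : ℤ → X → ℝ≥0∞ := fun j x => C0⁻¹ * (ENNReal.ofReal (((2 : ℝ) ^ (-j)) ^ n) * I j x) with hJ
  have hIm : ∀ j, Measurable (I j) := fun j => measurable_kernel_int κ hfc _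
  have hJm : ∀ j, Measurable (J j) := fun j => ((hIm j).const_mul _).const_mul _
  have hJb : ∀ j x c, J j x ≤ ∫⁻ z, ENNReal.ofReal (min 1 ((2 : ℝ) ^ j * ‖z - c‖)) *
      wt (n * (n + 2)) ((2 : ℝ) ^ j) (z - x) ∂ν := by
    intro j x c
    rw [hJ]
    refine (mul_le_mul_right (hC0 u hu j x c) _).trans (le_of_eq ?_)
    rw [← mul_assoc, ENNReal.inv_mul_cancel hC00 hC0t, one_mul]
  have hJT : ∀ j x, J j x ≤ ν Set.univ := by
    intro j x
    refine (hJb j x 0).trans ?_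
    rw [← lintegral_one]
    refine lintegral_mono fun z => ?_
    refine (mul_le_mul' (b := 1) (d := 1) ?_ (wt_le_one _ (by positivity) _)).trans (by simp)
    rw [← ENNReal.ofReal_one]
    exact ENNReal.ofReal_le_ofReal (min_le_left _ _)
  have hE := hC1 ν J hJb
  set G : X → ℝ≥0∞ := fun x => ∑' j : ℤ, ENNReal.ofReal (((2 : ℝ) ^ j) ^ n) * J j x ^ p with hG
  have hGint : ∫⁻ x, G x ≤ C1 * ν Set.univ ^ p := by
    rw [hG, lintegral_tsum (fun j => (((hJm j).pow_const p).const_mul _).aemeasurable)]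
    exact hE
  have hpt : ∀ x, ‖h (iteratedFDeriv ℝ m u x w)‖ₑ ^ q ≤
      C0 ^ q * (C2 * (ν Set.univ ^ (q - p) * G x)) := by
    intro x
    have a1 := hC2 (ν Set.univ) (G x) hνt (fun j => J j x) (fun j => hJT j x)
      (fun j => ENNReal.le_tsum (f := fun j : ℤ => ENNReal.ofReal (((2 : ℝ) ^ j) ^ n) * J j x ^ p) j)
    refine le_trans ?_ (mul_le_mul_right a1 _)
    rw [← ENNReal.mul_rpow_of_nonneg _ _ hq0.le]
    refine ENNReal.rpow_le_rpow ((hκ u hu x).trans (le_of_eq ?_)) hq0.le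
    rw [← ENNReal.tsum_mul_left]
    refine tsum_congr fun j => ?_
    have e1 : ENNReal.ofReal (((2 : ℝ) ^ (-j)) ^ l) = ENNReal.ofReal (((2 : ℝ) ^ j) ^ (n - l)) *
        ENNReal.ofReal (((2 : ℝ) ^ (-j)) ^ n) := by
      rw [← ENNReal.ofReal_mul (by positivity)]
      congr 1
      have : ((2 : ℝ) ^ (-j)) ^ n = ((2 : ℝ) ^ (-j)) ^ (n - l) * ((2 : ℝ) ^ (-j)) ^ l := by
        rw [← pow_add]; congr 1; omega
      rw [this, ← mul_assoc, ← mul_pow, ← zpow_add₀ two_ne_zero]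
      simp
    rw [e1]
    simp only [hJ]
    calc _ = (C0 * C0⁻¹) * (ENNReal.ofReal (((2 : ℝ) ^ j) ^ (n - l)) *
        ENNReal.ofReal (((2 : ℝ) ^ (-j)) ^ n) * I j x) := by
          rw [ENNReal.mul_inv_cancel hC00 hC0t, one_mul]
      _ = _ := by ring
  refine (lintegral_mono hpt).trans ?_
  have hpow : ν Set.univ ^ (q - p) ≠ ⊤ := ENNReal.rpow_ne_top_of_nonneg (by linarith) hνt
  rw [lintegral_const_mul' _ _ (ENNReal.rpow_ne_top_of_nonneg hq0.le hC0t),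
    lintegral_const_mul' _ _ hC2t, lintegral_const_mul' _ _ hpow, ← hνu]
  calc _ ≤ C0 ^ q * (C2 * (ν Set.univ ^ (q - p) * (C1 * ν Set.univ ^ p))) := by gcongr
    _ = C0 ^ q * (C2 * C1) * (ν Set.univ ^ (q - p) * ν Set.univ ^ p) := by ring
    _ = _ := by
      rw [← ENNReal.rpow_add_of_nonneg _ _ (by linarith) hp0.le]
      congr 2
      ring

theorem multilinear_bound {m : ℕ} (M : ContinuousMultilinearMap ℝ (fun _ : Fin m => X) V) :
    ‖M‖ ≤ ∑ σ : (Fin m → Fin (Module.finrank ℝ X)), ∑ i : Fin (Module.finrank ℝ V),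
      ‖(Complex.ofRealCLM.comp (innerSL ℝ (stdOrthonormalBasis ℝ V i)))
        (M (fun s => stdOrthonormalBasis ℝ X (σ s)))‖ := by
  classical
  set b := stdOrthonormalBasis ℝ X
  set e := stdOrthonormalBasis ℝ V
  refine ContinuousMultilinearMap.opNorm_le_bound (by positivity) fun x => ?_
  have hv : ∀ v : V, ‖v‖ ≤ ∑ i, ‖(Complex.ofRealCLM.comp (innerSL ℝ (e i))) v‖ := by
    intro v
    conv_lhs => rw [← e.sum_repr' v]
    refine (norm_sum_le _ _).trans (Finset.sum_le_sum fun i _ => ?_)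
    rw [norm_smul]
    simp
  have hx : M x = ∑ σ : (Fin m → Fin (Module.finrank ℝ X)),
      (∏ s, ⟪b (σ s), x s⟫) • M (fun s => b (σ s)) := by
    conv_lhs => rw [show x = fun s => ∑ a, ⟪b a, x s⟫ • b a from
      funext fun s => (b.sum_repr' (x s)).symm]
    rw [M.map_sum]
    refine Finset.sum_congr rfl fun σ _ => ?_
    rw [M.map_smul_univ]
  rw [hx, Finset.sum_mul]
  refine (norm_sum_le _ _).trans (Finset.sum_le_sum fun σ _ => ?_)
  rw [norm_smul, mul_comm]
  refine mul_le_mul (hv _) ?_ (norm_nonneg _) (by positivity)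
  rw [norm_prod]
  refine Finset.prod_le_prod (fun _ _ => norm_nonneg _) fun s _ => ?_
  refine (norm_inner_le_norm _ _).trans ?_
  simp

theorem sufficiency [Nontrivial X] {n m l : ℕ} (hn : 2 ≤ n) (hl : 1 ≤ l) (hln : l ≤ n - 1)
    (hX : Module.finrank ℝ X = n) (hk : k = m + l) (A : DiffOperator X k V E)
    (hA : A.IsElliptic) (hc : A.IsCanceling) :
    ∃ C : ℝ, 0 < C ∧ ∀ u : X → V, IsTestFun u →
      (∫⁻ x, ‖iteratedFDeriv ℝ m u x‖ₑ ^ ((n : ℝ) / ((n : ℝ) - l))) ^ (1 - (l : ℝ) / n) ≤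
        ENNReal.ofReal C * (∫⁻ x, ‖A.app u x‖ₑ) := by
  have hn0 : (0 : ℝ) < n := by positivity
  have hl1 : (1 : ℝ) ≤ l := by exact_mod_cast hl
  have hln' : (l : ℝ) + 1 ≤ n := by
    have : l + 1 ≤ n := by omega
    exact_mod_cast this
  have hα0 : 0 < (n : ℝ) - l := by linarith
  set q : ℝ := (n : ℝ) / ((n : ℝ) - l) with hq
  have hq1 : 1 ≤ q := by rw [hq, le_div_iff₀ hα0]; linarith
  have hq0 : 0 < q := by linarith
  have hexp : 1 - (l : ℝ) / n = q⁻¹ := by rw [hq]; field_simp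
  rw [hexp]
  choose C hCt hC using fun (s : (Fin m → Fin (Module.finrank ℝ X)) × Fin (Module.finrank ℝ V)) =>
    suff_component hn hl hln hX hk A hA hc (fun t => stdOrthonormalBasis ℝ X (s.1 t))
      (Complex.ofRealCLM.comp (innerSL ℝ (stdOrthonormalBasis ℝ V s.2)))
  set S := Finset.univ (α := (Fin m → Fin (Module.finrank ℝ X)) × Fin (Module.finrank ℝ V))
  set K : ℝ≥0∞ := (S.card : ℝ≥0∞) ^ (q - 1) * ∑ s ∈ S, C s with hK
  have hKt : K ≠ ⊤ := ENNReal.mul_ne_top (ENNReal.rpow_ne_top_of_nonneg (by linarith) (by simp))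
    (ENNReal.sum_ne_top.2 fun s _ => hCt s)
  have hKt2 : K ^ q⁻¹ ≠ ⊤ := ENNReal.rpow_ne_top_of_nonneg (by positivity) hKt
  refine ⟨(K ^ q⁻¹).toReal + 1, by positivity, fun u hu => ?_⟩
  set Φ : (Fin m → Fin (Module.finrank ℝ X)) × Fin (Module.finrank ℝ V) → X → ℂ := fun s x =>
    (Complex.ofRealCLM.comp (innerSL ℝ (stdOrthonormalBasis ℝ V s.2)))
      (iteratedFDeriv ℝ m u x (fun t => stdOrthonormalBasis ℝ X (s.1 t))) with hΦ
  have hmeas : ∀ s ∈ S, Measurable fun x =>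
      ‖Φ s x‖ₑ ^ q := fun s _ =>
    ((hu.evalT _ _).1.continuous.enorm.measurable).pow_const _
  have h1 : ∫⁻ x, ‖iteratedFDeriv ℝ m u x‖ₑ ^ q ≤ K * (∫⁻ x, ‖A.app u x‖ₑ) ^ q := by
    calc _ ≤ ∫⁻ x, (S.card : ℝ≥0∞) ^ (q - 1) * ∑ s ∈ S,
        ‖Φ s x‖ₑ ^ q := by
          refine lintegral_mono fun x => ?_
          refine le_trans (ENNReal.rpow_le_rpow ?_ hq0.le)
            (ENNReal.rpow_sum_le_const_mul_sum_rpow _ _ hq1)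
          have := multilinear_bound (iteratedFDeriv ℝ m u x)
          rw [← Finset.sum_product', Finset.univ_product_univ] at this
          simp only [← ofReal_norm]
          rw [← ENNReal.ofReal_sum_of_nonneg fun _ _ => norm_nonneg _]
          exact ENNReal.ofReal_le_ofReal this
      _ = (S.card : ℝ≥0∞) ^ (q - 1) * ∑ s ∈ S, ∫⁻ x,
        ‖Φ s x‖ₑ ^ q := by
          rw [lintegral_const_mul' _ _ (ENNReal.rpow_ne_top_of_nonneg (by linarith) (by simp)),
            lintegral_finsetSum _ hmeas]
      _ ≤ (S.card : ℝ≥0∞) ^ (q - 1) * ∑ s ∈ S, C s * (∫⁻ x, ‖A.app u x‖ₑ) ^ q := by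
          refine mul_le_mul_right (Finset.sum_le_sum fun s _ => ?_) _
          exact hC s u hu
      _ = _ := by rw [← Finset.sum_mul, hK, mul_assoc]
  have h2 := ENNReal.rpow_le_rpow h1 (inv_nonneg.2 hq0.le)
  refine h2.trans ?_
  rw [ENNReal.mul_rpow_of_nonneg _ _ (inv_nonneg.2 hq0.le), ← ENNReal.rpow_mul,
    mul_inv_cancel₀ hq0.ne', ENNReal.rpow_one]
  refine mul_le_mul_left ?_ _
  rw [ENNReal.ofReal_add (by positivity) (by norm_num), ENNReal.ofReal_toReal hKt2]
  exact le_self_add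

end suffSec

section extendSchwartz
open Filter Topology

variable {X : Type} [NormedAddCommGroup X] [InnerProductSpace ℝ X] [FiniteDimensional ℝ X]
  [MeasurableSpace X] [BorelSpace X]
  {V E : Type*} [NormedAddCommGroup V] [InnerProductSpace ℝ V]
  [FiniteDimensional ℝ V] [NormedAddCommGroup E] [InnerProductSpace ℝ E] [FiniteDimensional ℝ E]

theorem rho_deriv_bound (i : ℕ) : ∃ M : ℝ, ∀ (s : ℝ), 0 ≤ s → s ≤ 1 → ∀ x : X,
    ‖iteratedFDeriv ℝ i (fun y : X => rho (s • y)) x‖ ≤ M := by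
  have hc : Continuous (iteratedFDeriv ℝ i (rho : X → ℝ)) :=
    rho_contDiff.continuous_iteratedFDeriv (mod_cast le_top)
  obtain ⟨M, hM⟩ := hc.bounded_above_of_compact_support
    (HasCompactSupport.iteratedFDeriv (𝕜 := ℝ) rho_compact i)
  refine ⟨M, fun s hs hs1 x => ?_⟩
  rw [iteratedFDeriv_comp_const_smul s (rho_contDiff.of_le (mod_cast le_top))]
  rw [norm_smul, norm_pow, Real.norm_of_nonneg hs]
  calc s ^ i * ‖iteratedFDeriv ℝ i rho (s • x)‖ ≤ 1 * M :=
        mul_le_mul (pow_le_one₀ hs hs1) (hM _) (norm_nonneg _) zero_le_one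
    _ = M := one_mul _

theorem cutoff_testFun (U : SchwartzMap X V) {s : ℝ} (hs : 0 < s) :
    IsTestFun (fun x : X => rho (s • x) • U x) := by
  refine ⟨(rho_contDiff.comp (contDiff_const_smul s)).smul (U.smooth ⊤), ?_⟩
  have h : HasCompactSupport (fun x : X => rho (s • x)) :=
    rho_compact.comp_smul hs.ne'
  exact h.smul_right

theorem cutoff_eventually (U : SchwartzMap X V) (j : ℕ) (x : X) :
    ∀ᶠ N : ℕ in atTop,
      iteratedFDeriv ℝ j (fun y : X => rho (((N : ℝ) + 1)⁻¹ • y) • U y) x =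
        iteratedFDeriv ℝ j (U : X → V) x := by
  obtain ⟨N₀, hN₀⟩ := exists_nat_gt (‖x‖ + 1)
  filter_upwards [eventually_ge_atTop N₀] with N hN
  refine Filter.EventuallyEq.eq_of_nhds (Filter.EventuallyEq.iteratedFDeriv ℝ ?_ j)
  filter_upwards [Metric.ball_mem_nhds x one_pos] with y hy
  have h1 : ‖y‖ ≤ (N : ℝ) + 1 := by
    have : ‖y‖ ≤ ‖x‖ + ‖y - x‖ := by
      have := norm_add_le x (y - x); simpa using this
    have h2 : ‖y - x‖ < 1 := by simpa [dist_eq_norm] using hy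
    have h3 : (N₀ : ℝ) ≤ N := by exact_mod_cast hN
    linarith
  rw [rho_one, one_smul]
  rw [norm_smul, norm_inv, Real.norm_of_nonneg (by positivity)]
  rw [inv_mul_le_iff₀ (by positivity)]
  simpa using h1

theorem extend_schwartz {k m : ℕ} (A : DiffOperator X k V E) {K : ℝ≥0∞} (hK : K ≠ ⊤) {q p : ℝ}
    (h : ∀ u : X → V, IsTestFun u →
      ∫⁻ x, ‖iteratedFDeriv ℝ m u x‖ₑ ^ q ≤ (K * ∫⁻ x, ‖A.app u x‖ₑ) ^ p)
    (U : SchwartzMap X V) :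
    ∫⁻ x, ‖iteratedFDeriv ℝ m (U : X → V) x‖ₑ ^ q ≤ (K * ∫⁻ x, ‖A.app U x‖ₑ) ^ p := by
  set u : ℕ → X → V := fun N x => rho (((N : ℝ) + 1)⁻¹ • x) • U x with hu
  have hut : ∀ N, IsTestFun (u N) := fun N => cutoff_testFun U (by positivity)
  choose M hM using fun i => rho_deriv_bound (X := X) i
  have hlim : Tendsto (fun N => ∫⁻ x, ‖A.app (u N) x‖ₑ) atTop (𝓝 (∫⁻ x, ‖A.app U x‖ₑ)) := by
    set b : X → ℝ := fun x => ‖A‖ * ∑ i ∈ Finset.range (k + 1),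
      (k.choose i : ℝ) * M i * ‖iteratedFDeriv ℝ (k - i) (U : X → V) x‖ with hb
    have hbi : Integrable b := by
      refine Integrable.const_mul (integrable_finsetSum _ fun i _ => ?_) _
      have := U.integrable_pow_mul_iteratedFDeriv volume 0 (k - i)
      simp only [pow_zero, one_mul] at this
      exact this.const_mul _
    refine tendsto_lintegral_of_dominated_convergence (fun x => ENNReal.ofReal (b x)) ?_ ?_ ?_ ?_
    · intro N
      exact ((hut N).app A).1.continuous.enorm.measurable
    · intro N
      refine Eventually.of_forall fun x => ?_
      show ‖A.app (u N) x‖ₑ ≤ _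
      rw [← ofReal_norm]
      refine ENNReal.ofReal_le_ofReal ?_
      refine (A.le_opNorm _).trans ?_
      refine mul_le_mul_of_nonneg_left ?_ (norm_nonneg _)
      have hs : (0:ℝ) ≤ ((N : ℝ) + 1)⁻¹ := by positivity
      have hs1 : ((N : ℝ) + 1)⁻¹ ≤ 1 := inv_le_one_of_one_le₀ (by
        have : (0:ℝ) ≤ N := by positivity
        linarith)
      refine (norm_iteratedFDeriv_smul_le (N := (⊤ : ℕ∞))
        (rho_contDiff.comp (contDiff_const_smul _)) (U.smooth ⊤) x (mod_cast le_top)).trans ?_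
      refine Finset.sum_le_sum fun i _ => ?_
      refine mul_le_mul_of_nonneg_right ?_ (norm_nonneg _)
      exact mul_le_mul_of_nonneg_left (hM i _ hs hs1 x) (Nat.cast_nonneg _)
    · exact hbi.lintegral_lt_top.ne
    · refine Eventually.of_forall fun x => ?_
      refine tendsto_const_nhds.congr' ?_
      filter_upwards [cutoff_eventually U k x] with N hN
      simp only [DiffOperator.app, hu]
      rw [hN]
  have hlim2 : Tendsto (fun N => (K * ∫⁻ x, ‖A.app (u N) x‖ₑ) ^ p) atTop
      (𝓝 ((K * ∫⁻ x, ‖A.app U x‖ₑ) ^ p)) :=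
    (ENNReal.continuous_rpow_const.tendsto _).comp (ENNReal.Tendsto.const_mul hlim (Or.inr hK))
  calc ∫⁻ x, ‖iteratedFDeriv ℝ m (U : X → V) x‖ₑ ^ q
      = ∫⁻ x, liminf (fun N => ‖iteratedFDeriv ℝ m (u N) x‖ₑ ^ q) atTop := by
        refine lintegral_congr fun x => ?_
        refine (Tendsto.liminf_eq ?_).symm
        refine tendsto_const_nhds.congr' ?_
        filter_upwards [cutoff_eventually U m x] with N hN
        simp only [hu]
        rw [hN]
    _ ≤ liminf (fun N => ∫⁻ x, ‖iteratedFDeriv ℝ m (u N) x‖ₑ ^ q) atTop := by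
        refine lintegral_liminf_le fun N => ?_
        exact (((hut N).1.continuous_iteratedFDeriv (m := m)
          (mod_cast le_top)).enorm.measurable).pow_const _
    _ ≤ liminf (fun N => (K * ∫⁻ x, ‖A.app (u N) x‖ₑ) ^ p) atTop :=
        liminf_le_liminf (Eventually.of_forall fun N => h _ (hut N))
    _ = _ := hlim2.liminf_eq

end extendSchwartz

section derivRep
open Filter Topology FourierTransform Real

variable {X : Type} [NormedAddCommGroup X] [InnerProductSpace ℝ X] [FiniteDimensional ℝ X]
  [MeasurableSpace X] [BorelSpace X]
  {V E : Type*} [NormedAddCommGroup V] [InnerProductSpace ℝ V]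
  [FiniteDimensional ℝ V] [NormedAddCommGroup E] [InnerProductSpace ℝ E] [FiniteDimensional ℝ E]

/-- The map `z ↦ Re (c z) • x`. -/
def reC (c : ℂ) (x : V) : ℂ →L[ℝ] V :=
  (Complex.reCLM.comp (ContinuousLinearMap.mul ℝ ℂ c)).smulRight x

theorem reC_apply (c z : ℂ) (x : V) : reC c x z = (c * z).re • x := rfl

theorem exists_U_scalar (ψ : SchwartzMap X ℝ) (b : V) (c : ℂ) :
    ∃ U : SchwartzMap X V, ∀ (j : ℕ) (x : X),
    Integrable (fun ξ : X => (c * ((-(2 * π * Complex.I)) ^ j * (𝐞 (-⟪ξ, x⟫) : ℂ))).re •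
      tens j ξ (ψ ξ • b)) ∧
    iteratedFDeriv ℝ j (U : X → V) x = ∫ ξ : X,
      (c * ((-(2 * π * Complex.I)) ^ j * (𝐞 (-⟪ξ, x⟫) : ℂ))).re • tens j ξ (ψ ξ • b) := by
  obtain ⟨Ψ, hΨ⟩ : ∃ Ψ : SchwartzMap X ℂ, ∀ ξ, Ψ ξ = (ψ ξ : ℂ) :=
    ⟨SchwartzMap.postcompCLM (𝕜 := ℝ) Complex.ofRealCLM ψ, fun ξ => rfl⟩
  refine ⟨SchwartzMap.postcompCLM (𝕜 := ℝ) (reC c b) (𝓕 Ψ), fun j x => ?_⟩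
  have hi := fun j : ℕ => Ψ.integrable_pow_mul volume j
  have e1 : iteratedFDeriv ℝ j (SchwartzMap.postcompCLM (𝕜 := ℝ) (reC c b) (𝓕 Ψ) : X → V) x =
      (reC c b).compContinuousMultilinearMap (iteratedFDeriv ℝ j (𝓕 (Ψ : X → ℂ)) x) := by
    have := (reC c b).iteratedFDeriv_comp_left (f := (𝓕 Ψ : SchwartzMap X ℂ)) (x := x)
      (n := (⊤ : ℕ∞)) ((𝓕 Ψ : SchwartzMap X ℂ).smooth ⊤).contDiffAt (i := j)
      (mod_cast le_top)
    rw [SchwartzMap.fourier_coe] at this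
    exact this
  rw [e1, Real.iteratedFDeriv_fourier (N := (⊤ : ℕ∞)) (fun n _ => hi n)
    Ψ.continuous.aestronglyMeasurable le_top]
  set F : X → ContinuousMultilinearMap ℝ (fun _ : Fin j => X) ℂ := fun v =>
    VectorFourier.fourierPowSMulRight (innerSL ℝ) Ψ v j with hF
  have hFi : Integrable F := VectorFourier.integrable_fourierPowSMulRight _ (hi j)
    Ψ.continuous.aestronglyMeasurable
  have hFi2 : Integrable (fun ξ => 𝐞 (-⟪ξ, x⟫) • F ξ) :=
    (Real.fourierIntegral_convergent_iff x).2 hFi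
  set L := (ContinuousLinearMap.compContinuousMultilinearMapL ℝ (fun _ : Fin j => X)
    ℂ V (reC c b)) with hL
  have hpt : ∀ ξ : X, L (𝐞 (-⟪ξ, x⟫) • F ξ) =
      (c * ((-(2 * π * Complex.I)) ^ j * (𝐞 (-⟪ξ, x⟫) : ℂ))).re • tens j ξ (ψ ξ • b) := by
    intro ξ
    ext w
    have h2 : (𝐞 (-⟪ξ, x⟫) • F ξ) w = (((-(2 * π * Complex.I)) ^ j * (𝐞 (-⟪ξ, x⟫) : ℂ)) *
        (((∏ i, ⟪ξ, w i⟫) * ψ ξ : ℝ) : ℂ)) := by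
      have h3 : (𝐞 (-⟪ξ, x⟫) • F ξ) w = (𝐞 (-⟪ξ, x⟫) : ℂ) • (F ξ w) := rfl
      rw [h3, hF]
      simp only [VectorFourier.fourierPowSMulRight_apply, hΨ]
      have h4 : (∏ i, (innerSL ℝ ξ) (w i)) = ∏ i, ⟪ξ, w i⟫ := rfl
      rw [h4]
      simp only [smul_eq_mul, Complex.real_smul, Complex.ofReal_mul]
      ring
    show reC c b ((𝐞 (-⟪ξ, x⟫) • F ξ) w) = _
    rw [h2, reC_apply, smul_apply, tens_apply, smul_smul, smul_smul, ← mul_assoc,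
      Complex.re_mul_ofReal, mul_assoc _ (∏ i, ⟪ξ, w i⟫)]
  refine ⟨?_, ?_⟩
  · exact (L.integrable_comp hFi2).congr (Eventually.of_forall hpt)
  · rw [Real.fourier_eq]
    show L (∫ ξ, 𝐞 (-⟪ξ, x⟫) • F ξ) = _
    rw [← ContinuousLinearMap.integral_comp_comm L hFi2]
    exact integral_congr_ae (Eventually.of_forall hpt)

theorem integrable_sum_aux {α ι W : Type*} [MeasurableSpace α] {μ : Measure α} [Fintype ι]
    [NormedAddCommGroup W] {G : ι → α → W} (h : ∀ i, Integrable (G i) μ) :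
    Integrable (fun ξ => ∑ i, G i ξ) μ := integrable_finsetSum _ fun i _ => h i

theorem exists_U (ψ : SchwartzMap X V) (c : ℂ) : ∃ U : SchwartzMap X V, ∀ (j : ℕ) (x : X),
    Integrable (fun ξ : X => (c * ((-(2 * π * Complex.I)) ^ j * (𝐞 (-⟪ξ, x⟫) : ℂ))).re •
      tens j ξ (ψ ξ)) ∧
    iteratedFDeriv ℝ j (U : X → V) x = ∫ ξ : X,
      (c * ((-(2 * π * Complex.I)) ^ j * (𝐞 (-⟪ξ, x⟫) : ℂ))).re • tens j ξ (ψ ξ) := by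
  obtain ⟨b⟩ : Nonempty (OrthonormalBasis (Fin (Module.finrank ℝ V)) ℝ V) :=
    ⟨stdOrthonormalBasis ℝ V⟩
  obtain ⟨φ, hφ⟩ : ∃ φ : Fin (Module.finrank ℝ V) → SchwartzMap X ℝ, ∀ i ξ, φ i ξ = ⟪b i, ψ ξ⟫ :=
    ⟨fun i => SchwartzMap.postcompCLM (𝕜 := ℝ) (innerSL ℝ (b i)) ψ, fun i ξ => rfl⟩
  choose U hU using fun i => exists_U_scalar (φ i) (b i) c
  have hψ : ∀ ξ, ψ ξ = ∑ i, φ i ξ • b i := by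
    intro ξ
    simp_rw [hφ]
    exact (b.sum_repr' (ψ ξ)).symm
  have hs : ∀ (j : ℕ) (x ξ : X),
      (c * ((-(2 * π * Complex.I)) ^ j * (𝐞 (-⟪ξ, x⟫) : ℂ))).re • tens j ξ (ψ ξ) =
      ∑ i, (c * ((-(2 * π * Complex.I)) ^ j * (𝐞 (-⟪ξ, x⟫) : ℂ))).re • tens j ξ
        (φ i ξ • b i) := by
    intro j x ξ
    rw [← Finset.smul_sum, ← map_sum, ← hψ]
  refine ⟨∑ i, U i, fun j x => ?_⟩
  obtain ⟨G, hG⟩ : ∃ G : Fin (Module.finrank ℝ V) → X →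
      ContinuousMultilinearMap ℝ (fun _ : Fin j => X) V, G = fun i ξ =>
      (c * ((-(2 * π * Complex.I)) ^ j * (𝐞 (-⟪ξ, x⟫) : ℂ))).re • tens j ξ (φ i ξ • b i) :=
    ⟨_, rfl⟩
  have hG1 : ∀ i, Integrable (G i) := by
    intro i; rw [hG]; exact (hU i j x).1
  have hG2 : ∀ i, iteratedFDeriv ℝ j (U i) x = ∫ ξ, G i ξ := by
    intro i; rw [hG]; exact (hU i j x).2
  have hG3 : (fun ξ => (c * ((-(2 * π * Complex.I)) ^ j * (𝐞 (-⟪ξ, x⟫) : ℂ))).re •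
      tens j ξ (ψ ξ)) = fun ξ => ∑ i, G i ξ := by
    ext1 ξ; rw [hs, hG]
  rw [hG3]
  refine ⟨integrable_sum_aux hG1, ?_⟩
  rw [integral_finsetSum _ fun i _ => hG1 i]
  have e : ((∑ i, U i : SchwartzMap X V) : X → V) = fun x => ∑ i, U i x := by
    ext y; simp
  rw [e, iteratedFDeriv_fun_sum_apply (𝕜 := ℝ)
    (fun i _ => (((U i).smooth ⊤).of_le (mod_cast le_top)).contDiffAt)]
  exact Finset.sum_congr rfl fun i _ => hG2 i

/-- Scalar consequence. -/
theorem re_fourier {γ : X → ℝ} (hγ : Integrable γ) (a : ℂ) (x : X) :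
    ∫ ξ : X, (a * (𝐞 (-⟪ξ, x⟫) : ℂ)).re * γ ξ = (a * 𝓕 (fun ξ => (γ ξ : ℂ)) x).re := by
  have h1 : Integrable (fun ξ : X => 𝐞 (-⟪ξ, x⟫) • (γ ξ : ℂ)) :=
    (Real.fourierIntegral_convergent_iff x).2 hγ.ofReal
  rw [Real.fourier_eq, ← integral_const_mul]
  have := (Complex.reCLM).integral_comp_comm (h1.const_mul a)
  simp only [Complex.reCLM_apply] at this
  rw [← this]
  refine integral_congr_ae (Eventually.of_forall fun ξ => ?_)
  show _ = (a * ((𝐞 (-⟪ξ, x⟫) : ℂ) * (γ ξ : ℂ))).re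
  rw [← mul_assoc, Complex.re_mul_ofReal]

theorem exists_U_app {k m : ℕ} (A : DiffOperator X k V E) (e : E) (v : X → V)
    (τ : X → ℝ) (hτ : ContDiff ℝ (⊤ : ℕ∞) τ) (hτc : HasCompactSupport τ)
    (hψ : ContDiff ℝ (⊤ : ℕ∞) (fun ξ => τ ξ • v ξ))
    (hv : ∀ ξ, τ ξ ≠ 0 → A.symbol ξ (v ξ) = e) (c : ℂ) (w : Fin m → X) (h : V →L[ℝ] ℝ) :
    ∃ U : SchwartzMap X V, ∀ x : X,
      A.app U x = (c * (-(2 * π * Complex.I)) ^ k * 𝓕 (fun ξ => (τ ξ : ℂ)) x).re • e ∧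
      h (iteratedFDeriv ℝ m (U : X → V) x w) = (c * (-(2 * π * Complex.I)) ^ m *
        𝓕 (fun ξ => ((τ ξ * ((∏ i, ⟪ξ, w i⟫) * h (v ξ)) : ℝ) : ℂ)) x).re := by
  have hψc : HasCompactSupport (fun ξ => τ ξ • v ξ) := hτc.smul_right
  obtain ⟨ψ, hψe⟩ : ∃ ψ : SchwartzMap X V, ∀ ξ, ψ ξ = τ ξ • v ξ :=
    ⟨hψc.toSchwartzMap hψ, fun _ => rfl⟩
  obtain ⟨U, hU⟩ := exists_U ψ c
  refine ⟨U, fun x => ⟨?_, ?_⟩⟩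
  · obtain ⟨h1, h2⟩ := hU k x
    have hτi : Integrable τ := hτ.continuous.integrable_of_hasCompactSupport hτc
    rw [DiffOperator.app, h2, ← ContinuousLinearMap.integral_comp_comm A h1, ← re_fourier hτi,
      ← integral_smul_const]
    refine integral_congr_ae (Eventually.of_forall fun ξ => ?_)
    show A _ = _
    beta_reduce
    rw [map_smul, hψe, ← symbol_eq, map_smul, mul_assoc c]
    by_cases h0 : τ ξ = 0
    · simp [h0]
    · rw [hv ξ h0, smul_smul]
  · obtain ⟨h1, h2⟩ := hU m x
    set T : ContinuousMultilinearMap ℝ (fun _ : Fin m => X) V →L[ℝ] ℝ :=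
      h.comp (ContinuousMultilinearMap.apply ℝ (fun _ : Fin m => X) V w) with hT
    have hTa : ∀ B, T B = h (B w) := fun B => rfl
    set γ : X → ℝ := fun ξ => τ ξ * ((∏ i, ⟪ξ, w i⟫) * h (v ξ)) with hγ
    have hγ2 : ∀ ξ, γ ξ = T (tens m ξ (ψ ξ)) := by
      intro ξ
      rw [hTa, tens_apply, hψe, map_smul, map_smul, hγ]
      simp only [smul_eq_mul]
      ring
    have hγi : Integrable γ := by
      have hc : Continuous γ := by
        have : γ = fun ξ => (∏ i, ⟪ξ, w i⟫) * h (τ ξ • v ξ) := by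
          ext ξ; rw [map_smul, hγ]; simp only [smul_eq_mul]; ring
        rw [this]
        exact (continuous_finsetProd _ fun i _ => by fun_prop).mul
          (h.continuous.comp hψ.continuous)
      exact hc.integrable_of_hasCompactSupport hτc.mul_right
    rw [← hTa, h2, ← ContinuousLinearMap.integral_comp_comm T h1, ← re_fourier hγi]
    refine integral_congr_ae (Eventually.of_forall fun ξ => ?_)
    show T _ = _
    beta_reduce
    rw [map_smul, hγ2, mul_assoc c]
    rfl

end derivRep

section uniformBound
open Filter Topology FourierTransform Real

variable {X : Type} [NormedAddCommGroup X] [InnerProductSpace ℝ X] [FiniteDimensional ℝ X]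
  [MeasurableSpace X] [BorelSpace X]
  {V E : Type*} [NormedAddCommGroup V] [InnerProductSpace ℝ V]
  [FiniteDimensional ℝ V] [NormedAddCommGroup E] [InnerProductSpace ℝ E] [FiniteDimensional ℝ E]

/-- Annular cutoff. -/
def tauL (r : ℝ) (ξ : X) : ℝ := rho (r⁻¹ • ξ) - rho (r • ξ)

theorem tauL_contDiff (r : ℝ) : ContDiff ℝ (⊤ : ℕ∞) (tauL r : X → ℝ) :=
  (rho_contDiff.comp (contDiff_const_smul _)).sub (rho_contDiff.comp (contDiff_const_smul _))

theorem tauL_compact {r : ℝ} (hr : 0 < r) : HasCompactSupport (tauL r : X → ℝ) := by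
  have h1 : HasCompactSupport (fun x : X => rho (r⁻¹ • x)) :=
    rho_compact.comp_smul (inv_ne_zero hr.ne')
  have h2 : HasCompactSupport (fun x : X => rho (r • x)) := rho_compact.comp_smul hr.ne'
  exact h1.sub h2

theorem tauL_one {r : ℝ} (hr : 0 < r) {ξ : X} (h1 : 3 / 2 ≤ r * ‖ξ‖) (h2 : ‖ξ‖ ≤ r) :
    tauL r ξ = 1 := by
  rw [tauL, rho_one, rho_zero, sub_zero]
  · rwa [norm_smul, Real.norm_of_nonneg hr.le]
  · rw [norm_smul, norm_inv, Real.norm_of_nonneg hr.le, inv_mul_le_iff₀ hr]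
    simpa using h2

theorem tauL_tsupport {r : ℝ} (hr : 0 < r) : (0 : X) ∉ tsupport (tauL r : X → ℝ) := by
  rw [notMem_tsupport_iff_eventuallyEq]
  have h : (0:ℝ) < min r r⁻¹ := lt_min hr (inv_pos.2 hr)
  filter_upwards [Metric.ball_mem_nhds (0 : X) h] with ξ hξ
  have hξ : ‖ξ‖ < min r r⁻¹ := by simpa using hξ
  have h1 := hξ.trans_le (min_le_left _ _)
  have h2 := hξ.trans_le (min_le_right _ _)
  have : tauL r ξ = 0 := by
    rw [tauL, rho_one, rho_one, sub_self]
    · rw [norm_smul, Real.norm_of_nonneg hr.le]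
      calc r * ‖ξ‖ ≤ r * r⁻¹ := by gcongr
        _ = 1 := mul_inv_cancel₀ hr.ne'
    · rw [norm_smul, norm_inv, Real.norm_of_nonneg hr.le, inv_mul_le_iff₀ hr]
      simpa using h1.le
  simpa using this

theorem lintegral_fourier_scale (R : SchwartzMap X ℂ) {r : ℝ} (hr : 0 < r) :
    ∫⁻ y, ‖𝓕 (fun ξ : X => R (r • ξ)) y‖ₑ = ∫⁻ y, ‖𝓕 (R : X → ℂ) y‖ₑ := by
  rw [← lintegral_comp_smul_pos (inv_pos.2 hr) (fun y => ‖𝓕 (R : X → ℂ) y‖ₑ)]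
  rw [← lintegral_const_mul' _ _ ENNReal.ofReal_ne_top]
  refine lintegral_congr fun y => ?_
  rw [fourier_scale hr, enorm_smul, Real.enorm_eq_ofReal (by positivity), inv_pow]

theorem fourier_tau_bound : ∃ K : ℝ≥0∞, K ≠ ⊤ ∧ ∀ r : ℝ, 0 < r →
    ∫⁻ y, ‖𝓕 (fun ξ : X => (tauL r ξ : ℂ)) y‖ₑ ≤ K := by
  obtain ⟨R, hR⟩ := exists_rhoS (X := X)
  have hRi : ∫⁻ y, ‖𝓕 (R : X → ℂ) y‖ₑ ≠ ⊤ := by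
    have := (𝓕 R : SchwartzMap X ℂ).integrable (μ := volume)
    rw [SchwartzMap.fourier_coe] at this
    exact this.2.ne
  have hi : ∀ {s : ℝ}, 0 < s → Integrable (fun ξ : X => R (s • ξ)) := fun hs =>
    (R.integrable (μ := volume)).comp_smul hs.ne'
  refine ⟨2 * ∫⁻ y, ‖𝓕 (R : X → ℂ) y‖ₑ, ENNReal.mul_ne_top (by simp) hRi, fun r hr => ?_⟩
  have e1 : (fun ξ : X => (tauL r ξ : ℂ)) =
      (fun ξ : X => R (r⁻¹ • ξ)) + -(fun ξ : X => R (r • ξ)) := by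
    ext ξ; simp [tauL, hR, sub_eq_add_neg]
  have hr' : 0 < r⁻¹ := inv_pos.2 hr
  have e2 : ∀ y, 𝓕 (fun ξ : X => (tauL r ξ : ℂ)) y =
      𝓕 (fun ξ : X => R (r⁻¹ • ξ)) y - 𝓕 (fun ξ : X => R (r • ξ)) y := by
    intro y
    have hsub := integral_sub ((Real.fourierIntegral_convergent_iff y).2 (hi hr'))
      ((Real.fourierIntegral_convergent_iff y).2 (hi hr))
    rw [Real.fourier_eq, Real.fourier_eq, Real.fourier_eq, ← hsub]
    refine integral_congr_ae (Eventually.of_forall fun ξ => ?_)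
    simp only [tauL, hR, ← smul_sub, Complex.ofReal_sub]
  calc ∫⁻ y, ‖𝓕 (fun ξ : X => (tauL r ξ : ℂ)) y‖ₑ
      ≤ ∫⁻ y, (‖𝓕 (fun ξ : X => R (r⁻¹ • ξ)) y‖ₑ + ‖𝓕 (fun ξ : X => R (r • ξ)) y‖ₑ) := by
        refine lintegral_mono fun y => ?_
        rw [e2]; exact enorm_sub_le
    _ = (∫⁻ y, ‖𝓕 (fun ξ : X => R (r⁻¹ • ξ)) y‖ₑ) + ∫⁻ y, ‖𝓕 (fun ξ : X => R (r • ξ)) y‖ₑ := by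
        refine lintegral_add_left ?_ _
        have hc : Continuous (𝓕 (fun ξ : X => R (r⁻¹ • ξ))) :=
          VectorFourier.fourierIntegral_continuous Real.continuous_fourierChar
            (by exact continuous_inner) (hi hr')
        exact hc.enorm.measurable
    _ = 2 * ∫⁻ y, ‖𝓕 (R : X → ℂ) y‖ₑ := by
        rw [lintegral_fourier_scale R hr, lintegral_fourier_scale R hr', two_mul]

/-- The multiplier attached to a vector in the range of all symbols. -/
def gam {k m : ℕ} (A : DiffOperator X k V E) (e : E) (w : Fin m → X) (h : V →L[ℝ] ℝ) (ξ : X) : ℝ :=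
  (∏ i, ⟪ξ, w i⟫) * h (linv A ξ e)

theorem symbol_linv {k : ℕ} (A : DiffOperator X k V E) (hA : A.IsElliptic) {e : E}
    (he : ∀ ξ : X, ξ ≠ 0 → e ∈ Set.range (A.symbol ξ)) {ξ : X} (hξ : ξ ≠ 0) :
    A.symbol ξ (linv A ξ e) = e := by
  obtain ⟨v, hv⟩ := he ξ hξ
  rw [← hv, linv_comp A hA hξ]

theorem gam_bound_re {k m : ℕ} (A : DiffOperator X k V E) (hA : A.IsElliptic) {e : E}
    (he : ∀ ξ : X, ξ ≠ 0 → e ∈ Set.range (A.symbol ξ)) {q p : ℝ} (hq : 0 ≤ q) (hp : 0 ≤ p)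
    {K : ℝ≥0∞} (hK : K ≠ ⊤)
    (H : ∀ U : SchwartzMap X V,
      ∫⁻ x, ‖iteratedFDeriv ℝ m (U : X → V) x‖ₑ ^ q ≤ (K * ∫⁻ x, ‖A.app U x‖ₑ) ^ p)
    (w : Fin m → X) (h : V →L[ℝ] ℝ) (c : ℂ) :
    ∃ C : ℝ≥0∞, C ≠ ⊤ ∧ ∀ r : ℝ, 0 < r →
      ∫⁻ x, ‖(c * (-(2 * π * Complex.I)) ^ m *
        𝓕 (fun ξ : X => ((tauL r ξ * gam A e w h ξ : ℝ) : ℂ)) x).re‖ₑ ^ q ≤ C := by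
  obtain ⟨K1, hK1, hK1b⟩ := fourier_tau_bound (X := X)
  set B : ℝ≥0∞ := ‖c * (-(2 * π * Complex.I)) ^ k‖ₑ with hB
  set D : ℝ≥0∞ := ENNReal.ofReal (‖h‖ * ∏ i, ‖w i‖) with hD
  refine ⟨D ^ q * (K * (B * K1 * ‖e‖ₑ)) ^ p, ?_, fun r hr => ?_⟩
  · refine ENNReal.mul_ne_top (ENNReal.rpow_ne_top_of_nonneg hq ENNReal.ofReal_ne_top)
      (ENNReal.rpow_ne_top_of_nonneg hp ?_)
    exact ENNReal.mul_ne_top hK (ENNReal.mul_ne_top (ENNReal.mul_ne_top enorm_ne_top hK1)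
      enorm_ne_top)
  have hne : ∀ ξ : X, tauL r ξ ≠ 0 → ξ ≠ 0 := by
    rintro ξ h1 rfl
    exact tauL_tsupport hr (subset_tsupport _ h1)
  have hψ : ContDiff ℝ (⊤ : ℕ∞) (fun ξ : X => tauL r ξ • linv A ξ e) :=
    contDiff_cutoff (W := V) (F := fun ξ => linv A ξ e)
      (fun ξ hξ => (contDiffAt_linv A hA hξ).clm_apply contDiffAt_const) (tauL_contDiff r)
      (tauL_tsupport hr)
  obtain ⟨U, hU⟩ := exists_U_app A e (fun ξ => linv A ξ e) (tauL r) (tauL_contDiff r)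
    (tauL_compact hr) hψ (fun ξ h0 => symbol_linv A hA he (hne ξ h0)) c w h
  have hb1 : ∫⁻ x, ‖A.app U x‖ₑ ≤ B * K1 * ‖e‖ₑ := by
    calc ∫⁻ x, ‖A.app U x‖ₑ ≤ ∫⁻ x, (B * ‖e‖ₑ) * ‖𝓕 (fun ξ : X => (tauL r ξ : ℂ)) x‖ₑ := by
          refine lintegral_mono fun x => ?_
          rw [(hU x).1, enorm_smul]
          have : ‖(c * (-(2 * π * Complex.I)) ^ k * 𝓕 (fun ξ : X => (tauL r ξ : ℂ)) x).re‖ₑ ≤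
              B * ‖𝓕 (fun ξ : X => (tauL r ξ : ℂ)) x‖ₑ := by
            rw [hB, ← enorm_mul, ← ofReal_norm, ← ofReal_norm]
            exact ENNReal.ofReal_le_ofReal (Complex.abs_re_le_norm _)
          calc _ ≤ B * ‖𝓕 (fun ξ : X => (tauL r ξ : ℂ)) x‖ₑ * ‖e‖ₑ := by gcongr
            _ = _ := by ring
      _ = (B * ‖e‖ₑ) * ∫⁻ x, ‖𝓕 (fun ξ : X => (tauL r ξ : ℂ)) x‖ₑ :=
          lintegral_const_mul' _ _ (ENNReal.mul_ne_top enorm_ne_top enorm_ne_top)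
      _ ≤ (B * ‖e‖ₑ) * K1 := by gcongr; exact hK1b r hr
      _ = B * K1 * ‖e‖ₑ := by ring
  calc _ ≤ ∫⁻ x, D ^ q * ‖iteratedFDeriv ℝ m (U : X → V) x‖ₑ ^ q := by
        refine lintegral_mono fun x => ?_
        have h2 := (hU x).2
        simp only [gam]
        rw [← h2, ← ENNReal.mul_rpow_of_nonneg _ _ hq]
        refine ENNReal.rpow_le_rpow ?_ hq
        rw [hD, ← ofReal_norm, ← ofReal_norm, ← ENNReal.ofReal_mul (by positivity)]
        refine ENNReal.ofReal_le_ofReal ?_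
        calc _ ≤ ‖h‖ * ‖iteratedFDeriv ℝ m (U : X → V) x w‖ := h.le_opNorm _
          _ ≤ ‖h‖ * (‖iteratedFDeriv ℝ m (U : X → V) x‖ * ∏ i, ‖w i‖) := by
              gcongr; exact ContinuousMultilinearMap.le_opNorm _ _
          _ = _ := by ring
    _ = D ^ q * ∫⁻ x, ‖iteratedFDeriv ℝ m (U : X → V) x‖ₑ ^ q :=
        lintegral_const_mul' _ _ (ENNReal.rpow_ne_top_of_nonneg hq ENNReal.ofReal_ne_top)
    _ ≤ D ^ q * (K * (B * K1 * ‖e‖ₑ)) ^ p := by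
        refine mul_le_mul_right ((H U).trans (ENNReal.rpow_le_rpow ?_ hp)) _
        exact mul_le_mul_right hb1 _

theorem gam_bound {k m : ℕ} (A : DiffOperator X k V E) (hA : A.IsElliptic) {e : E}
    (he : ∀ ξ : X, ξ ≠ 0 → e ∈ Set.range (A.symbol ξ)) {q p : ℝ} (hq : 1 ≤ q) (hp : 0 ≤ p)
    {K : ℝ≥0∞} (hK : K ≠ ⊤)
    (H : ∀ U : SchwartzMap X V,
      ∫⁻ x, ‖iteratedFDeriv ℝ m (U : X → V) x‖ₑ ^ q ≤ (K * ∫⁻ x, ‖A.app U x‖ₑ) ^ p)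
    (w : Fin m → X) (h : V →L[ℝ] ℝ) :
    ∃ C : ℝ≥0∞, C ≠ ⊤ ∧ ∀ r : ℝ, 0 < r →
      ∫⁻ x, ‖𝓕 (fun ξ : X => ((tauL r ξ * gam A e w h ξ : ℝ) : ℂ)) x‖ₑ ^ q ≤ C := by
  have hq0 : 0 ≤ q := zero_le_one.trans hq
  set a : ℂ := (-(2 * π * Complex.I)) ^ m with ha
  have ha0 : a ≠ 0 := pow_ne_zero _ (by simp [Real.pi_ne_zero])
  obtain ⟨C1, hC1, h1⟩ := gam_bound_re A hA he hq0 hp hK H w h a⁻¹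
  obtain ⟨C2, hC2, h2⟩ := gam_bound_re A hA he hq0 hp hK H w h (-Complex.I * a⁻¹)
  rw [← ha] at h1 h2
  simp only [mul_assoc, inv_mul_cancel_left₀ ha0] at h1 h2
  have hq2 : (2 : ℝ≥0∞) ^ (q - 1) ≠ ⊤ :=
    ENNReal.rpow_ne_top_of_nonneg (by linarith) (by simp)
  refine ⟨2 ^ (q - 1) * (C1 + C2), ENNReal.mul_ne_top hq2 (ENNReal.add_ne_top.2 ⟨hC1, hC2⟩),
    fun r hr => ?_⟩
  set F : X → ℂ := 𝓕 (fun ξ : X => ((tauL r ξ * gam A e w h ξ : ℝ) : ℂ)) with hF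
  have hFc : Continuous F := by
    have hψ : ContDiff ℝ (⊤ : ℕ∞) (fun ξ : X => tauL r ξ • linv A ξ e) :=
      contDiff_cutoff (W := V) (F := fun ξ => linv A ξ e)
        (fun ξ hξ => (contDiffAt_linv A hA hξ).clm_apply contDiffAt_const) (tauL_contDiff r)
        (tauL_tsupport hr)
    have hc : Continuous (fun ξ : X => tauL r ξ * gam A e w h ξ) := by
      have : (fun ξ : X => tauL r ξ * gam A e w h ξ) =
          fun ξ => (∏ i, ⟪ξ, w i⟫) * h (tauL r ξ • linv A ξ e) := by
        ext ξ; rw [map_smul, gam]; simp only [smul_eq_mul]; ring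
      rw [this]
      exact (continuous_finsetProd _ fun i _ => by fun_prop).mul
        (h.continuous.comp hψ.continuous)
    have hi : Integrable (fun ξ : X => tauL r ξ * gam A e w h ξ) :=
      hc.integrable_of_hasCompactSupport (tauL_compact hr).mul_right
    exact VectorFourier.fourierIntegral_continuous Real.continuous_fourierChar
            (by exact continuous_inner) hi.ofReal
  have hr1 := h1 r hr
  have hr2 := h2 r hr
  simp only [← hF] at hr1 hr2
  calc ∫⁻ x, ‖F x‖ₑ ^ q
      ≤ ∫⁻ x, 2 ^ (q - 1) * (‖(F x).re‖ₑ ^ q + ‖(-(Complex.I) * F x).re‖ₑ ^ q) := by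
        refine lintegral_mono fun x => ?_
        refine le_trans (ENNReal.rpow_le_rpow ?_ hq0)
          (ENNReal.rpow_add_le_mul_rpow_add_rpow _ _ hq)
        rw [← ofReal_norm, ← ofReal_norm, ← ofReal_norm,
          ← ENNReal.ofReal_add (norm_nonneg _) (norm_nonneg _)]
        refine ENNReal.ofReal_le_ofReal ?_
        have e2 : (-(Complex.I) * F x).re = (F x).im := by simp
        rw [e2]
        exact Complex.norm_le_abs_re_add_abs_im _
    _ = 2 ^ (q - 1) * ∫⁻ x, (‖(F x).re‖ₑ ^ q + ‖(-(Complex.I) * F x).re‖ₑ ^ q) :=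
        lintegral_const_mul' _ _ hq2
    _ = 2 ^ (q - 1) * ((∫⁻ x, ‖(F x).re‖ₑ ^ q) + ∫⁻ x, ‖(-(Complex.I) * F x).re‖ₑ ^ q) := by
        congr 1
        refine lintegral_add_left ?_ _
        exact ((Complex.continuous_re.comp hFc).enorm.measurable).pow_const _
    _ ≤ 2 ^ (q - 1) * (C1 + C2) := by
        refine mul_le_mul_right (add_le_add ?_ ?_) _
        · exact hr1
        · exact hr2

end uniformBound

section dyadicTest
open Filter Topology FourierTransform Real

variable {X : Type} [NormedAddCommGroup X] [InnerProductSpace ℝ X] [FiniteDimensional ℝ X]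
  [MeasurableSpace X] [BorelSpace X]

theorem dyadic_sum_bound {l : ℕ} (hl : 1 ≤ l) (Φ : SchwartzMap X ℂ) :
    ∃ C : ℝ≥0∞, C ≠ ⊤ ∧ ∀ x : X, x ≠ 0 →
      ∑' j : ℤ, ENNReal.ofReal (2 ^ ((j : ℝ) * l)) * ‖Φ ((2 : ℝ) ^ (j : ℝ) • x)‖ₑ ≤
        C * ENNReal.ofReal (‖x‖ ^ (-(l : ℝ))) := by
  have hl0 : (0 : ℝ) < l := by exact_mod_cast hl
  obtain ⟨C₀, hC₀, hb⟩ := schwartz_bd Φ (2 * l)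
  obtain ⟨C', hC', hg⟩ := geom_int hl0 hl0
  set B : ℝ := C₀ + 1 with hB
  have hB0 : 0 < B := by positivity
  refine ⟨C' * ENNReal.ofReal B, ENNReal.mul_ne_top hC' ENNReal.ofReal_ne_top, fun x hx => ?_⟩
  have hx0 : 0 < ‖x‖ := norm_pos_iff.2 hx
  have hb2 : 0 < B * ‖x‖ ^ (-(2 * l : ℝ)) := by positivity
  refine le_trans (ENNReal.tsum_le_tsum fun j => ?_) ((hg B _ hB0 hb2).trans (le_of_eq ?_))
  · rw [← ofReal_norm, ← ENNReal.ofReal_mul (by positivity)]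
    refine ENNReal.ofReal_le_ofReal ?_
    set t : ℝ := (2 : ℝ) ^ (j : ℝ) with ht
    have ht0 : 0 < t := by positivity
    have htl : (2 : ℝ) ^ ((j : ℝ) * l) = t ^ (l : ℝ) := by rw [ht, ← Real.rpow_mul (by norm_num)]
    have htl2 : (2 : ℝ) ^ (-((j : ℝ) * l)) = t ^ (-(l : ℝ)) := by
      rw [ht, ← Real.rpow_mul (by norm_num)]; ring_nf
    have hn : ‖t • x‖ = t * ‖x‖ := by rw [norm_smul, Real.norm_of_nonneg ht0.le]
    have h1 := hb (t • x)
    rw [hn] at h1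
    have hpos : 0 < t * ‖x‖ := by positivity
    rw [htl, htl2]
    refine le_min ?_ ?_
    · have h2 : ‖Φ (t • x)‖ ≤ B := by
        refine h1.trans ((div_le_self hC₀ (one_le_pow₀ (by linarith))).trans (by linarith))
      calc t ^ (l : ℝ) * ‖Φ (t • x)‖ ≤ t ^ (l : ℝ) * B := by gcongr
        _ = _ := mul_comm _ _
    · have h2 : ‖Φ (t • x)‖ ≤ B * (t * ‖x‖) ^ (-(2 * l : ℝ)) := by
        refine h1.trans ?_
        have e : (t * ‖x‖) ^ (-(2 * l : ℝ)) = ((t * ‖x‖) ^ (2 * l))⁻¹ := by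
          rw [Real.rpow_neg hpos.le, ← Real.rpow_natCast]; push_cast; rfl
        rw [e, div_eq_mul_inv]
        gcongr
        · linarith
        · linarith
      calc t ^ (l : ℝ) * ‖Φ (t • x)‖ ≤ t ^ (l : ℝ) * (B * (t * ‖x‖) ^ (-(2 * l : ℝ))) := by gcongr
        _ = B * ‖x‖ ^ (-(2 * l : ℝ)) * (t ^ (l : ℝ) * t ^ (-(2 * l : ℝ))) := by
            rw [Real.mul_rpow ht0.le hx0.le]; ring
        _ = _ := by rw [← Real.rpow_add ht0]; ring_nf
  · have e : (l : ℝ) / (l + l) = 1 / 2 := by field_simp; ring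
    rw [e, mul_assoc C', ← ENNReal.ofReal_mul hB0.le]
    congr 2
    rw [Real.mul_rpow hB0.le (by positivity), ← mul_assoc, ← Real.rpow_add hB0,
      ← Real.rpow_mul hx0.le]
    have e3 : (1 / 2 : ℝ) + 1 / 2 = 1 := by norm_num
    have e4 : -(2 * l : ℝ) * (1 / 2) = -(l : ℝ) := by ring
    rw [e3, e4, Real.rpow_one]

theorem weighted_finite [Nontrivial X] {n l : ℕ} (hl : 1 ≤ l) (hln : l ≤ n - 1)
    (hX : Module.finrank ℝ X = n) (Φ : SchwartzMap X ℂ) :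
    ∫⁻ y : X, ENNReal.ofReal (‖y‖ ^ (-((n : ℝ) - l))) * ‖Φ y‖ₑ ≠ ⊤ := by
  obtain ⟨C₀, hC₀, hb⟩ := schwartz_bd Φ (n + 1)
  have hIntg : Integrable (fun y : X => (fun r : ℝ => r ^ (-((n : ℝ) - l)) / (1 + r) ^ (n + 1)) ‖y‖)
      volume := by
    rw [integrable_fun_norm_addHaar (μ := (volume : Measure X))
      (f := fun r : ℝ => r ^ (-((n : ℝ) - l)) / (1 + r) ^ (n + 1))]
    rw [hX]
    refine Integrable.mono' (integrable_inv_one_add_sq.integrableOn) ?_ ?_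
    · have hm : Measurable fun r : ℝ => r ^ (n - 1) • (r ^ (-((n : ℝ) - l)) / (1 + r) ^ (n + 1)) := by
        fun_prop
      exact hm.aestronglyMeasurable
    · filter_upwards [ae_restrict_mem measurableSet_Ioi] with r hr
      have hr : 0 < r := hr
      have e1 : r ^ (n - 1) * r ^ (-((n : ℝ) - l)) = r ^ (l - 1) := by
        rw [← Real.rpow_natCast, ← Real.rpow_natCast, ← Real.rpow_add hr]
        congr 1
        have hn1 : 1 ≤ n := by omega
        rw [Nat.cast_sub hn1, Nat.cast_sub hl]
        push_cast; ring
      rw [smul_eq_mul, ← mul_div_assoc, e1, Real.norm_of_nonneg (by positivity),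
        inv_eq_one_div, div_le_div_iff₀ (by positivity) (by positivity)]
      have e2 : (1 + r) ^ (n + 1) = (1 + r) ^ (n - 1) * (1 + r) ^ 2 := by
        rw [← pow_add]; congr 1; omega
      rw [e2, one_mul]
      refine mul_le_mul ?_ (by nlinarith) (by positivity) (by positivity)
      calc r ^ (l - 1) ≤ (1 + r) ^ (l - 1) := by gcongr; linarith
        _ ≤ (1 + r) ^ (n - 1) := pow_le_pow_right₀ (by linarith) (by omega)
  have hfin := (hIntg.const_mul C₀).lintegral_lt_top
  refine (lt_of_le_of_lt (lintegral_mono fun y => ?_) hfin).ne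
  rw [← ofReal_norm, ← ENNReal.ofReal_mul (by positivity)]
  refine ENNReal.ofReal_le_ofReal ?_
  calc _ ≤ ‖y‖ ^ (-((n : ℝ) - l)) * (C₀ / (1 + ‖y‖) ^ (n + 1)) := by gcongr; exact hb y
    _ = _ := by ring

theorem weighted_scale {n l : ℕ} (hX : Module.finrank ℝ X = n) (Φ : SchwartzMap X ℂ) (j : ℤ) :
    ∫⁻ x : X, ENNReal.ofReal (‖x‖ ^ (-((n : ℝ) - l))) *
      (ENNReal.ofReal (2 ^ ((j : ℝ) * l)) * ‖Φ ((2 : ℝ) ^ (j : ℝ) • x)‖ₑ) =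
    ∫⁻ y : X, ENNReal.ofReal (‖y‖ ^ (-((n : ℝ) - l))) * ‖Φ y‖ₑ := by
  set t : ℝ := (2 : ℝ) ^ (j : ℝ) with ht
  have ht0 : 0 < t := by positivity
  have htl : (2 : ℝ) ^ ((j : ℝ) * l) = t ^ (l : ℝ) := by rw [ht, ← Real.rpow_mul (by norm_num)]
  conv_rhs => rw [← lintegral_comp_smul_pos ht0, hX,
    ← lintegral_const_mul' _ _ ENNReal.ofReal_ne_top]
  refine lintegral_congr fun x => ?_
  rw [← mul_assoc, ← mul_assoc, ← ENNReal.ofReal_mul (by positivity),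
    ← ENNReal.ofReal_mul (by positivity)]
  congr 2
  rw [norm_smul, Real.norm_of_nonneg ht0.le, Real.mul_rpow ht0.le (norm_nonneg _), htl,
    ← Real.rpow_natCast t n]
  have e5 : t ^ (n : ℝ) * t ^ (-((n : ℝ) - l)) = t ^ (l : ℝ) := by
    rw [← Real.rpow_add ht0]; ring_nf
  rw [← mul_assoc, e5, mul_comm]

/-- Upper bound for the dyadic test functions. -/
theorem dyadic_test_bound [Nontrivial X] {n l : ℕ} (hl : 1 ≤ l) (hln : l ≤ n - 1)
    (hX : Module.finrank ℝ X = n) (Φ : SchwartzMap X ℂ) :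
    ∃ C : ℝ≥0∞, C ≠ ⊤ ∧ ∀ J : Finset ℤ,
      ∫⁻ x : X, (∑ j ∈ J, ENNReal.ofReal (2 ^ ((j : ℝ) * l)) * ‖Φ ((2 : ℝ) ^ (j : ℝ) • x)‖ₑ) ^
        ((n : ℝ) / l) ≤ C * J.card := by
  have hl0 : (0 : ℝ) < l := by exact_mod_cast hl
  have hn1 : 1 ≤ n := by omega
  have hnl : (l : ℝ) + 1 ≤ n := by
    have : l + 1 ≤ n := by omega
    exact_mod_cast this
  obtain ⟨C1, hC1, h1⟩ := dyadic_sum_bound hl Φ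
  set I : ℝ≥0∞ := ∫⁻ y : X, ENNReal.ofReal (‖y‖ ^ (-((n : ℝ) - l))) * ‖Φ y‖ₑ with hI
  have hIf : I ≠ ⊤ := weighted_finite hl hln hX Φ
  set s : ℝ := (n : ℝ) / l with hs
  have hs1 : 0 < s - 1 := by
    rw [hs, sub_pos, lt_div_iff₀ hl0]; linarith
  have hC1s : C1 ^ (s - 1) ≠ ⊤ := ENNReal.rpow_ne_top_of_nonneg hs1.le hC1
  refine ⟨C1 ^ (s - 1) * I, ENNReal.mul_ne_top hC1s hIf, fun J => ?_⟩
  set f : ℤ → X → ℝ≥0∞ := fun j x =>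
    ENNReal.ofReal (2 ^ ((j : ℝ) * l)) * ‖Φ ((2 : ℝ) ^ (j : ℝ) • x)‖ₑ with hf
  have hfm : ∀ j, Measurable (f j) := by
    intro j
    have : Continuous fun x : X => ‖Φ ((2 : ℝ) ^ (j : ℝ) • x)‖ₑ :=
      (Φ.continuous.comp (continuous_const_smul _)).enorm
    exact this.measurable.const_mul _
  have hwm : Measurable fun x : X => ENNReal.ofReal (‖x‖ ^ (-((n : ℝ) - l))) :=
    (measurable_norm.pow_const _).ennreal_ofReal
  have hae : ∀ᵐ x : X, x ≠ 0 := by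
    simp [ae_iff]
  calc ∫⁻ x : X, (∑ j ∈ J, f j x) ^ s
      ≤ ∫⁻ x : X, C1 ^ (s - 1) *
        ∑ j ∈ J, ENNReal.ofReal (‖x‖ ^ (-((n : ℝ) - l))) * f j x := by
        refine lintegral_mono_ae ?_
        filter_upwards [hae] with x hx
        have hx0 : 0 < ‖x‖ := norm_pos_iff.2 hx
        have hS : ∑ j ∈ J, f j x ≤ C1 * ENNReal.ofReal (‖x‖ ^ (-(l : ℝ))) :=
          (ENNReal.sum_le_tsum J).trans (h1 x hx)
        have e1 : (∑ j ∈ J, f j x) ^ s = (∑ j ∈ J, f j x) ^ (s - 1) * ∑ j ∈ J, f j x := by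
          conv_rhs => rw [← ENNReal.rpow_one (∑ j ∈ J, f j x), ← ENNReal.rpow_mul, one_mul]
          rw [← ENNReal.rpow_add_of_nonneg _ _ hs1.le zero_le_one]
          ring_nf
        have e2 : (C1 * ENNReal.ofReal (‖x‖ ^ (-(l : ℝ)))) ^ (s - 1) =
            C1 ^ (s - 1) * ENNReal.ofReal (‖x‖ ^ (-((n : ℝ) - l))) := by
          rw [ENNReal.mul_rpow_of_nonneg _ _ hs1.le,
            ENNReal.ofReal_rpow_of_nonneg (by positivity) hs1.le, ← Real.rpow_mul hx0.le]
          congr 3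
          rw [hs]; field_simp
        rw [e1, ← Finset.mul_sum, ← mul_assoc, ← e2]
        exact mul_le_mul_left (ENNReal.rpow_le_rpow hS hs1.le) _
    _ = C1 ^ (s - 1) * ∑ j ∈ J, ∫⁻ x : X, ENNReal.ofReal (‖x‖ ^ (-((n : ℝ) - l))) * f j x := by
        rw [lintegral_const_mul' _ _ hC1s]
        congr 1
        exact lintegral_finsetSum J fun j _ => hwm.mul (hfm j)
    _ = C1 ^ (s - 1) * I * J.card := by
        have : ∀ j ∈ J, ∫⁻ x : X, ENNReal.ofReal (‖x‖ ^ (-((n : ℝ) - l))) * f j x = I :=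
          fun j _ => weighted_scale hX Φ j
        rw [Finset.sum_congr rfl this, Finset.sum_const, nsmul_eq_mul]
        ring

end dyadicTest

section pairing
open Filter Topology FourierTransform Real

variable {X : Type} [NormedAddCommGroup X] [InnerProductSpace ℝ X] [FiniteDimensional ℝ X]
  [MeasurableSpace X] [BorelSpace X]
  {V E : Type*} [NormedAddCommGroup V] [InnerProductSpace ℝ V]
  [FiniteDimensional ℝ V] [NormedAddCommGroup E] [InnerProductSpace ℝ E] [FiniteDimensional ℝ E]

theorem symbol_smul {k : ℕ} (A : DiffOperator X k V E) (t : ℝ) (ξ : X) (v : V) :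
    A.symbol (t • ξ) v = t ^ k • A.symbol ξ v := by
  rw [symbol_eq, symbol_eq, ← map_smul]
  congr 1
  ext w
  rw [smul_apply, tens_apply, tens_apply, smul_smul]
  congr 1
  simp only [real_inner_smul_left, Finset.prod_mul_distrib, Finset.prod_const, Finset.card_univ,
    Fintype.card_fin]

theorem gam_homog {k m l : ℕ} (hk : k = m + l) (A : DiffOperator X k V E) (hA : A.IsElliptic)
    {e : E} (he : ∀ ξ : X, ξ ≠ 0 → e ∈ Set.range (A.symbol ξ)) (w : Fin m → X) (h : V →L[ℝ] ℝ)
    {t : ℝ} (ht : 0 < t) {ξ : X} (hξ : ξ ≠ 0) :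
    gam A e w h (t • ξ) = (t ^ l)⁻¹ * gam A e w h ξ := by
  have h1 : linv A (t • ξ) e = (t ^ k)⁻¹ • linv A ξ e := by
    have h2 : A.symbol (t • ξ) ((t ^ k)⁻¹ • linv A ξ e) = e := by
      rw [symbol_smul, map_smul, symbol_linv A hA he hξ, smul_smul,
        mul_inv_cancel₀ (by positivity), one_smul]
    conv_lhs => rw [← h2]
    exact linv_comp A hA (smul_ne_zero ht.ne' hξ) _
  have h3 : t ^ k = t ^ m * t ^ l := by rw [hk, pow_add]
  have h4 : (∏ i, ⟪t • ξ, w i⟫) = t ^ m * ∏ i, ⟪ξ, w i⟫ := by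
    simp only [real_inner_smul_left, Finset.prod_mul_distrib, Finset.prod_const, Finset.card_univ,
      Fintype.card_fin]
  rw [gam, gam, h1, h3, h4, map_smul, smul_eq_mul]
  field_simp

theorem cut_gam_continuous {k m : ℕ} (A : DiffOperator X k V E) (hA : A.IsElliptic) (e : E)
    (w : Fin m → X) (h : V →L[ℝ] ℝ) {χ : X → ℝ} (hχ : ContDiff ℝ (⊤ : ℕ∞) χ)
    (h0 : 0 ∉ tsupport χ) : Continuous (fun ξ : X => χ ξ * gam A e w h ξ) := by
  have hψ : ContDiff ℝ (⊤ : ℕ∞) (fun ξ : X => χ ξ • linv A ξ e) :=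
    contDiff_cutoff (W := V) (F := fun ξ => linv A ξ e)
      (fun ξ hξ => (contDiffAt_linv A hA hξ).clm_apply contDiffAt_const) hχ h0
  have : (fun ξ : X => χ ξ * gam A e w h ξ) =
      fun ξ => (∏ i, ⟪ξ, w i⟫) * h (χ ξ • linv A ξ e) := by
    ext ξ; rw [map_smul, gam]; simp only [smul_eq_mul]; ring
  rw [this]
  exact (continuous_finsetProd _ fun i _ => by fun_prop).mul (h.continuous.comp hψ.continuous)

theorem exists_test [Nontrivial X] {k : ℕ} (m : ℕ) (A : DiffOperator X k V E) (hA : A.IsElliptic)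
    {e : E} (he0 : e ≠ 0) (he : ∀ ξ : X, ξ ≠ 0 → e ∈ Set.range (A.symbol ξ)) :
    ∃ (w : Fin m → X) (h : V →L[ℝ] ℝ) (φ : SchwartzMap X ℂ) (c : ℝ), 0 < c ∧
      (∀ η, 𝓕 (φ : X → ℂ) η ≠ 0 → 1 / 2 ≤ ‖η‖ ∧ ‖η‖ ≤ 3 / 2) ∧
      ∫ η, (gam A e w h η : ℂ) * 𝓕 (φ : X → ℂ) η = c := by
  obtain ⟨ξ₀, hξ₀⟩ := exists_norm_eq X zero_le_one
  have hξ0 : ξ₀ ≠ 0 := by rw [← norm_pos_iff, hξ₀]; exact one_pos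
  set v := linv A ξ₀ e with hv
  have hv0 : v ≠ 0 := by
    intro h0
    have := symbol_linv A hA he hξ0
    rw [← hv, h0, map_zero] at this
    exact he0 this.symm
  set w : Fin m → X := fun _ => ξ₀ with hw
  set h : V →L[ℝ] ℝ := innerSL ℝ v with hh
  have hg0 : 0 < gam A e w h ξ₀ := by
    have h1 : h v = ‖v‖ ^ 2 := by rw [hh, innerSL_apply_apply, real_inner_self_eq_norm_sq]
    rw [gam, ← hv, h1]
    have h2 : (∏ i, ⟪ξ₀, w i⟫) = (1 : ℝ) := by
      simp [hw, real_inner_self_eq_norm_sq, hξ₀]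
    rw [h2]
    have := norm_pos_iff.2 hv0
    positivity
  have hcg : ContinuousAt (gam A e w h) ξ₀ := by
    have h1 : ContinuousAt (fun ξ => linv A ξ e) ξ₀ :=
      ((contDiffAt_linv A hA hξ0).clm_apply contDiffAt_const).continuousAt
    have h2 : Continuous (fun ξ : X => ∏ i, ⟪ξ, w i⟫) :=
      continuous_finsetProd _ fun i _ => by fun_prop
    exact h2.continuousAt.mul (h.continuous.continuousAt.comp h1)
  obtain ⟨δ, hδ, hball⟩ := Metric.eventually_nhds_iff_ball.1 (hcg.eventually (lt_mem_nhds hg0))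
  set R : ℝ := min δ (1 / 2) with hR
  have hR0 : 0 < R := lt_min hδ (by norm_num)
  let b : ContDiffBump ξ₀ := ⟨R / 2, R, by positivity, by linarith⟩
  have hbs : ∀ η, b η ≠ 0 → dist η ξ₀ < R := by
    intro η hη
    by_contra hcon
    exact hη (b.zero_of_le_dist (not_lt.1 hcon))
  have hnorm : ∀ η, dist η ξ₀ ≤ R → 1 / 2 ≤ ‖η‖ ∧ ‖η‖ ≤ 3 / 2 := by
    intro η hη
    have h1 : dist η ξ₀ ≤ 1 / 2 := hη.trans (min_le_right _ _)
    rw [dist_eq_norm] at h1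
    have h2 := norm_sub_norm_le η ξ₀
    have h3 := norm_sub_norm_le ξ₀ η
    rw [norm_sub_rev] at h3
    constructor <;> linarith
  have hbc : ContDiff ℝ (⊤ : ℕ∞) (b : X → ℝ) := b.contDiff
  have hts : (0 : X) ∉ tsupport (b : X → ℝ) := by
    rw [b.tsupport_eq]
    intro h0
    have := (hnorm 0 h0).1
    norm_num at this
  have hcs : HasCompactSupport (fun η : X => ((b η : ℝ) : ℂ)) :=
    b.hasCompactSupport.comp_left (g := fun x : ℝ => (x : ℂ)) Complex.ofReal_zero
  have hcd : ContDiff ℝ (⊤ : ℕ∞) (fun η : X => ((b η : ℝ) : ℂ)) :=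
    Complex.ofRealCLM.contDiff.comp hbc
  obtain ⟨Ψ, hΨ⟩ : ∃ Ψ : SchwartzMap X ℂ, ∀ η, Ψ η = ((b η : ℝ) : ℂ) :=
    ⟨hcs.toSchwartzMap hcd, fun _ => rfl⟩
  obtain ⟨φ, hφ⟩ : ∃ φ : SchwartzMap X ℂ, ∀ η, 𝓕 (φ : X → ℂ) η = Ψ η := by
    refine ⟨𝓕⁻ Ψ, fun η => ?_⟩
    rw [← SchwartzMap.fourier_coe, FourierTransform.fourier_fourierInv_eq]
  refine ⟨w, h, φ, ∫ η, b η * gam A e w h η, ?_, ?_, ?_⟩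
  · refine Continuous.integral_pos_of_hasCompactSupport_nonneg_nonzero (x := ξ₀)
      (cut_gam_continuous A hA e w h hbc hts) b.hasCompactSupport.mul_right ?_ ?_
    · intro η
      by_cases hη : b η = 0
      · simp [hη]
      · exact mul_nonneg b.nonneg (hball η ((hbs η hη).trans_le (min_le_left _ _))).le
    · have : b ξ₀ = 1 := b.one_of_mem_closedBall (Metric.mem_closedBall_self b.rIn_pos.le)
      rw [this, one_mul]
      exact hg0.ne'
  · intro η hη
    rw [hφ, hΨ] at hη
    exact hnorm η (hbs η (by simpa using hη)).le
  · rw [← integral_complex_ofReal]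
    refine integral_congr_ae (Eventually.of_forall fun η => ?_)
    beta_reduce
    rw [hφ, hΨ]; push_cast; ring

theorem pairing_eq {k m l : ℕ} (hk : k = m + l) (A : DiffOperator X k V E) (hA : A.IsElliptic)
    {e : E} (he : ∀ ξ : X, ξ ≠ 0 → e ∈ Set.range (A.symbol ξ)) (w : Fin m → X) (h : V →L[ℝ] ℝ)
    (φ : SchwartzMap X ℂ) {c : ℝ}
    (hs : ∀ η, 𝓕 (φ : X → ℂ) η ≠ 0 → 1 / 2 ≤ ‖η‖ ∧ ‖η‖ ≤ 3 / 2)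
    (hc : ∫ η, (gam A e w h η : ℂ) * 𝓕 (φ : X → ℂ) η = c)
    {r t : ℝ} (hr : 0 < r) (ht : 0 < t) (h1 : 3 ≤ r * t) (h2 : 3 / 2 * t ≤ r) :
    ∫ x, 𝓕 (fun ξ : X => ((tauL r ξ * gam A e w h ξ : ℝ) : ℂ)) x * φ (t • x) =
      ((t ^ l)⁻¹ * c : ℝ) := by
  set f : X → ℂ := fun ξ : X => ((tauL r ξ * gam A e w h ξ : ℝ) : ℂ) with hf
  have hcont := cut_gam_continuous A hA e w h (tauL_contDiff r) (tauL_tsupport hr)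
  have hi : Integrable (fun ξ : X => tauL r ξ * gam A e w h ξ) :=
    hcont.integrable_of_hasCompactSupport (tauL_compact hr).mul_right
  have hfi : Integrable f := hi.ofReal
  have hgi : Integrable (fun x : X => φ (t • x)) :=
    (φ.integrable (μ := volume)).comp_smul ht.ne'
  have hfl : ∫ x, 𝓕 f x * φ (t • x) = ∫ ξ, f ξ * 𝓕 (fun x : X => φ (t • x)) ξ := by
    have := VectorFourier.integral_fourierIntegral_smul_eq_flip (L := innerₗ X)
      Real.continuous_fourierChar (by exact continuous_inner) hfi hgi
    rw [flip_innerₗ] at this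
    exact this
  rw [hfl]
  have e1 : ∀ ξ, f ξ * 𝓕 (fun x : X => φ (t • x)) ξ =
      (t ^ Module.finrank ℝ X)⁻¹ • (fun η => f (t • η) * 𝓕 (φ : X → ℂ) η) (t⁻¹ • ξ) := by
    intro ξ
    rw [fourier_scale ht]
    beta_reduce
    rw [smul_smul, mul_inv_cancel₀ ht.ne', one_smul, mul_smul_comm]
  rw [integral_congr_ae (Eventually.of_forall e1), integral_smul,
    Measure.integral_comp_smul volume (fun η => f (t • η) * 𝓕 (φ : X → ℂ) η) t⁻¹, inv_pow, inv_inv,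
    abs_of_pos (by positivity), smul_smul, inv_mul_cancel₀ (by positivity), one_smul,
    Complex.ofReal_mul, ← hc, ← integral_const_mul]
  refine integral_congr_ae (Eventually.of_forall fun η => ?_)
  beta_reduce
  by_cases hη : 𝓕 (φ : X → ℂ) η = 0
  · simp [hη]
  obtain ⟨ha, hb⟩ := hs η hη
  have hη0 : η ≠ 0 := by
    rw [← norm_pos_iff]; linarith
  have hn : ‖t • η‖ = t * ‖η‖ := by rw [norm_smul, Real.norm_of_nonneg ht.le]
  have hrt : 0 < r * t := by positivity
  have h3 : tauL r (t • η) = 1 := by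
    refine tauL_one hr ?_ ?_
    · rw [hn]; nlinarith
    · rw [hn]; nlinarith
  rw [hf]
  beta_reduce
  rw [h3, gam_homog hk A hA he w h ht hη0]
  push_cast
  ring

end pairing

section necessity
open Filter Topology FourierTransform Real

variable {X : Type} [NormedAddCommGroup X] [InnerProductSpace ℝ X] [FiniteDimensional ℝ X]
  [MeasurableSpace X] [BorelSpace X]
  {V E : Type*} [NormedAddCommGroup V] [InnerProductSpace ℝ V]
  [FiniteDimensional ℝ V] [NormedAddCommGroup E] [InnerProductSpace ℝ E] [FiniteDimensional ℝ E]

theorem growth_contra {c s : ℝ} (hc : 0 < c) (hs : 1 < s) {D : ℝ≥0∞} (hD : D ≠ ⊤)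
    (h : ∀ M : ℕ, ((2 * M + 1 : ℕ) : ℝ≥0∞) * ENNReal.ofReal c ≤
      D * ((2 * M + 1 : ℕ) : ℝ≥0∞) ^ (1 / s)) : False := by
  have hs0 : 0 < s := by linarith
  have hs1 : 0 < 1 - 1 / s := by
    rw [sub_pos, div_lt_one hs0]; exact hs
  have hreal : ∀ M : ℕ, ((2 * M + 1 : ℕ) : ℝ) ^ (1 - 1 / s) ≤ D.toReal / c := by
    intro M
    have hN0 : (0 : ℝ) < ((2 * M + 1 : ℕ) : ℝ) := by positivity
    have h1 := ENNReal.toReal_mono (ENNReal.mul_ne_top hD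
      (ENNReal.rpow_ne_top_of_nonneg (by positivity) (ENNReal.natCast_ne_top _))) (h M)
    rw [ENNReal.toReal_mul, ENNReal.toReal_mul, ENNReal.toReal_ofReal hc.le,
      ← ENNReal.toReal_rpow, ENNReal.toReal_natCast] at h1
    rw [Real.rpow_sub hN0, Real.rpow_one, le_div_iff₀ hc, div_mul_eq_mul_div,
      div_le_iff₀ (by positivity)]
    exact h1
  have ht : Tendsto (fun M : ℕ => ((2 * M + 1 : ℕ) : ℝ) ^ (1 - 1 / s)) atTop atTop := by
    refine (tendsto_rpow_atTop hs1).comp (tendsto_natCast_atTop_atTop.comp ?_)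
    exact tendsto_atTop_mono (fun M => (by omega : M ≤ 2 * M + 1)) tendsto_id
  obtain ⟨M, hM⟩ := (ht.eventually (eventually_gt_atTop (D.toReal / c))).exists
  exact absurd (hreal M) (not_le.2 hM)

/-- Necessity of the canceling condition. -/
theorem necessity [Nontrivial X] {n k m l : ℕ} (hl : 1 ≤ l) (hln : l ≤ n - 1)
    (hX : Module.finrank ℝ X = n) (hk : k = m + l) (A : DiffOperator X k V E)
    (hA : A.IsElliptic) {C : ℝ}
    (H : ∀ u : X → V, IsTestFun u →
      (∫⁻ x, ‖iteratedFDeriv ℝ m u x‖ₑ ^ ((n : ℝ) / ((n : ℝ) - l))) ^ (1 - (l : ℝ) / n) ≤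
        ENNReal.ofReal C * (∫⁻ x, ‖A.app u x‖ₑ)) : A.IsCanceling := by
  have hl0 : (0 : ℝ) < l := by exact_mod_cast hl
  have hnl : (l : ℝ) + 1 ≤ n := by
    have : l + 1 ≤ n := by omega
    exact_mod_cast this
  have hn0 : (0 : ℝ) < n := by linarith
  set q : ℝ := (n : ℝ) / ((n : ℝ) - l) with hq
  set s : ℝ := (n : ℝ) / l with hs
  have hq1 : 1 < q := by rw [hq, lt_div_iff₀ (by linarith)]; linarith
  have hs1 : 1 < s := by rw [hs, lt_div_iff₀ hl0]; linarith
  have hconj : q.HolderConjugate s := by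
    rw [Real.holderConjugate_iff]
    refine ⟨hq1, ?_⟩
    rw [hq, hs, inv_div, inv_div, ← add_div]
    field_simp
    ring
  have hpow : 0 < 1 - (l : ℝ) / n := by
    rw [sub_pos, div_lt_one hn0]; linarith
  set p : ℝ := (1 - (l : ℝ) / n)⁻¹ with hp
  have hp0 : 0 < p := inv_pos.2 hpow
  have H2 : ∀ u : X → V, IsTestFun u →
      ∫⁻ x, ‖iteratedFDeriv ℝ m u x‖ₑ ^ q ≤ (ENNReal.ofReal C * ∫⁻ x, ‖A.app u x‖ₑ) ^ p := by
    intro u hu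
    have h1 := ENNReal.rpow_le_rpow (H u hu) hp0.le
    rwa [← ENNReal.rpow_mul, hp, mul_inv_cancel₀ hpow.ne', ENNReal.rpow_one] at h1
  have H3 := extend_schwartz A ENNReal.ofReal_ne_top H2
  by_contra hcan
  have hex : ∃ e : E, e ≠ 0 ∧ ∀ ξ : X, ξ ≠ 0 → e ∈ Set.range (A.symbol ξ) := by
    by_contra hne
    push Not at hne
    apply hcan
    unfold DiffOperator.IsCanceling
    ext e
    simp only [Set.mem_iInter, Set.mem_singleton_iff]
    constructor
    · intro h1
      by_contra he
      obtain ⟨ξ, hξ, hξ2⟩ := hne e he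
      exact hξ2 (h1 ξ hξ)
    · rintro rfl ξ _
      exact ⟨0, map_zero _⟩
  obtain ⟨e, he0, he⟩ := hex
  obtain ⟨w, h, φ, c, hc, hsupp, hIntg⟩ := exists_test m A hA he0 he
  obtain ⟨C1, hC1, hb1⟩ := gam_bound A hA he hq1.le hp0.le ENNReal.ofReal_ne_top H3 w h
  obtain ⟨C2, hC2, hb2⟩ := dyadic_test_bound hl hln hX φ
  have hq0 : 0 < q := by linarith
  have hs0 : 0 < s := by linarith
  refine growth_contra hc hs1 (D := C1 ^ (1 / q) * C2 ^ (1 / s)) (ENNReal.mul_ne_top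
    (ENNReal.rpow_ne_top_of_nonneg (by positivity) hC1)
    (ENNReal.rpow_ne_top_of_nonneg (by positivity) hC2)) fun M => ?_
  set J : Finset ℤ := Finset.Icc (-(M : ℤ)) M with hJ
  have hcard : J.card = 2 * M + 1 := by
    rw [hJ, Int.card_Icc]; omega
  set r : ℝ := (2 : ℝ) ^ ((M : ℝ) + 2) with hr
  have hr0 : 0 < r := by positivity
  set F : X → ℂ := 𝓕 (fun ξ : X => ((tauL r ξ * gam A e w h ξ : ℝ) : ℂ)) with hF
  have hFc : Continuous F := by
    have hi : Integrable (fun ξ : X => tauL r ξ * gam A e w h ξ) :=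
      (cut_gam_continuous A hA e w h (tauL_contDiff r)
        (tauL_tsupport hr0)).integrable_of_hasCompactSupport (tauL_compact hr0).mul_right
    exact VectorFourier.fourierIntegral_continuous Real.continuous_fourierChar
            (by exact continuous_inner) hi.ofReal
  set g : ℤ → X → ℝ≥0∞ := fun j x =>
    ENNReal.ofReal (2 ^ ((j : ℝ) * l)) * ‖φ ((2 : ℝ) ^ (j : ℝ) • x)‖ₑ with hg
  have hgm : ∀ j, Measurable (g j) := by
    intro j
    have : Continuous fun x : X => ‖φ ((2 : ℝ) ^ (j : ℝ) • x)‖ₑ :=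
      (φ.continuous.comp (continuous_const_smul _)).enorm
    exact this.measurable.const_mul _
  have hFm : Measurable fun x => ‖F x‖ₑ := hFc.enorm.measurable
  have hterm : ∀ j ∈ J, ENNReal.ofReal c ≤ ∫⁻ x, ‖F x‖ₑ * g j x := by
    intro j hj
    rw [hJ, Finset.mem_Icc] at hj
    have hj1 : -(M : ℝ) ≤ (j : ℝ) := by exact_mod_cast hj.1
    have hj2 : (j : ℝ) ≤ M := by exact_mod_cast hj.2
    set t : ℝ := (2 : ℝ) ^ (j : ℝ) with ht
    have ht0 : 0 < t := by positivity
    have htl : (2 : ℝ) ^ ((j : ℝ) * l) = t ^ l := by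
      rw [ht, Real.rpow_mul (by norm_num), Real.rpow_natCast]
    have h4 : (2 : ℝ) ^ (2 : ℝ) = 4 := by norm_num
    have ha : 3 ≤ r * t := by
      have : (4 : ℝ) ≤ r * t := by
        rw [hr, ht, ← Real.rpow_add (by norm_num), ← h4]
        exact Real.rpow_le_rpow_of_exponent_le (by norm_num) (by linarith)
      linarith
    have hb : 3 / 2 * t ≤ r := by
      have : (4 : ℝ) * t ≤ r := by
        rw [hr, ht, ← h4, ← Real.rpow_add (by norm_num)]
        exact Real.rpow_le_rpow_of_exponent_le (by norm_num) (by linarith)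
      linarith
    have hpair := pairing_eq hk A hA he w h φ hsupp hIntg hr0 ht0 ha hb
    rw [← hF] at hpair
    have e1 : ENNReal.ofReal c = ENNReal.ofReal (t ^ l) * ‖∫ x, F x * φ (t • x)‖ₑ := by
      rw [hpair, ← ofReal_norm, Complex.norm_real, Real.norm_of_nonneg (by positivity),
        ← ENNReal.ofReal_mul (by positivity), mul_inv_cancel_left₀ (by positivity)]
    calc ENNReal.ofReal c = ENNReal.ofReal (t ^ l) * ‖∫ x, F x * φ (t • x)‖ₑ := e1
      _ ≤ ENNReal.ofReal (t ^ l) * ∫⁻ x, ‖F x * φ (t • x)‖ₑ :=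
          mul_le_mul_right (enorm_integral_le_lintegral_enorm _) _
      _ = ∫⁻ x, ENNReal.ofReal (t ^ l) * ‖F x * φ (t • x)‖ₑ :=
          (lintegral_const_mul' _ _ ENNReal.ofReal_ne_top).symm
      _ = ∫⁻ x, ‖F x‖ₑ * g j x := by
          refine lintegral_congr fun x => ?_
          rw [hg]
          beta_reduce
          rw [htl, enorm_mul]
          ring
  calc ((2 * M + 1 : ℕ) : ℝ≥0∞) * ENNReal.ofReal c = ∑ j ∈ J, ENNReal.ofReal c := by
        rw [Finset.sum_const, hcard, nsmul_eq_mul]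
    _ ≤ ∑ j ∈ J, ∫⁻ x, ‖F x‖ₑ * g j x := Finset.sum_le_sum hterm
    _ = ∫⁻ x, ((fun x => ‖F x‖ₑ) * fun x => ∑ j ∈ J, g j x) x := by
        refine (lintegral_finsetSum J fun j _ => hFm.mul (hgm j)).symm.trans ?_
        refine lintegral_congr fun x => ?_
        simp only [Pi.mul_apply, Finset.mul_sum]
    _ ≤ (∫⁻ x, ‖F x‖ₑ ^ q) ^ (1 / q) * (∫⁻ x, (∑ j ∈ J, g j x) ^ s) ^ (1 / s) :=
        ENNReal.lintegral_mul_le_Lp_mul_Lq volume hconj hFm.aemeasurable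
          (Finset.measurable_fun_sum J fun j _ => hgm j).aemeasurable
    _ ≤ C1 ^ (1 / q) * (C2 * J.card) ^ (1 / s) := by
        gcongr
        · exact hb1 r hr0
        · exact hb2 J
    _ = C1 ^ (1 / q) * C2 ^ (1 / s) * ((2 * M + 1 : ℕ) : ℝ≥0∞) ^ (1 / s) := by
        rw [ENNReal.mul_rpow_of_nonneg _ _ (by positivity), hcard, mul_assoc]

end necessity

/-- Theorem: Sobolev inequality for elliptic canceling operators.
For an elliptic homogeneous operator `A(D)` of order `k` on `ℝⁿ` (`n ≥ 2`) and
`ℓ ∈ {1, …, min(k, n−1)}`, the Gagliardo–Nirenberg–Sobolev type estimate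
`(∫ |D^{k−ℓ}u|^{n/(n−ℓ)})^{1−ℓ/n} ≤ C ∫ |A(D)u|` holds for all `u ∈ C_c^∞(ℝⁿ; V)`
iff `A(D)` is canceling. -/
theorem statement0
    {V E : Type*} [NormedAddCommGroup V] [InnerProductSpace ℝ V] [FiniteDimensional ℝ V]
    [NormedAddCommGroup E] [InnerProductSpace ℝ E] [FiniteDimensional ℝ E]
    {n k ℓ : ℕ} (hn : 2 ≤ n) (hℓ1 : 1 ≤ ℓ) (hℓk : ℓ ≤ k) (hℓn : ℓ ≤ n - 1)
    (A : DiffOperator (EuclideanSpace ℝ (Fin n)) k V E) (hA : A.IsElliptic) :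
    (∃ C : ℝ, 0 < C ∧ ∀ u : EuclideanSpace ℝ (Fin n) → V, IsTestFun u →
        (∫⁻ x, (‖iteratedFDeriv ℝ (k - ℓ) u x‖₊ : ℝ≥0∞) ^ ((n : ℝ) / ((n : ℝ) - ℓ)))
            ^ (1 - (ℓ : ℝ) / n)
          ≤ ENNReal.ofReal C * ∫⁻ x, (‖A.app u x‖₊ : ℝ≥0∞))
      ↔ A.IsCanceling := by
  have hX : Module.finrank ℝ (EuclideanSpace ℝ (Fin n)) = n := finrank_euclideanSpace_fin
  haveI : Nontrivial (EuclideanSpace ℝ (Fin n)) :=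
    Module.nontrivial_of_finrank_pos (R := ℝ) (by rw [hX]; omega)
  have hk : k = (k - ℓ) + ℓ := by omega
  constructor
  · rintro ⟨C, _, hC⟩
    exact necessity hℓ1 hℓn hX hk A hA (C := C) hC
  · intro hc
    exact sufficiency hn hℓ1 hℓn hX hk A hA hc
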